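/- Theorem (Wronskian solution of the Q-system on the generalized T-hook). The Wronskian supercharacters χ_{a,s} satisfy the Q-system (χ_{a,s})² = χ_{a,s−1}·χ_{a,s+1} + χ_{a−1,s}·χ_{a+1,s} for all a, s ∈ ℤ, together with the boundary conditions: χ_{m1,n1+a} = (∏_{b∈B} z_b / ∏_{f∈F} (−z_f))^a · χ_{m1+a,n1} and χ_{m2,−n2−a} = χ_{m2+a,−n2} for all integers a ≥ 0; χ_{a,n1} = (∏_{b∈B2} z_b / ∏_{f∈F} (−z_f))^{m1−a} · ∏_{(b,f)∈B1×F}(z_b−z_f) / ∏_{(b′,b)∈B2×B1}(z_{b′}−z_b) for a ≥ m1; χ_{a,−n2} = ∏_{b∈B2} z_b^{η1−a−n2} · ∏_{(b,f)∈B2×F}(z_b−z_f) / ∏_{(b′,b)∈B2×B1}(z_{b′}−z_b) for a ≥ m2; χ_{m1,s} = ∏_{b∈B1} z_b^{s−n1} · ∏_{(b,f)∈B1×F}(z_b−z_f) / ∏_{(b′,b)∈B2×B1}(z_{b′}−z_b) for s ≥ n1; χ_{m2,s} = ∏_{b∈B2} z_b^{s−m2+η1} · ∏_{(b,f)∈B2×F}(z_b−z_f)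 / ∏_{(b′,b)∈B2×B1}(z_{b′}−z_b) for s ≤ −n2; and χ_{0,s} = 1 for all s ∈ ℤ. -/

import Mathlib

open scoped BigOperators

namespace Stmt0

/-- The integer segment tuple `⟨a,b⟩ = (a, a+1, …, b)`, empty when `b < a`. -/
def seg (a b : ℤ) : List ℤ := (List.range (b - a + 1).toNat).map (fun k => a + (k : ℤ))

/-- Product of `g x y` over ordered pairs `x ≺ y` in the list `L`. -/
def pairProd {ι : Type*} (L : List ι) (g : ι → ι → ℂ) : ℂ :=
  ∏ i : Fin L.length, ∏ j : Fin L.length, if i < j then g (L.get i) (L.get j) else 1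

/-- Product of `g x` over a list. -/
def prodL {ι : Type*} (L : List ι) (g : ι → ℂ) : ℂ := (L.map g).prod

/-- Product of `g x y` over pairs `(x, y) ∈ L × M`. -/
def prodLL {ι : Type*} (L M : List ι) (g : ι → ι → ℂ) : ℂ :=
  (L.map (fun x => (M.map (g x)).prod)).prod

/-- Determinant of the square matrix whose rows and columns are labelled by the given
key lists (by convention `0` if the two lists have different lengths). -/
noncomputable def listDet {α β : Type*} (rows : List α) (cols : List β) (e : α → β → ℂ) : ℂ :=
  if h : rows.length = cols.length then
    Matrix.det (Matrix.of fun i j : Fin rows.length =>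
      e (rows.get i) (cols.get (Fin.cast h j)))
  else 0

/-- The sparse determinant `Δ^{B1,B2,R,(η)}_{F,S,T1,T2}`. -/
noncomputable def Delta {ι : Type*} (z : ι → ℂ) (B1 B2 F : List ι)
    (R S T1 T2 : List ℤ) (η : ℤ) : ℂ :=
  listDet
    ((B1.map (Sum.inl : ι → ι ⊕ (ι ⊕ ℤ)) ++
      B2.map (fun b => (Sum.inr (Sum.inl b) : ι ⊕ (ι ⊕ ℤ))) ++
      R.map (fun r => (Sum.inr (Sum.inr r) : ι ⊕ (ι ⊕ ℤ)))))
    ((F.map (Sum.inl : ι → ι ⊕ (ℤ ⊕ (ℤ ⊕ ℤ))) ++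
      S.map (fun j => (Sum.inr (Sum.inl j) : ι ⊕ (ℤ ⊕ (ℤ ⊕ ℤ)))) ++
      T1.map (fun j => (Sum.inr (Sum.inr (Sum.inl j)) : ι ⊕ (ℤ ⊕ (ℤ ⊕ ℤ)))) ++
      T2.map (fun j => (Sum.inr (Sum.inr (Sum.inr j)) : ι ⊕ (ℤ ⊕ (ℤ ⊕ ℤ))))))
    (fun row col =>
      match row, col with
      | Sum.inl b, Sum.inl f => 1 / (z b - z f)
      | Sum.inl b, Sum.inr (Sum.inl j) => z b ^ (j - 1)
      | Sum.inl b, Sum.inr (Sum.inr (Sum.inl j)) => z b ^ (j - 1)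
      | Sum.inl _, Sum.inr (Sum.inr (Sum.inr _)) => 0
      | Sum.inr (Sum.inl b), Sum.inl f => (-z f / z b) ^ η / (z b - z f)
      | Sum.inr (Sum.inl b), Sum.inr (Sum.inl j) => z b ^ (j - 1)
      | Sum.inr (Sum.inl _), Sum.inr (Sum.inr (Sum.inl _)) => 0
      | Sum.inr (Sum.inl b), Sum.inr (Sum.inr (Sum.inr j)) => z b ^ (j - 1)
      | Sum.inr (Sum.inr r), Sum.inl f => (-z f) ^ (r - 1)
      | Sum.inr (Sum.inr _), Sum.inr _ => 0)

/-- The denominator formula `D(B|F)`. -/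
noncomputable def Dden {ι : Type*} (z : ι → ℂ) (B F : List ι) : ℂ :=
  pairProd B (fun b b' => z b - z b') * pairProd F (fun f f' => z f' - z f) /
    prodLL B F (fun b f => z b - z f)

/-- `χ` is the Wronskian supercharacter family for the data `(z, B1, B2, F1, F2)`:
it vanishes outside the generalized T-hook and is given by the eight regional
sparse determinant formulas inside the hook. -/
def IsChi {ι : Type*} (z : ι → ℂ) (B1 B2 F1 F2 : List ι) (χ : ℤ → ℤ → ℂ) : Prop :=
  let m1 : ℤ := B1.length
  let m2 : ℤ := B2.length
  let n1 : ℤ := F1.length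
  let n2 : ℤ := F2.length
  let η1 : ℤ := m1 - n1
  let η2 : ℤ := m2 - n2
  let θ : ℤ := (m1 + m2) * (m1 + m2 - 1) / 2 + (n1 + n2) * (n1 + n2 - 1) / 2
  let F : List ι := F1 ++ F2
  let Dd : ℂ := Dden z (B1 ++ B2) F
  (∀ a s : ℤ, (a < 0 ∨ (m1 < a ∧ n1 < s) ∨ (m2 < a ∧ s < -n2)) → χ a s = 0) ∧
  (∀ a s : ℤ, s + η1 ≤ a → -s + η2 ≤ a → 0 ≤ a → -η1 ≤ s → s ≤ η2 →
    χ a s = (-1 : ℂ) ^ ((s + η1) * (s + n2) + θ) *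
      Delta z B1 B2 F [] [] (seg 1 (s + η1)) (seg (s - a + η1 + 1) (-a + η1 + η2))
        (a - s - η1) / Dd) ∧
  (∀ a s : ℤ, s + η1 ≤ a → -s + η2 ≤ a → 0 ≤ a → -η1 ≤ s → η2 ≤ s →
    χ a s = (-1 : ℂ) ^ ((s + η1) * (s + n2) + θ) *
      Delta z B1 B2 F (seg (a - s - η1 + 1) (a - η1 - η2)) [] (seg 1 (s + η1)) []
        (a - s - η1) / Dd) ∧
  (∀ a s : ℤ, s + η1 ≤ a → -s + η2 ≤ a → 0 ≤ a → s ≤ -η1 → s ≤ η2 →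
    χ a s = (-1 : ℂ) ^ ((s + η1) * m2 + θ) *
      Delta z B1 B2 F (seg 1 (-s - η1)) [] [] (seg (s - a + η1 + 1) (-a + η1 + η2))
        (a - s - η1) / Dd) ∧
  (∀ a s : ℤ, s + η1 ≤ a → -s + η2 ≤ a → 0 ≤ a → η2 ≤ s → s ≤ -η1 →
    χ a s = (-1 : ℂ) ^ ((s + η1) * m2 + θ) *
      Delta z B1 B2 F (seg 1 (-s - η1) ++ seg (a - s - η1 + 1) (a - η1 - η2)) [] [] []
        (a - s - η1) / Dd) ∧
  (∀ a s : ℤ, a ≤ s + η1 → a ≤ η1 + η2 →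
    χ a s = (-1 : ℂ) ^ (a * m2 + θ) *
      Delta z B1 B2 F [] (seg 1 (-a + η1 + η2)) (seg (s - a + η1 + 1) (s + η1)) [] 0 / Dd) ∧
  (∀ a s : ℤ, η1 + η2 ≤ a → a ≤ s + η1 →
    χ a s = (-1 : ℂ) ^ (a * (η1 + n2 + 1) + θ) *
      Delta z B1 B2 F (seg 1 (a - η1 - η2)) [] (seg (s - a + η1 + 1) (s + η1)) [] 0 / Dd) ∧
  (∀ a s : ℤ, a ≤ -s + η2 → a ≤ η1 + η2 →
    χ a s = (-1 : ℂ) ^ (a * (1 + m2) + θ) *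
      Delta z B1 B2 F [] (seg 1 (-a + η1 + η2)) [] (seg (s - a + η1 + 1) (s + η1)) 0 / Dd) ∧
  (∀ a s : ℤ, η1 + η2 ≤ a → a ≤ -s + η2 →
    χ a s = (-1 : ℂ) ^ (a * (η1 + n2) + θ) *
      Delta z B1 B2 F (seg 1 (a - η1 - η2)) [] [] (seg (s - a + η1 + 1) (s + η1)) 0 / Dd)

end Stmt0

open scoped BigOperators
namespace Stmt0

theorem listDet_ofFn {α β : Type*} {N : ℕ} (r : Fin N → α) (c : Fin N → β) (e : α → β → ℂ) :
    listDet (List.ofFn r) (List.ofFn c) e = Matrix.det (Matrix.of fun i j => e (r i) (c j)) := by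
  unfold listDet
  have h : (List.ofFn r).length = (List.ofFn c).length := by simp
  rw [dif_pos h]
  rw [← Matrix.det_submatrix_equiv_self (finCongr (List.length_ofFn (f := r)))]
  congr 1
  ext i j
  simp [Matrix.of_apply]
  rfl

theorem listDet_ne {α β : Type*} {rows : List α} {cols : List β} (e : α → β → ℂ)
    (h : rows.length ≠ cols.length) : listDet rows cols e = 0 := by
  unfold listDet; rw [dif_neg h]

theorem exists_ofFn {α : Type*} {N : ℕ} (L : List α) (h : L.length = N) :
    ∃ r : Fin N → α, L = List.ofFn r := by
  subst h; exact ⟨L.get, (List.ofFn_get L).symm⟩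

theorem listDet_transpose {α β : Type*} (rows : List α) (cols : List β) (e : α → β → ℂ) :
    listDet rows cols e = listDet cols rows (fun c r => e r c) := by
  by_cases h : rows.length = cols.length
  · obtain ⟨r, rfl⟩ := exists_ofFn rows h
    obtain ⟨c, hc⟩ := exists_ofFn cols rfl
    generalize cols.length = N at *
    subst hc
    rw [listDet_ofFn, listDet_ofFn, ← Matrix.det_transpose]
    rfl
  · rw [listDet_ne _ h, listDet_ne _ (Ne.symm h)]

theorem listDet_map {α β α' β' : Type*} (rows : List α) (cols : List β) (f : α → α') (g : β → β')
    (e : α' → β' → ℂ) :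
    listDet (rows.map f) (cols.map g) e = listDet rows cols (fun r c => e (f r) (g c)) := by
  by_cases h : rows.length = cols.length
  · obtain ⟨r, rfl⟩ := exists_ofFn rows h
    obtain ⟨c, hc⟩ := exists_ofFn cols rfl
    generalize cols.length = N at *
    subst hc
    rw [List.map_ofFn, List.map_ofFn, listDet_ofFn, listDet_ofFn]
    rfl
  · rw [listDet_ne _ h, listDet_ne]; simpa using h

theorem listDet_congr {α β : Type*} (rows : List α) (cols : List β) (e e' : α → β → ℂ)
    (h : ∀ r ∈ rows, ∀ c ∈ cols, e r c = e' r c) :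
    listDet rows cols e = listDet rows cols e' := by
  unfold listDet
  split_ifs with hl
  · congr 1
    ext i j
    exact h _ (List.get_mem _ _) _ (List.get_mem _ _)
  · rfl

theorem listDet_rowscale {α β : Type*} (rows : List α) (cols : List β) (e : α → β → ℂ)
    (l : α → ℂ) :
    listDet rows cols (fun r c => l r * e r c) = (rows.map l).prod * listDet rows cols e := by
  by_cases h : rows.length = cols.length
  · obtain ⟨r, rfl⟩ := exists_ofFn rows h
    obtain ⟨c, hc⟩ := exists_ofFn cols rfl
    generalize cols.length = N at *
    subst hc
    rw [List.map_ofFn, List.prod_ofFn, listDet_ofFn, listDet_ofFn]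
    exact Matrix.det_mul_column (fun i => l (r i)) (Matrix.of fun i j => e (r i) (c j))
  · rw [listDet_ne _ h, listDet_ne _ h]; simp

theorem listDet_colscale {α β : Type*} (rows : List α) (cols : List β) (e : α → β → ℂ)
    (l : β → ℂ) :
    listDet rows cols (fun r c => l c * e r c) = (cols.map l).prod * listDet rows cols e := by
  rw [listDet_transpose, listDet_rowscale, ← listDet_transpose]

theorem listDet_append {α β : Type*} (rows rows' : List α) (cols cols' : List β) (e : α → β → ℂ)
    (hl : rows'.length = cols'.length)
    (h : ∀ r ∈ rows', ∀ c ∈ cols, e r c = 0) :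
    listDet (rows ++ rows') (cols ++ cols') e = listDet rows cols e * listDet rows' cols' e := by
  by_cases h1 : rows.length = cols.length
  · obtain ⟨r, rfl⟩ := exists_ofFn rows h1
    obtain ⟨c, hc⟩ := exists_ofFn cols rfl
    obtain ⟨r', rfl⟩ := exists_ofFn rows' hl
    obtain ⟨c', hc'⟩ := exists_ofFn cols' rfl
    generalize cols.length = N at *
    generalize cols'.length = N' at *
    subst hc hc'
    rw [← List.ofFn_fin_append, ← List.ofFn_fin_append, listDet_ofFn, listDet_ofFn, listDet_ofFn,
      ← Matrix.det_submatrix_equiv_self finSumFinEquiv,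
      ← Matrix.det_fromBlocks_zero₂₁ _ (Matrix.of fun i j => e (r i) (c' j))]
    congr 1
    ext i j
    rcases i with i | i <;> rcases j with j | j <;>
      simp [Matrix.fromBlocks]
    exact h _ (by simp) _ (by simp)
  · rw [listDet_ne _ h1, listDet_ne, zero_mul]
    simp; omega

theorem listDet_append' {α β : Type*} (rows rows' : List α) (cols cols' : List β) (e : α → β → ℂ)
    (hl : rows.length = cols.length)
    (h : ∀ r ∈ rows, ∀ c ∈ cols', e r c = 0) :
    listDet (rows ++ rows') (cols ++ cols') e = listDet rows cols e * listDet rows' cols' e := by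
  by_cases h1 : rows'.length = cols'.length
  · rw [listDet_transpose, listDet_append _ _ _ _ _ h1.symm (fun r hr c hc => h c hc r hr),
      listDet_transpose rows cols, listDet_transpose rows' cols']
  · rw [listDet_ne _ h1, listDet_ne, mul_zero]
    simp; omega

theorem listDet_single {α β : Type*} (r : α) (c : β) (e : α → β → ℂ) :
    listDet [r] [c] e = e r c := by
  have := listDet_ofFn (fun _ : Fin 1 => r) (fun _ : Fin 1 => c) e
  simpa using this

theorem listDet_nil {α β : Type*} (e : α → β → ℂ) :
    listDet [] [] e = 1 := by
  unfold listDet; simp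

/-- diagonal pairing -/
theorem listDet_diag {α β γ : Type*} (L : List γ) (hL : L.Nodup) (f : γ → α) (g : γ → β)
    (e : α → β → ℂ) (h : ∀ i ∈ L, ∀ j ∈ L, i ≠ j → e (f i) (g j) = 0) :
    listDet (L.map f) (L.map g) e = (L.map (fun i => e (f i) (g i))).prod := by
  induction L with
  | nil => simp [listDet_nil]
  | cons a L ih =>
    have := listDet_append' [f a] (L.map f) [g a] (L.map g) e rfl (by
      intro r hr c hc
      simp at hr hc
      obtain ⟨j, hj, rfl⟩ := hc
      subst hr
      refine h a (by simp) j (by simp [hj]) ?_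
      rintro rfl
      simp at hL; exact hL.1 hj)
    simp only [List.singleton_append] at this
    rw [List.map_cons, List.map_cons, this, listDet_single, ih (by simp at hL; exact hL.2)]
    · simp
    · intro i hi j hj; exact h i (by simp [hi]) j (by simp [hj])

section bd
variable {E : Type*} [AddCommGroup E] [Module ℂ E]

/-- determinant of a list of functionals against a list of vectors -/
noncomputable def bd (rows : List (E →ₗ[ℂ] ℂ)) (cols : List E) : ℂ :=
  listDet rows cols (fun φ v => φ v)

theorem exists_update (A B : List E) {N : ℕ} (h : (A ++ (0 : E) :: B).length = N) :
    ∃ (c : Fin N → E) (i : Fin N), (∀ x, A ++ x :: B = List.ofFn (Function.update c i x)) ∧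
      ∀ x ∈ A ++ B, ∃ j, j ≠ i ∧ c j = x := by
  have hi : A.length < N := by rw [← h]; simp
  refine ⟨fun j => (A ++ (0 : E) :: B).get (Fin.cast h.symm j), ⟨A.length, hi⟩, ?_, ?_⟩
  · intro x
    apply List.ext_getElem
    · simp at h ⊢; exact h
    · intro n h1 h2
      simp [Function.update_apply, Fin.ext_iff, List.getElem_append, List.getElem_cons]
      split_ifs <;> first | rfl | omega
  · intro x hx
    rw [List.mem_append] at hx
    rcases hx with hx | hx
    · obtain ⟨k, hk, rfl⟩ := List.getElem_of_mem hx
      refine ⟨⟨k, by omega⟩, ?_, ?_⟩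
      · simp [Fin.ext_iff]; omega
      · simp [List.getElem_append, hk]
    · obtain ⟨k, hk, rfl⟩ := List.getElem_of_mem hx
      refine ⟨⟨A.length + 1 + k, by simp at h; omega⟩, ?_, ?_⟩
      · simp [Fin.ext_iff]; omega
      · have : A.length + 1 + k - A.length = k + 1 := by omega
        simp [List.getElem_append, this]
        rw [dif_neg (by omega)]

theorem bd_ne {rows : List (E →ₗ[ℂ] ℂ)} {cols : List E} (h : rows.length ≠ cols.length) :
    bd rows cols = 0 := listDet_ne _ h

theorem bd_lin (rows : List (E →ₗ[ℂ] ℂ)) (A B : List E) :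
    ∃ f : E →ₗ[ℂ] ℂ, (∀ x, bd rows (A ++ x :: B) = f x) ∧ ∀ x ∈ A ++ B, f x = 0 := by
  by_cases h : rows.length = (A ++ (0 : E) :: B).length
  · obtain ⟨r, rfl⟩ := exists_ofFn rows h
    obtain ⟨c, i, hc, hc2⟩ := exists_update A B rfl
    generalize (A ++ (0 : E) :: B).length = N at *
    let d : E [⋀^Fin N]→ₗ[ℂ] ℂ :=
      (Matrix.detRowAlternating (R := ℂ) (n := Fin N)).compLinearMap (LinearMap.pi r)
    have hd : ∀ v : Fin N → E, bd (List.ofFn r) (List.ofFn v) = d v := by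
      intro v
      unfold bd
      rw [listDet_ofFn, ← Matrix.det_transpose]
      rfl
    refine ⟨d.toMultilinearMap.toLinearMap c i, ?_, ?_⟩
    · intro x
      rw [hc, hd]; rfl
    · intro x hx
      obtain ⟨j, hj, rfl⟩ := hc2 x hx
      exact d.map_eq_zero_of_eq _ (i := i) (j := j) (by simp [hj]) hj.symm
  · refine ⟨0, ?_, by simp⟩
    intro x
    rw [bd_ne]; · rfl
    simpa using h

theorem bd_add (rows : List (E →ₗ[ℂ] ℂ)) (A B : List E) (x y : E) :
    bd rows (A ++ (x + y) :: B) = bd rows (A ++ x :: B) + bd rows (A ++ y :: B) := by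
  obtain ⟨f, h1, -⟩ := bd_lin rows A B
  simp [h1]

theorem bd_smul (rows : List (E →ₗ[ℂ] ℂ)) (A B : List E) (x : E) (t : ℂ) :
    bd rows (A ++ (t • x) :: B) = t * bd rows (A ++ x :: B) := by
  obtain ⟨f, h1, -⟩ := bd_lin rows A B
  simp [h1]

theorem bd_dup (rows : List (E →ₗ[ℂ] ℂ)) (A B : List E) (x : E) (h : x ∈ A ++ B) :
    bd rows (A ++ x :: B) = 0 := by
  obtain ⟨f, h1, h2⟩ := bd_lin rows A B
  simp [h1, h2 x h]

theorem bd_sub_one (rows : List (E →ₗ[ℂ] ℂ)) (A B : List E) (x y : E)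
    (h : y - x ∈ Submodule.span ℂ {v | v ∈ A ++ B}) :
    bd rows (A ++ y :: B) = bd rows (A ++ x :: B) := by
  obtain ⟨f, h1, h2⟩ := bd_lin rows A B
  have : Submodule.span ℂ {v | v ∈ A ++ B} ≤ LinearMap.ker f := by
    rw [Submodule.span_le]
    intro v hv
    exact h2 v hv
  have := this h
  rw [LinearMap.mem_ker, map_sub, sub_eq_zero] at this
  rw [h1, h1, this]

theorem bd_swap_one (rows : List (E →ₗ[ℂ] ℂ)) (A B : List E) (x y : E) :
    bd rows (A ++ x :: y :: B) = - bd rows (A ++ y :: x :: B) := by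
  have h1 : bd rows (A ++ (x + y) :: (x + y) :: B) = 0 := bd_dup _ _ _ _ (by simp)
  have h2 : ∀ w, bd rows (A ++ w :: (x + y) :: B)
      = bd rows (A ++ w :: x :: B) + bd rows (A ++ w :: y :: B) := by
    intro w
    have := bd_add rows (A ++ [w]) B x y
    simpa using this
  rw [bd_add, h2, h2, bd_dup rows A (x :: B) x (by simp), bd_dup rows A (y :: B) y (by simp)] at h1
  linear_combination h1

theorem bd_move (rows : List (E →ₗ[ℂ] ℂ)) (A L B : List E) (x : E) :
    bd rows (A ++ x :: (L ++ B)) = (-1) ^ L.length * bd rows (A ++ L ++ x :: B) := by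
  induction L generalizing A with
  | nil => simp
  | cons y L ih =>
    rw [List.cons_append, bd_swap_one]
    have := ih (A ++ [y])
    simp only [List.append_assoc, List.singleton_append] at this
    rw [this]
    simp [pow_succ]

theorem bd_swap (rows : List (E →ₗ[ℂ] ℂ)) (A K L B : List E) :
    bd rows (A ++ (K ++ (L ++ B))) = (-1) ^ (K.length * L.length) * bd rows (A ++ (L ++ (K ++ B))) := by
  induction K generalizing A with
  | nil => simp
  | cons y K ih =>
    have := ih (A ++ [y])
    simp only [List.append_assoc, List.singleton_append] at this
    rw [List.cons_append, this, bd_move rows A L (K ++ B) y]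
    simp [add_mul, pow_add]
    ring

theorem bd_transpose (rows : List (E →ₗ[ℂ] ℂ)) (cols : List E) :
    bd rows cols = bd (cols.map (Module.Dual.eval ℂ E)) rows := by
  unfold bd
  rw [listDet_transpose]
  conv_rhs => rw [← List.map_id rows]
  rw [listDet_map]
  rfl

theorem bd_rowswap (A K L B : List (E →ₗ[ℂ] ℂ)) (cols : List E) :
    bd (A ++ (K ++ (L ++ B))) cols = (-1) ^ (K.length * L.length) * bd (A ++ (L ++ (K ++ B))) cols := by
  rw [bd_transpose, bd_swap, ← bd_transpose]

theorem bd_sub (rows : List (E →ₗ[ℂ] ℂ)) (A C : List E) {γ : Type*} (L : List γ) (f g : γ → E)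
    (h : ∀ i ∈ L, f i - g i ∈ Submodule.span ℂ {v | v ∈ A ++ C}) :
    bd rows (A ++ (L.map f ++ C)) = bd rows (A ++ (L.map g ++ C)) := by
  have key : ∀ (M : List E), bd rows (A ++ (M ++ (L.map f ++ C))) =
      bd rows (A ++ (M ++ (L.map g ++ C))) := by
    induction L with
    | nil => intro M; rfl
    | cons a L ih =>
      intro M
      have h1 := bd_sub_one rows (A ++ M) (L.map f ++ C) (g a) (f a) (by
        refine Submodule.span_mono ?_ (h a (by simp))
        intro v hv
        simp at hv ⊢
        tauto)
      have h2 := ih (fun i hi => h i (by simp [hi])) (M ++ [g a])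
      simp only [List.append_assoc, List.nil_append, List.map_cons, List.cons_append] at h1 h2 ⊢
      rw [h1, h2]
  exact key []

theorem bd_smul_list (rows : List (E →ₗ[ℂ] ℂ)) (A C : List E) {γ : Type*} (L : List γ) (f : γ → E)
    (t : γ → ℂ) :
    bd rows (A ++ (L.map (fun i => t i • f i) ++ C)) =
      (L.map t).prod * bd rows (A ++ (L.map f ++ C)) := by
  induction L generalizing A with
  | nil => simp
  | cons a L ih =>
    have := ih (A ++ [f a])
    simp only [List.append_assoc, List.singleton_append] at this
    simp only [List.map_cons, List.cons_append, bd_smul, List.prod_cons]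
    rw [mul_assoc, ← this]

end bd
end Stmt0

open scoped BigOperators
namespace Stmt0

section pl
set_option linter.unusedSectionVars false
variable {E : Type*} [AddCommGroup E] [Module ℂ E]

theorem bd_zero_col (rows : List (E →ₗ[ℂ] ℂ)) (A B : List E) (w : E)
    (h : ∀ φ ∈ rows, φ w = 0) : bd rows (A ++ w :: B) = 0 := by
  have h1 : bd rows (A ++ w :: B) = bd rows (w :: A ++ B) * (-1) ^ A.length := by
    have := bd_move rows [] A B w
    simp only [List.nil_append] at this
    rw [List.cons_append, this, mul_comm, ← mul_assoc, ← pow_add, Even.neg_one_pow ⟨_, rfl⟩, one_mul]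
  rw [h1]
  rw [mul_eq_zero]; left
  by_cases hl : rows.length = (w :: A ++ B).length
  · rcases rows with _ | ⟨r, rows⟩
    · simp at hl
    · unfold bd
      rw [listDet_transpose]
      have := listDet_append' [w] (A ++ B) [r] rows (fun c φ => φ c) rfl (by
        intro a ha φ hφ
        simp at ha; subst ha
        exact h φ (by simp [hφ]))
      simp only [List.singleton_append] at this
      rw [List.cons_append, this, listDet_single, h r (by simp), zero_mul]
  · exact bd_ne hl

theorem bd_zero_row (A B : List (E →ₗ[ℂ] ℂ)) (φ : E →ₗ[ℂ] ℂ) (cols : List E)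
    (h : ∀ v ∈ cols, φ v = 0) : bd (A ++ φ :: B) cols = 0 := by
  rw [bd_transpose]
  apply bd_zero_col
  intro ψ hψ
  rw [List.mem_map] at hψ
  obtain ⟨v, hv, rfl⟩ := hψ
  simpa using h v hv

theorem bd_two_swap (rows : List (E →ₗ[ℂ] ℂ)) (C : List E) (a b : E) :
    bd rows (a :: b :: C) = - bd rows (b :: a :: C) := bd_swap_one rows [] C a b

/-- prepend two vectors -/
def cons2 {N : ℕ} (a b : E) (u : Fin N → E) : Fin (N + 2) → E :=
  @Fin.cons (N + 1) (fun _ => E) a (@Fin.cons N (fun _ => E) b u)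

@[simp] theorem cons2_zero {N : ℕ} (a b : E) (u : Fin N → E) : cons2 a b u 0 = a := rfl
@[simp] theorem cons2_one {N : ℕ} (a b : E) (u : Fin N → E) : cons2 a b u 1 = b := rfl
@[simp] theorem cons2_ss {N : ℕ} (a b : E) (u : Fin N → E) (j : Fin N) :
    cons2 a b u j.succ.succ = u j := rfl
theorem cons2_s {N : ℕ} (a a' b : E) (u : Fin N → E) (j : Fin (N + 1)) :
    cons2 a b u j.succ = cons2 a' b u j.succ := rfl

theorem plucker (rows : List (E →ₗ[ℂ] ℂ)) (C : List E) (a b c d : E) :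
    bd rows (a :: b :: C) * bd rows (c :: d :: C) =
      bd rows (c :: b :: C) * bd rows (a :: d :: C) +
      bd rows (a :: c :: C) * bd rows (b :: d :: C) := by
  by_cases hl : rows.length = C.length + 2
  swap
  · rw [bd_ne, bd_ne (cols := c :: b :: C), bd_ne (cols := a :: c :: C)]
    · simp
    all_goals simpa using hl
  obtain ⟨r, rfl⟩ := exists_ofFn rows hl
  obtain ⟨u, hu⟩ := exists_ofFn C rfl
  obtain ⟨f, hf1, hf2⟩ := bd_lin (List.ofFn r) [] (d :: C)
  simp only [List.nil_append] at hf1 hf2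
  have hz := bd_zero_col (List.ofFn r) [] (d :: C)
  simp only [List.nil_append, hf1] at hz
  generalize C.length = N at *
  have hb : ∀ a b : E, bd (List.ofFn r) (a :: b :: C) =
      Matrix.det (Matrix.of fun i j : Fin (N + 2) => r i (cons2 a b u j)) := by
    intro a b
    have : a :: b :: C = List.ofFn (cons2 a b u) := by
      unfold cons2; rw [List.ofFn_cons, List.ofFn_cons, hu]
    rw [this]
    unfold bd
    rw [listDet_ofFn]
  let A : Matrix (Fin (N+2)) (Fin (N+2)) ℂ :=
    Matrix.of fun i j => r i (cons2 a b u j)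
  let cv : Fin (N+2) → ℂ := fun i => r i c
  have hcr := Matrix.mulVec_cramer A cv
  have h0 : A.cramer cv 0 = bd (List.ofFn r) (c :: b :: C) := by
    rw [Matrix.cramer_apply, hb]
    congr 1
    ext i j
    refine Fin.cases ?_ (fun j => ?_) j
    · simp [cv]
    · simp [A]; rw [cons2_s a c]
  have h1 : A.cramer cv 1 = bd (List.ofFn r) (a :: c :: C) := by
    rw [Matrix.cramer_apply, hb]
    congr 1
    ext i j
    refine Fin.cases ?_ (fun j => ?_) j
    · simp [A, Matrix.updateCol_apply]
    · refine Fin.cases ?_ (fun j => ?_) j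
      · simp [cv]
      · have : (Fin.succ (Fin.succ j)) ≠ 1 := by
          intro h; simp [Fin.ext_iff] at h
        simp [A, Matrix.updateCol_apply, this]
  have h3 := hz (A.det • c - ∑ j, A.cramer cv j • (cons2 a b u j)) (by
    intro φ hφ
    rw [List.mem_ofFn] at hφ
    obtain ⟨i, rfl⟩ := hφ
    have := congrFun hcr i
    simp only [Matrix.mulVec, dotProduct, Pi.smul_apply] at this
    rw [map_sub, map_sum, map_smul]
    simp only [map_smul]
    rw [sub_eq_zero]
    change A.det • cv i = _
    rw [← this]
    apply Finset.sum_congr rfl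
    intro j _
    simp only [A, Matrix.of_apply, smul_eq_mul]
    ring)
  rw [map_sub, map_sum, map_smul, sub_eq_zero, Fin.sum_univ_succ, Fin.sum_univ_succ] at h3
  rw [Finset.sum_eq_zero] at h3
  · simp only [Fin.cons_zero, Fin.cons_succ, map_smul, smul_eq_mul] at h3
    rw [h0, Fin.succ_zero_eq_one, h1, cons2_zero, cons2_one] at h3
    rw [hf1 c, hf1 a, hf1 b, hb a b]
    rw [show Matrix.det (Matrix.of fun i j : Fin (N + 2) => r i (cons2 a b u j)) = A.det from rfl, h3]
    ring
  · intro j _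
    rw [map_smul]
    simp only [cons2_ss]
    rw [hf2, smul_zero]
    rw [hu]; simp

theorem bd_tri (rows : List (E →ₗ[ℂ] ℂ)) (A C : List E) (k : ℕ) (v v' : ℕ → E)
    (h : ∀ j < k, v' j - v j ∈ Submodule.span ℂ ({w | w ∈ A} ∪ {w | ∃ i < j, w = v i})) :
    bd rows (A ++ ((List.range k).map v' ++ C)) = bd rows (A ++ ((List.range k).map v ++ C)) := by
  have h0 : bd rows (A ++ ((List.range k).map v ++ C)) = bd rows (A ++ ((List.range k).map v' ++ C)) := by
    induction k generalizing C with
    | zero => simp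
    | succ k ih =>
      have h1 := bd_sub_one rows (A ++ (List.range k).map v) C (v k) (v' k) (by
        refine Submodule.span_mono ?_ (h k (by omega))
        intro w hw
        simp only [Set.mem_union, Set.mem_ofPred_eq] at hw
        simp only [List.mem_append, List.mem_map, List.mem_range, Set.mem_ofPred_eq]
        rcases hw with hw | ⟨i, hi, rfl⟩
        · simp [hw]
        · left; right; exact ⟨i, hi, rfl⟩)
      have h2 := ih (v' k :: C) (fun j hj => h j (by omega))
      simp only [List.range_succ, List.map_append, List.map_cons, List.map_nil, List.append_assoc,
        List.cons_append, List.nil_append] at h1 h2 ⊢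
      rw [← h1, h2]
  exact h0.symm

theorem bd_tri_row (cols : List E) (A C : List (E →ₗ[ℂ] ℂ)) (k : ℕ) (v v' : ℕ → (E →ₗ[ℂ] ℂ))
    (h : ∀ j < k, v' j - v j ∈ Submodule.span ℂ ({w | w ∈ A} ∪ {w | ∃ i < j, w = v i})) :
    bd (A ++ ((List.range k).map v' ++ C)) cols = bd (A ++ ((List.range k).map v ++ C)) cols := by
  rw [bd_transpose, bd_transpose (A ++ _)]
  exact bd_tri _ A C k v v' h

end pl

theorem pairProd_nil {ι : Type*} (g : ι → ι → ℂ) : pairProd [] g = 1 := by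
  simp [pairProd]

theorem pairProd_cons {ι : Type*} (a : ι) (L : List ι) (g : ι → ι → ℂ) :
    pairProd (a :: L) g = (L.map (g a)).prod * pairProd L g := by
  unfold pairProd
  simp only [List.length_cons]
  rw [Fin.prod_univ_succ]
  congr 1
  · rw [Fin.prod_univ_succ]
    simp
  · apply Finset.prod_congr rfl
    intro i _
    rw [Fin.prod_univ_succ]
    simp

open Polynomial

/-- product of `X - f` over a list -/
noncomputable def PF (L : List ℂ) : ℂ[X] := (L.map (fun f => X - C f)).prod

open Classical in
/-- `PF / (X - f)` -/
noncomputable def ell (L : List ℂ) (f : ℂ) : ℂ[X] := PF (L.erase f)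

theorem ell_head (f : ℂ) (L : List ℂ) : ell (f :: L) f = PF L := by
  simp [ell]

theorem ell_tail (f g : ℂ) (L : List ℂ) (h : g ≠ f) : ell (f :: L) g = (X - C f) * ell L g := by
  unfold ell
  rw [List.erase_cons_tail (by simpa using h.symm)]
  simp [PF]

theorem PF_cons (f : ℂ) (L : List ℂ) : PF (f :: L) = (X - C f) * PF L := by
  simp [PF]

theorem mul_ell (L : List ℂ) (f : ℂ) (h : f ∈ L) : (X - C f) * ell L f = PF L := by
  induction L with
  | nil => simp at h
  | cons a L ih =>
    by_cases hf : f = a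
    · subst hf; rw [ell_head, PF_cons]
    · rw [ell_tail _ _ _ hf, PF_cons, ← ih (by simpa [hf] using h)]; ring

theorem lemX {E : Type*} [AddCommGroup E] [Module ℂ E] (I : ℂ[X] →ₗ[ℂ] E)
    (Q : List (E →ₗ[ℂ] ℂ)) (O : List E) (L : List ℂ) (hL : L.Nodup) (k K : ℕ)
    (hkK : k = 0 ∨ K = 0) (ρ : ℕ → (E →ₗ[ℂ] ℂ)) (κ : ℂ)
    (hlen : Q.length + K = L.length + k + O.length)
    (hρ : ∀ r < K, ∀ f ∈ L, ρ r (I (ell L f)) = κ * (-f) ^ r)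
    (hρO : ∀ r < K, ∀ o ∈ O, ρ r o = 0) :
    bd (Q ++ (List.range K).map ρ)
      (L.map (fun f => I (ell L f)) ++ ((List.range k).map (fun j => I (PF L * X ^ j)) ++ O)) =
    (-1) ^ (L.length.choose 2 + K * O.length) * κ ^ K * pairProd L (fun f f' => f' - f) *
      bd Q ((List.range (L.length + k - K)).map (fun j => I (X ^ j)) ++ O) := by
  induction L generalizing k K ρ κ with
  | nil =>
    rcases K with _ | K
    · simp [PF, pairProd_nil]
    · rcases hkK with rfl | h
      · simp only [List.map_nil, List.range_zero, List.nil_append]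
        have : (List.range (K+1)).map ρ = ρ 0 :: (List.range K).map (ρ ∘ Nat.succ) := by
          rw [List.range_succ_eq_map]; simp
        rw [this, bd_zero_row, bd_ne, mul_zero]
        · simp at hlen ⊢; omega
        · exact hρO 0 (by omega)
      · omega
  | cons f0 L ih =>
    have hf0 : ∀ f ∈ L, f ≠ f0 := by
      rintro f hf rfl; simp at hL; exact hL.1 hf
    have hL' : L.Nodup := by simp at hL; exact hL.2
    -- step a
    have stepa : ∀ (R : List (E →ₗ[ℂ] ℂ)) (C' : List E),
        bd R ((f0 :: L).map (fun f => I (ell (f0 :: L) f)) ++ C') =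
        (L.map (fun f => f - f0)).prod * bd R (I (PF L) :: (L.map (fun f => I (ell L f)) ++ C')) := by
      intro R C'
      rw [List.map_cons, ell_head]
      have h1 := bd_smul_list R [I (PF L)] C' L (fun f => I (ell L f)) (fun f => f - f0)
      have h2 := bd_sub R [I (PF L)] C' L (fun f => I (ell (f0 :: L) f))
        (fun f => (f - f0) • I (ell L f)) (by
          intro f hf
          apply Submodule.subset_span
          rw [ell_tail _ _ _ (hf0 f hf), ← map_smul, ← map_sub, smul_eq_C_mul]
          have : (X - C f0) * ell L f - C (f - f0) * ell L f = PF L := by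
            rw [← mul_ell L f hf, C_sub]; ring
          rw [this]; simp)
      simp only [List.singleton_append] at h1 h2
      rw [List.cons_append, h2, h1]
    have hprod : pairProd (f0 :: L) (fun f f' => f' - f) =
      (L.map (fun f => f - f0)).prod * pairProd L (fun f f' => f' - f) := pairProd_cons _ _ _
    rw [stepa, hprod]
    rcases K with _ | K
    · -- no R rows
      have h3 := bd_tri (Q ++ (List.range 0).map ρ) (I (PF L) :: L.map (fun f => I (ell L f))) O k
        (fun j => I (PF L * X ^ (j + 1))) (fun j => I (PF (f0 :: L) * X ^ j)) (by
          intro j hj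
          have h4 : I (PF (f0 :: L) * X ^ j) - I (PF L * X ^ (j + 1)) = (-f0) • I (PF L * X ^ j) := by
            rw [← map_sub, ← map_smul, smul_eq_C_mul, PF_cons]
            congr 1
            rw [C_neg]; ring
          simp only [h4]
          apply Submodule.smul_mem
          apply Submodule.subset_span
          rcases j with _ | j
          · left; simp
          · right; exact ⟨j, by omega, rfl⟩)
      simp only [List.cons_append] at h3
      rw [h3]
      have h5 := bd_move (Q ++ (List.range 0).map ρ) [] (L.map (fun f => I (ell L f)))
        ((List.range k).map (fun j => I (PF L * X ^ (j + 1))) ++ O) (I (PF L))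
      simp only [List.nil_append] at h5
      rw [h5]
      have h6 : ∀ O : List E, I (PF L) :: ((List.range k).map (fun j => I (PF L * X ^ (j + 1))) ++ O) =
          (List.range (k+1)).map (fun j => I (PF L * X ^ j)) ++ O := by
        intro O
        rw [List.range_succ_eq_map]; simp [Function.comp_def]
      rw [h6]
      have h7 := ih hL' (k+1) 0 (Or.inr rfl) ρ κ (by simp at hlen ⊢; omega) (by simp) (by simp)
      rw [h7]
      have h8 : L.length + (k+1) - 0 = (f0 :: L).length + k - 0 := by simp; omega
      rw [h8]
      simp only [List.length_cons, List.length_map, Nat.choose_succ_succ' _ 1, Nat.choose_one_right,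
        pow_add]
      ring
    · obtain rfl : k = 0 := by omega
      simp only [List.range_zero, List.map_nil, List.nil_append]
      have h1 : (List.range (K+1)).map ρ = ρ 0 :: (List.range K).map (fun r => ρ (r + 1)) := by
        rw [List.range_succ_eq_map]; simp [Function.comp_def]
      rw [h1]
      have h2 := bd_tri_row (I (PF L) :: (L.map (fun f => I (ell L f)) ++ O)) (Q ++ [ρ 0]) [] K
        (fun r => ρ (r + 1)) (fun r => ρ (r + 1) + f0 • ρ r) (by
          intro j hj
          simp only [add_sub_cancel_left]
          apply Submodule.smul_mem
          apply Submodule.subset_span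
          rcases j with _ | j
          · left; simp
          · right; exact ⟨j, by omega, rfl⟩)
      simp only [List.append_nil, List.append_assoc, List.singleton_append] at h2
      rw [← h2]
      have h3 := bd_rowswap [] Q [ρ 0] ((List.range K).map (fun r => ρ (r + 1) + f0 • ρ r))
        (I (PF L) :: (L.map (fun f => I (ell L f)) ++ O))
      simp only [List.nil_append, List.singleton_append] at h3
      rw [h3]
      have e1 : ∀ f ∈ L, I (ell L f) = (f - f0)⁻¹ • (I (ell (f0 :: L) f) - I (ell (f0 :: L) f0)) := by
        intro f hf
        rw [ell_tail _ _ _ (hf0 f hf), ell_head, ← map_sub, ← map_smul, ← mul_ell L f hf]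
        congr 1
        rw [smul_eq_C_mul, ← sub_mul, ← mul_assoc]
        have : (X - C f0 - (X - C f) : ℂ[X]) = C (f - f0) := by rw [C_sub]; ring
        rw [this, ← C_mul, inv_mul_cancel₀ (sub_ne_zero.mpr (hf0 f hf))]
        simp
      have h4 : bd (ρ 0 :: (Q ++ (List.range K).map (fun r => ρ (r + 1) + f0 • ρ r)))
          (I (PF L) :: (L.map (fun f => I (ell L f)) ++ O)) =
          κ * bd (Q ++ (List.range K).map (fun r => ρ (r + 1) + f0 • ρ r))
            (L.map (fun f => I (ell L f)) ++ O) := by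
        have := listDet_append' [ρ 0] (Q ++ (List.range K).map (fun r => ρ (r + 1) + f0 • ρ r))
          [I (PF L)] (L.map (fun f => I (ell L f)) ++ O) (fun φ v => φ v) rfl (by
            intro φ hφ c hc
            simp only [List.mem_singleton] at hφ
            subst hφ
            rw [List.mem_append, List.mem_map] at hc
            rcases hc with ⟨f, hf, rfl⟩ | hc
            · rw [e1 f hf, map_smul, map_sub, hρ 0 (by omega) f (by simp [hf]),
                hρ 0 (by omega) f0 (by simp)]
              simp
            · exact hρO 0 (by omega) c hc)
        simp only [List.singleton_append] at this
        unfold bd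
        rw [this, listDet_single]
        have h5 := hρ 0 (by omega) f0 (by simp)
        rw [ell_head] at h5
        rw [h5]; simp
      rw [h4]
      have h7 := ih hL' 0 K (Or.inl rfl) (fun r => ρ (r + 1) + f0 • ρ r) (-κ)
        (by simp at hlen ⊢; omega) (by
          intro r hr f hf
          have hne := sub_ne_zero.mpr (hf0 f hf)
          rw [e1 f hf, map_smul, map_sub]
          simp only [LinearMap.add_apply, LinearMap.smul_apply]
          rw [hρ _ (by omega : r + 1 < K + 1) f (by simp [hf]), hρ _ (by omega : r < K + 1) f (by simp [hf]),
            hρ _ (by omega : r + 1 < K + 1) f0 (by simp), hρ _ (by omega : r < K + 1) f0 (by simp)]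
          simp only [smul_eq_mul]
          field_simp
          ring) (by
          intro r hr o ho
          simp [hρO (r+1) (by omega) o ho, hρO r (by omega) o ho])
      simp only [List.range_zero, List.map_nil, List.nil_append] at h7
      rw [h7]
      have h8 : L.length + 0 - K = (f0 :: L).length + 0 - (K + 1) := by simp
      rw [h8]
      have h9 : Q.length + K = L.length + O.length := by simp at hlen; omega
      have h10 : (-1 : ℂ) ^ Q.length * (-1) ^ K = (-1) ^ L.length * (-1) ^ O.length := by
        rw [← pow_add, ← pow_add, h9]
      simp only [List.length_cons, Nat.choose_succ_succ' _ 1, Nat.choose_one_right,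
        pow_add, neg_pow κ, List.length_nil, zero_add, mul_one, add_mul, one_mul, pow_one]
      linear_combination (L.map (fun f => f - f0)).prod * κ * κ ^ K * (-1) ^ L.length.choose 2 *
        (-1) ^ (K * O.length) * pairProd L (fun f f' => f' - f) *
        bd Q ((List.range (L.length + 1 + 0 - (K + 1))).map (fun j => I (X ^ j)) ++ O) * h10

end Stmt0

open scoped BigOperators
namespace Stmt0
open Polynomial

theorem mem_inl_aux {α β : Type*} {a : α} {A : List α} {B : List β}
    (h : (Sum.inl a : α ⊕ β) ∈ A.map Sum.inl ++ B.map Sum.inr) : a ∈ A := by simpa using h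

theorem mem_inr_aux {α β : Type*} {b : β} {A : List α} {B : List β}
    (h : (Sum.inr b : α ⊕ β) ∈ A.map Sum.inl ++ B.map Sum.inr) : b ∈ B := by simpa using h

theorem map_elim_append {α β γ : Type*} (A : List α) (B : List β) (f : α → γ) (g : β → γ) :
    (A.map (Sum.inl : α → α ⊕ β) ++ B.map Sum.inr).map (Sum.elim f g) = A.map f ++ B.map g := by
  simp

theorem prod_elim_append {α β : Type*} (A : List α) (B : List β) (f : α → ℂ) (g : β → ℂ) :
    ((A.map (Sum.inl : α → α ⊕ β) ++ B.map Sum.inr).map (Sum.elim f g)).prod =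
      (A.map f).prod * (B.map g).prod := by
  simp

/-- entrywise comparison of two determinants, up to row and column scaling -/
theorem listDet_cmp {κ ν R C R' C' : Type*} (rows : List κ) (cols : List ν)
    (f : κ → R) (g : ν → C) (f' : κ → R') (g' : ν → C') (e : R → C → ℂ) (e' : R' → C' → ℂ)
    (l : κ → ℂ) (μ : ν → ℂ)
    (h : ∀ r ∈ rows, ∀ c ∈ cols, e (f r) (g c) = l r * (μ c * e' (f' r) (g' c))) :
    listDet (rows.map f) (cols.map g) e =
      (rows.map l).prod * ((cols.map μ).prod * listDet (rows.map f') (cols.map g') e') := by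
  rw [listDet_map, listDet_map, ← listDet_colscale, ← listDet_rowscale]
  exact listDet_congr _ _ _ _ h

theorem listDet_block {α1 α2 α3 α4 γ1 γ2 γ3 R C R' C' : Type*}
    (A1 : List α1) (A2 : List α2) (A3 : List α3) (A4 : List α4)
    (C1 : List γ1) (C2 : List γ2) (C3 : List γ3)
    (f1 : α1 → R) (f2 : α2 → R) (f3 : α3 → R) (f4 : α4 → R)
    (g1 : γ1 → C) (g2 : γ2 → C) (g3 : γ3 → C)
    (f1' : α1 → R') (f2' : α2 → R') (f3' : α3 → R') (f4' : α4 → R')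
    (g1' : γ1 → C') (g2' : γ2 → C') (g3' : γ3 → C')
    (e : R → C → ℂ) (e' : R' → C' → ℂ)
    (l1 : α1 → ℂ) (l2 : α2 → ℂ) (l3 : α3 → ℂ) (l4 : α4 → ℂ)
    (μ1 : γ1 → ℂ) (μ2 : γ2 → ℂ) (μ3 : γ3 → ℂ)
    (h11 : ∀ a ∈ A1, ∀ c ∈ C1, e (f1 a) (g1 c) = l1 a * (μ1 c * e' (f1' a) (g1' c)))
    (h12 : ∀ a ∈ A1, ∀ c ∈ C2, e (f1 a) (g2 c) = l1 a * (μ2 c * e' (f1' a) (g2' c)))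
    (h13 : ∀ a ∈ A1, ∀ c ∈ C3, e (f1 a) (g3 c) = l1 a * (μ3 c * e' (f1' a) (g3' c)))
    (h21 : ∀ a ∈ A2, ∀ c ∈ C1, e (f2 a) (g1 c) = l2 a * (μ1 c * e' (f2' a) (g1' c)))
    (h22 : ∀ a ∈ A2, ∀ c ∈ C2, e (f2 a) (g2 c) = l2 a * (μ2 c * e' (f2' a) (g2' c)))
    (h23 : ∀ a ∈ A2, ∀ c ∈ C3, e (f2 a) (g3 c) = l2 a * (μ3 c * e' (f2' a) (g3' c)))
    (h31 : ∀ a ∈ A3, ∀ c ∈ C1, e (f3 a) (g1 c) = l3 a * (μ1 c * e' (f3' a) (g1' c)))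
    (h32 : ∀ a ∈ A3, ∀ c ∈ C2, e (f3 a) (g2 c) = l3 a * (μ2 c * e' (f3' a) (g2' c)))
    (h33 : ∀ a ∈ A3, ∀ c ∈ C3, e (f3 a) (g3 c) = l3 a * (μ3 c * e' (f3' a) (g3' c)))
    (h41 : ∀ a ∈ A4, ∀ c ∈ C1, e (f4 a) (g1 c) = l4 a * (μ1 c * e' (f4' a) (g1' c)))
    (h42 : ∀ a ∈ A4, ∀ c ∈ C2, e (f4 a) (g2 c) = l4 a * (μ2 c * e' (f4' a) (g2' c)))
    (h43 : ∀ a ∈ A4, ∀ c ∈ C3, e (f4 a) (g3 c) = l4 a * (μ3 c * e' (f4' a) (g3' c))) :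
    listDet (A1.map f1 ++ (A2.map f2 ++ (A3.map f3 ++ A4.map f4)))
      (C1.map g1 ++ (C2.map g2 ++ C3.map g3)) e =
    ((A1.map l1).prod * ((A2.map l2).prod * ((A3.map l3).prod * (A4.map l4).prod))) *
    (((C1.map μ1).prod * ((C2.map μ2).prod * (C3.map μ3).prod)) *
    listDet (A1.map f1' ++ (A2.map f2' ++ (A3.map f3' ++ A4.map f4')))
      (C1.map g1' ++ (C2.map g2' ++ C3.map g3')) e') := by
  rw [← map_elim_append A3 A4 f3 f4, ← map_elim_append A2 _ f2, ← map_elim_append A1 _ f1,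
    ← map_elim_append A3 A4 f3' f4', ← map_elim_append A2 _ f2', ← map_elim_append A1 _ f1',
    ← map_elim_append C2 C3 g2 g3, ← map_elim_append C1 _ g1,
    ← map_elim_append C2 C3 g2' g3', ← map_elim_append C1 _ g1',
    ← prod_elim_append A3 A4 l3 l4, ← prod_elim_append A2 _ l2, ← prod_elim_append A1 _ l1,
    ← prod_elim_append C2 C3 μ2 μ3, ← prod_elim_append C1 _ μ1]
  apply listDet_cmp
  intro r hr c hc
  rcases r with r | r | r | r
  · have hr := mem_inl_aux hr
    rcases c with c | c | c
    · exact h11 r hr c (mem_inl_aux hc)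
    · exact h12 r hr c (mem_inl_aux (mem_inr_aux hc))
    · exact h13 r hr c (mem_inr_aux (mem_inr_aux hc))
  · have hr := mem_inl_aux (mem_inr_aux hr)
    rcases c with c | c | c
    · exact h21 r hr c (mem_inl_aux hc)
    · exact h22 r hr c (mem_inl_aux (mem_inr_aux hc))
    · exact h23 r hr c (mem_inr_aux (mem_inr_aux hc))
  · have hr := mem_inl_aux (mem_inr_aux (mem_inr_aux hr))
    rcases c with c | c | c
    · exact h31 r hr c (mem_inl_aux hc)
    · exact h32 r hr c (mem_inl_aux (mem_inr_aux hc))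
    · exact h33 r hr c (mem_inr_aux (mem_inr_aux hc))
  · have hr := mem_inr_aux (mem_inr_aux (mem_inr_aux hr))
    rcases c with c | c | c
    · exact h41 r hr c (mem_inl_aux hc)
    · exact h42 r hr c (mem_inl_aux (mem_inr_aux hc))
    · exact h43 r hr c (mem_inr_aux (mem_inr_aux hc))

/-- pairs of functions -/
abbrev EE := (ℂ → ℂ) × (ℂ → ℂ)

noncomputable def evx (c : ℂ) : EE →ₗ[ℂ] ℂ := (LinearMap.proj c).comp (LinearMap.fst ℂ (ℂ → ℂ) (ℂ → ℂ))
noncomputable def evy (c : ℂ) : EE →ₗ[ℂ] ℂ := (LinearMap.proj c).comp (LinearMap.snd ℂ (ℂ → ℂ) (ℂ → ℂ))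

noncomputable def pz (e : ℤ) : ℂ[X] →ₗ[ℂ] (ℂ → ℂ) := LinearMap.pi (fun c => (c ^ e) • leval c)
noncomputable def Xz (e : ℤ) : ℂ[X] →ₗ[ℂ] EE := (LinearMap.inl ℂ (ℂ → ℂ) (ℂ → ℂ)).comp (pz e)
noncomputable def Yz (e : ℤ) : ℂ[X] →ₗ[ℂ] EE := (LinearMap.inr ℂ (ℂ → ℂ) (ℂ → ℂ)).comp (pz e)

@[simp] theorem evx_Xz (c : ℂ) (e : ℤ) (p : ℂ[X]) : evx c (Xz e p) = c ^ e * p.eval c := by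
  simp [evx, Xz, pz]
@[simp] theorem evx_Yz (c : ℂ) (e : ℤ) (p : ℂ[X]) : evx c (Yz e p) = 0 := by
  simp [evx, Yz]
@[simp] theorem evy_Xz (c : ℂ) (e : ℤ) (p : ℂ[X]) : evy c (Xz e p) = 0 := by
  simp [evy, Xz]
@[simp] theorem evy_Yz (c : ℂ) (e : ℤ) (p : ℂ[X]) : evy c (Yz e p) = c ^ e * p.eval c := by
  simp [evy, Yz, pz]

/-- basic columns -/
noncomputable def xc (j : ℤ) : EE := (fun c => c ^ j, 0)
noncomputable def yc (j : ℤ) : EE := (0, fun c => c ^ j)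
noncomputable def uc (j : ℤ) : EE := xc j + yc j

@[simp] theorem evx_xc (c : ℂ) (j : ℤ) : evx c (xc j) = c ^ j := by simp [evx, xc]
@[simp] theorem evx_yc (c : ℂ) (j : ℤ) : evx c (yc j) = 0 := by simp [evx, yc]
@[simp] theorem evy_xc (c : ℂ) (j : ℤ) : evy c (xc j) = 0 := by simp [evy, xc]
@[simp] theorem evy_yc (c : ℂ) (j : ℤ) : evy c (yc j) = c ^ j := by simp [evy, yc]

/-- residue functionals -/
noncomputable def res (F : List ℂ) (ev : ℂ → (EE →ₗ[ℂ] ℂ)) (r : ℕ) : EE →ₗ[ℂ] ℂ :=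
  ∑ f ∈ F.toFinset, ((-f) ^ r / (ell F f).eval f) • ev f

theorem res_apply (F : List ℂ) (ev : ℂ → (EE →ₗ[ℂ] ℂ)) (r : ℕ) (v : EE) :
    res F ev r v = ∑ f ∈ F.toFinset, ((-f) ^ r / (ell F f).eval f) * ev f v := by
  simp [res, LinearMap.sum_apply]

theorem PF_eval (L : List ℂ) (c : ℂ) : (PF L).eval c = (L.map (fun f => c - f)).prod := by
  induction L with
  | nil => simp [PF]
  | cons a L ih => simp [PF_cons, ih]

theorem PF_eval_mem (L : List ℂ) (c : ℂ) (h : c ∈ L) : (PF L).eval c = 0 := by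
  rw [PF_eval, List.prod_eq_zero_iff, List.mem_map]
  exact ⟨c, h, by simp⟩

theorem PF_eval_ne (L : List ℂ) (c : ℂ) (h : c ∉ L) : (PF L).eval c ≠ 0 := by
  rw [PF_eval, Ne, List.prod_eq_zero_iff, List.mem_map]
  rintro ⟨f, hf, h2⟩
  rw [sub_eq_zero] at h2; subst h2; exact h hf

theorem ell_eval_ne (L : List ℂ) (f c : ℂ) (hf : f ∈ L) (h : c ≠ f) :
    (ell L f).eval c = (PF L).eval c / (c - f) := by
  rw [← mul_ell L f hf]
  simp only [eval_mul, eval_sub, eval_X, eval_C]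
  field_simp [sub_ne_zero.mpr h]

theorem ell_eval_zero (L : List ℂ) (f c : ℂ) (hf : f ∈ L) (hc : c ∈ L) (h : c ≠ f) :
    (ell L f).eval c = 0 := by
  rw [ell_eval_ne L f c hf h, PF_eval_mem L c hc, zero_div]

theorem ell_eval_self (L : List ℂ) (f : ℂ) (hL : L.Nodup) : (ell L f).eval f ≠ 0 := by
  unfold ell
  apply PF_eval_ne
  intro h
  exact (List.Nodup.not_mem_erase hL) h

theorem res_zero (F : List ℂ) (ev : ℂ → (EE →ₗ[ℂ] ℂ)) (r : ℕ) (v : EE)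
    (h : ∀ f ∈ F, ev f v = 0) : res F ev r v = 0 := by
  rw [res_apply]
  apply Finset.sum_eq_zero
  intro f hf
  rw [h f (by simpa using hf), mul_zero]

theorem res_ell (F : List ℂ) (hF : F.Nodup) (ev : ℂ → (EE →ₗ[ℂ] ℂ)) (r : ℕ) (v : EE) (f0 : ℂ) (hf0 : f0 ∈ F)
    (t : ℂ) (h : ∀ f ∈ F, ev f v = t * (ell F f0).eval f) : res F ev r v = (-f0) ^ r * t := by
  rw [res_apply, Finset.sum_eq_single f0]
  · rw [h f0 hf0]
    field_simp [ell_eval_self F f0 hF]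
  · intro f hf hne
    rw [h f (by simpa using hf), ell_eval_zero F f0 f hf0 (by simpa using hf) hne]
    simp
  · intro hh; simp [hf0] at hh

theorem prod_ell (L : List ℂ) (hL : L.Nodup) :
    (L.map (fun f => (ell L f).eval f)).prod =
      (-1) ^ (L.length.choose 2) * pairProd L (fun f f' => f' - f) ^ 2 := by
  induction L with
  | nil => simp [pairProd_nil]
  | cons f0 L ih =>
    have hf0 : ∀ f ∈ L, f ≠ f0 := by
      rintro f hf rfl; simp at hL; exact hL.1 hf
    have hL' : L.Nodup := by simp at hL; exact hL.2
    rw [List.map_cons, List.prod_cons, ell_head, pairProd_cons, PF_eval]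
    have h1 : L.map (fun f => (ell (f0 :: L) f).eval f) =
        L.map (fun f => (f - f0) * (ell L f).eval f) := by
      apply List.map_congr_left
      intro f hf
      rw [ell_tail _ _ _ (hf0 f hf)]; simp
    rw [h1, List.prod_map_mul, ih hL']
    have h2 : (L.map (fun f => f0 - f)).prod = (-1) ^ L.length * (L.map (fun f => f - f0)).prod := by
      have : L.map (fun f => f0 - f) = L.map (fun f => (-1) * (f - f0)) := by
        apply List.map_congr_left; intro f _; ring
      rw [this, List.prod_map_mul]; simp
    rw [h2]
    simp only [List.length_cons, Nat.choose_succ_succ' _ 1, Nat.choose_one_right, pow_add]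
    ring

end Stmt0

open scoped BigOperators
namespace Stmt0
open Polynomial

theorem seg_eq (a b : ℤ) (k : ℕ) (h : (b - a + 1).toNat = k) :
    seg a b = (List.range k).map (fun i : ℕ => a + (i : ℤ)) := by
  unfold seg; rw [h]; simp only [bind_pure_comp, List.map_eq_map, List.map_map]; rfl

theorem seg_nil (a b : ℤ) (h : b < a) : seg a b = [] := by
  rw [seg_eq a b 0 (by omega)]; rfl

/-- the final rows -/
noncomputable def gam (f : ℂ) : EE →ₗ[ℂ] ℂ := evx f - evy f

@[simp] theorem gam_xc (c : ℂ) (j : ℤ) : gam c (xc j) = c ^ j := by simp [gam]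
@[simp] theorem gam_yc (c : ℂ) (j : ℤ) : gam c (yc j) = - c ^ j := by simp [gam]

noncomputable def Om (b1 b2 F : List ℂ) : List (EE →ₗ[ℂ] ℂ) :=
  b1.map evx ++ (b2.map evy ++ F.map gam)

noncomputable def dEnt {ι : Type*} (z : ι → ℂ) (η : ℤ) : ι ⊕ (ι ⊕ ℤ) → ι ⊕ (ℤ ⊕ (ℤ ⊕ ℤ)) → ℂ
  | Sum.inl b, Sum.inl f => 1 / (z b - z f)
  | Sum.inl b, Sum.inr (Sum.inl j) => z b ^ (j - 1)
  | Sum.inl b, Sum.inr (Sum.inr (Sum.inl j)) => z b ^ (j - 1)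
  | Sum.inl _, Sum.inr (Sum.inr (Sum.inr _)) => 0
  | Sum.inr (Sum.inl b), Sum.inl f => (-z f / z b) ^ η / (z b - z f)
  | Sum.inr (Sum.inl b), Sum.inr (Sum.inl j) => z b ^ (j - 1)
  | Sum.inr (Sum.inl _), Sum.inr (Sum.inr (Sum.inl _)) => 0
  | Sum.inr (Sum.inl b), Sum.inr (Sum.inr (Sum.inr j)) => z b ^ (j - 1)
  | Sum.inr (Sum.inr r), Sum.inl f => (-z f) ^ (r - 1)
  | Sum.inr (Sum.inr _), Sum.inr _ => 0

theorem Delta_eq {ι : Type*} (z : ι → ℂ) (B1 B2 F : List ι) (R S T1 T2 : List ℤ) (η : ℤ) :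
    Delta z B1 B2 F R S T1 T2 η = listDet
    ((B1.map (Sum.inl : ι → ι ⊕ (ι ⊕ ℤ)) ++
      B2.map (fun b => (Sum.inr (Sum.inl b) : ι ⊕ (ι ⊕ ℤ))) ++
      R.map (fun r => (Sum.inr (Sum.inr r) : ι ⊕ (ι ⊕ ℤ)))))
    ((F.map (Sum.inl : ι → ι ⊕ (ℤ ⊕ (ℤ ⊕ ℤ))) ++
      S.map (fun j => (Sum.inr (Sum.inl j) : ι ⊕ (ℤ ⊕ (ℤ ⊕ ℤ)))) ++
      T1.map (fun j => (Sum.inr (Sum.inr (Sum.inl j)) : ι ⊕ (ℤ ⊕ (ℤ ⊕ ℤ)))) ++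
      T2.map (fun j => (Sum.inr (Sum.inr (Sum.inr j)) : ι ⊕ (ℤ ⊕ (ℤ ⊕ ℤ)))))) (dEnt z η) := by
  unfold Delta
  apply listDet_congr
  intro r _ c _
  rcases r with r | r | r <;> rcases c with c | c | c | c <;> rfl

theorem delta_upper (b1 b2 F : List ℂ) (hF : F.Nodup)
    (hbF : ∀ b ∈ b1 ++ b2, b ∉ F) (hb0 : ∀ b ∈ b1 ++ b2, b ≠ 0) (hF0 : ∀ f ∈ F, f ≠ 0)
    (η : ℤ) (K1 k1 K2 k2 : ℕ) :
    Delta id b1 b2 F ((List.range K1).map (fun i : ℕ => 1 + (i : ℤ)) ++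
        (List.range K2).map (fun i : ℕ => η + 1 + (i : ℤ))) []
      ((List.range k1).map (fun i : ℕ => 1 + (i : ℤ)))
      ((List.range k2).map (fun i : ℕ => 1 - η + (i : ℤ))) η =
    ((b1.map (fun b => 1 / (PF F).eval b)).prod * (b2.map (fun b => b ^ (-η) / (PF F).eval b)).prod) *
    bd (b1.map evx ++ (b2.map evy ++ ((List.range K1).map (res F evx) ++ (List.range K2).map (res F evy))))
      (F.map (fun f => Xz 0 (ell F f) + ((-f) ^ η) • Yz 0 (ell F f)) ++
        ((List.range k1).map (fun j => Xz 0 (PF F * X ^ j)) ++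
         (List.range k2).map (fun j => Yz 0 (PF F * X ^ j)))) := by
  rw [Delta_eq]
  unfold bd
  simp only [List.map_append, List.map_map, List.map_nil, List.append_nil, List.append_assoc]
  have key := listDet_block b1 b2 (List.range K1) (List.range K2) F (List.range k1) (List.range k2)
    (Sum.inl : ℂ → ℂ ⊕ (ℂ ⊕ ℤ)) (fun b => (Sum.inr (Sum.inl b) : ℂ ⊕ (ℂ ⊕ ℤ)))
    ((fun r => (Sum.inr (Sum.inr r) : ℂ ⊕ (ℂ ⊕ ℤ))) ∘ (fun i : ℕ => 1 + (i : ℤ)))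
    ((fun r => (Sum.inr (Sum.inr r) : ℂ ⊕ (ℂ ⊕ ℤ))) ∘ (fun i : ℕ => η + 1 + (i : ℤ)))
    (Sum.inl : ℂ → ℂ ⊕ (ℤ ⊕ (ℤ ⊕ ℤ)))
    ((fun j => (Sum.inr (Sum.inr (Sum.inl j)) : ℂ ⊕ (ℤ ⊕ (ℤ ⊕ ℤ)))) ∘ (fun i : ℕ => 1 + (i : ℤ)))
    ((fun j => (Sum.inr (Sum.inr (Sum.inr j)) : ℂ ⊕ (ℤ ⊕ (ℤ ⊕ ℤ)))) ∘ (fun i : ℕ => 1 - η + (i : ℤ)))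
    evx evy (res F evx) (res F evy)
    (fun f => Xz 0 (ell F f) + ((-f) ^ η) • Yz 0 (ell F f))
    (fun j => Xz 0 (PF F * X ^ j)) (fun j => Yz 0 (PF F * X ^ j))
    (dEnt id η)
    (fun φ v => φ v)
    (fun b => 1 / (PF F).eval b) (fun b => b ^ (-η) / (PF F).eval b) (fun _ => 1) (fun _ => 1)
    (fun _ => 1) (fun _ => 1) (fun _ => 1)
    ?_ ?_ ?_ ?_ ?_ ?_ ?_ ?_ ?_ ?_ ?_ ?_
  · rw [key]; simp
  · intro b hb f hf
    have h1 := PF_eval_ne F b (hbF b (by simp [hb]))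
    have h2 : b ≠ f := by rintro rfl; exact hbF b (by simp [hb]) hf
    have h3 := sub_ne_zero.mpr h2
    simp [dEnt, ell_eval_ne F f b hf h2]
    field_simp
  · intro b hb j hj
    have h1 := PF_eval_ne F b (hbF b (by simp [hb]))
    simp [dEnt]
    field_simp
  · intro b hb j hj
    simp [dEnt]
  · intro b hb f hf
    have h1 := PF_eval_ne F b (hbF b (by simp [hb]))
    have h2 : b ≠ f := by rintro rfl; exact hbF b (by simp [hb]) hf
    have h3 := sub_ne_zero.mpr h2
    have h4 := hb0 b (by simp [hb])
    simp [dEnt, ell_eval_ne F f b hf h2, div_zpow]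
    field_simp
  · intro b hb j hj
    simp [dEnt]
  · intro b hb j hj
    have h1 := PF_eval_ne F b (hbF b (by simp [hb]))
    have h4 := hb0 b (by simp [hb])
    have h5 : b ^ (1 - η + (j : ℤ) - 1) = b ^ (-η) * b ^ j := by
      rw [show 1 - η + (j : ℤ) - 1 = -η + j by ring, zpow_add₀ h4, zpow_natCast]
    simp [dEnt, h5]
    field_simp
  · intro r hr f hf
    simp only [one_mul]
    rw [res_ell F hF evx r _ f hf 1 (by intro g hg; simp)]
    simp [dEnt]
  · intro r hr j hj
    simp only [one_mul]
    rw [res_zero _ _ _ _ (by intro f hf; simp [PF_eval_mem F f hf])]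
    rfl
  · intro r hr j hj
    simp only [one_mul]
    rw [res_zero _ _ _ _ (by intro f hf; simp)]
    rfl
  · intro r hr f hf
    simp only [one_mul]
    rw [res_ell F hF evy r _ f hf ((-f) ^ η) (by intro g hg; simp)]
    have := neg_ne_zero.mpr (hF0 f hf)
    simp only [Function.comp, dEnt, id]
    rw [show η + 1 + (r : ℤ) - 1 = r + η by ring, zpow_add₀ this, zpow_natCast]
  · intro r hr j hj
    simp only [one_mul]
    rw [res_zero _ _ _ _ (by intro f hf; simp)]
    rfl
  · intro r hr j hj
    simp only [one_mul]
    rw [res_zero _ _ _ _ (by intro f hf; simp [PF_eval_mem F f hf])]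
    rfl

end Stmt0

open scoped BigOperators
namespace Stmt0
open Polynomial

theorem pairProd_ne {ι : Type*} (L : List ι) (g : ι → ι → ℂ) (hL : L.Nodup)
    (h : ∀ a ∈ L, ∀ b ∈ L, a ≠ b → g a b ≠ 0) : pairProd L g ≠ 0 := by
  induction L with
  | nil => simp [pairProd_nil]
  | cons a L ih =>
    rw [pairProd_cons]
    rw [List.nodup_cons] at hL
    refine mul_ne_zero ?_ (ih hL.2 (fun x hx y hy => h x (by simp [hx]) y (by simp [hy])))
    rw [Ne, List.prod_eq_zero_iff, List.mem_map]
    rintro ⟨b, hb, h2⟩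
    refine h a (by simp) b (by simp [hb]) ?_ h2
    rintro rfl; exact hL.1 hb

noncomputable def VF (F : List ℂ) : ℂ := pairProd F (fun f f' => f' - f)

theorem VF_ne (F : List ℂ) (hF : F.Nodup) : VF F ≠ 0 :=
  pairProd_ne F _ hF (fun _ _ _ _ h => sub_ne_zero.mpr (Ne.symm h))

/-- border a determinant by rows `G` and columns `c` with diagonal pairing -/
theorem bd_border {E : Type*} [AddCommGroup E] [Module ℂ E] (rows : List (E →ₗ[ℂ] ℂ)) (cols : List E)
    (F : List ℂ) (hF : F.Nodup) (G : ℂ → (E →ₗ[ℂ] ℂ)) (c : ℂ → E)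
    (h0 : ∀ f ∈ F, ∀ v ∈ cols, G f v = 0)
    (h1 : ∀ f ∈ F, ∀ g ∈ F, f ≠ g → G f (c g) = 0) :
    bd (rows ++ F.map G) (cols ++ F.map c) = bd rows cols * (F.map (fun f => G f (c f))).prod := by
  unfold bd
  rw [listDet_append _ _ _ _ _ (by simp), listDet_diag F hF]
  · exact h1
  · intro r hr v hv
    rw [List.mem_map] at hr
    obtain ⟨f, hf, rfl⟩ := hr
    exact h0 f hf v hv

noncomputable def Geta (η : ℤ) (f : ℂ) : EE →ₗ[ℂ] ℂ := ((-f) ^ η) • evx f - evy f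

theorem upper_step1 (b1 b2 F : List ℂ) (hF : F.Nodup) (η : ℤ) (K1 k1 K2 k2 : ℕ) :
    bd (b1.map evx ++ (b2.map evy ++ ((List.range K1).map (res F evx) ++ (List.range K2).map (res F evy))))
      (F.map (fun f => Xz 0 (ell F f) + ((-f) ^ η) • Yz 0 (ell F f)) ++
        ((List.range k1).map (fun j => Xz 0 (PF F * X ^ j)) ++
         (List.range k2).map (fun j => Yz 0 (PF F * X ^ j)))) *
      ((-1) ^ F.length * ((-1) ^ (F.length.choose 2) * VF F ^ 2)) =
    bd (b1.map evx ++ (b2.map evy ++ ((List.range K1).map (res F evx) ++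
        ((List.range K2).map (res F evy) ++ F.map (Geta η)))))
      (F.map (fun f => Xz 0 (ell F f)) ++
        ((List.range k1).map (fun j => Xz 0 (PF F * X ^ j)) ++
         ((List.range k2).map (fun j => Yz 0 (PF F * X ^ j)) ++ F.map (fun f => Yz 0 (ell F f))))) := by
  have h1 := bd_border (b1.map evx ++ (b2.map evy ++ ((List.range K1).map (res F evx) ++ (List.range K2).map (res F evy))))
      (F.map (fun f => Xz 0 (ell F f) + ((-f) ^ η) • Yz 0 (ell F f)) ++
        ((List.range k1).map (fun j => Xz 0 (PF F * X ^ j)) ++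
         (List.range k2).map (fun j => Yz 0 (PF F * X ^ j)))) F hF (Geta η)
         (fun f => Yz 0 (ell F f)) (by
      intro f hf v hv
      simp only [List.mem_append, List.mem_map] at hv
      rcases hv with ⟨g, hg, rfl⟩ | ⟨j, _, rfl⟩ | ⟨j, _, rfl⟩
      · by_cases hfg : f = g
        · subst hfg; simp [Geta]
        · simp [Geta, ell_eval_zero F g f hg hf hfg]
      · simp [Geta, PF_eval_mem F f hf]
      · simp [Geta, PF_eval_mem F f hf]) (by
      intro f hf g hg hfg
      simp [Geta, ell_eval_zero F g f hg hf hfg])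
  have h2 : (F.map (fun f => Geta η f (Yz 0 (ell F f)))).prod =
      (-1) ^ F.length * ((-1) ^ (F.length.choose 2) * VF F ^ 2) := by
    have : F.map (fun f => Geta η f (Yz 0 (ell F f))) = F.map (fun f => (-1) * (ell F f).eval f) := by
      apply List.map_congr_left; intro f _; simp [Geta]
    rw [this, List.prod_map_mul, prod_ell F hF]; simp [VF]
  rw [h2] at h1
  rw [← h1]
  have h3 := bd_sub (b1.map evx ++ (b2.map evy ++ ((List.range K1).map (res F evx) ++
        ((List.range K2).map (res F evy) ++ F.map (Geta η))))) []
        ((List.range k1).map (fun j => Xz 0 (PF F * X ^ j)) ++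
         ((List.range k2).map (fun j => Yz 0 (PF F * X ^ j)) ++ F.map (fun f => Yz 0 (ell F f))))
        F (fun f => Xz 0 (ell F f) + ((-f) ^ η) • Yz 0 (ell F f)) (fun f => Xz 0 (ell F f)) (by
      intro f hf
      simp only [add_sub_cancel_left]
      apply Submodule.smul_mem
      apply Submodule.subset_span
      simp only [Set.mem_ofPred_eq, List.nil_append, List.mem_append, List.mem_map]
      right; right; exact ⟨f, hf, rfl⟩)
  simp only [List.nil_append] at h3
  simp only [List.append_assoc]
  rw [h3]

theorem upper_step2 (b1 b2 F : List ℂ) (hF : F.Nodup) (η : ℤ) (K1 k1 K2 k2 d1 d2 : ℕ)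
    (h1 : k1 = 0 ∨ K1 = 0) (h2 : k2 = 0 ∨ K2 = 0)
    (hd1 : F.length + k1 - K1 = d1) (hd2 : F.length + k2 - K2 = d2)
    (hlen : b1.length + b2.length + K1 + K2 = F.length + k1 + k2) :
    bd (b1.map evx ++ (b2.map evy ++ ((List.range K1).map (res F evx) ++
        ((List.range K2).map (res F evy) ++ F.map (Geta η)))))
      (F.map (fun f => Xz 0 (ell F f)) ++
        ((List.range k1).map (fun j => Xz 0 (PF F * X ^ j)) ++
         ((List.range k2).map (fun j => Yz 0 (PF F * X ^ j)) ++ F.map (fun f => Yz 0 (ell F f))))) =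
    (-1) ^ (K1 * (K2 + F.length) + K2 * F.length + K1 * (k2 + F.length) + d1 * (k2 + F.length) +
        k2 * F.length + K2 * d1 + d2 * d1) * VF F ^ 2 *
    bd (b1.map evx ++ (b2.map evy ++ F.map (Geta η)))
      ((List.range d1).map (fun j => Xz 0 (X ^ j)) ++ (List.range d2).map (fun j => Yz 0 (X ^ j))) := by
  have r1 := bd_rowswap (b1.map evx ++ b2.map evy) ((List.range K1).map (res F evx))
    ((List.range K2).map (res F evy) ++ F.map (Geta η)) []
  have r2 := bd_rowswap (b1.map evx ++ b2.map evy) ((List.range K2).map (res F evy)) (F.map (Geta η))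
    ((List.range K1).map (res F evx))
  simp only [List.append_assoc, List.append_nil] at r1 r2
  rw [r1, r2]
  have l1 := lemX (Xz 0) (b1.map evx ++ (b2.map evy ++ (F.map (Geta η) ++ (List.range K2).map (res F evy))))
    ((List.range k2).map (fun j => Yz 0 (PF F * X ^ j)) ++ F.map (fun f => Yz 0 (ell F f))) F hF k1 K1 h1
    (res F evx) 1 (by simp; omega) (by
      intro r hr f hf
      rw [res_ell F hF evx r _ f hf 1 (by intro g hg; simp)]; ring) (by
      intro r hr o ho
      apply res_zero
      intro f hf
      simp only [List.mem_append, List.mem_map] at ho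
      rcases ho with ⟨j, _, rfl⟩ | ⟨j, _, rfl⟩ <;> simp)
  simp only [List.append_assoc] at l1
  rw [l1, hd1]
  have c1 := bd_swap (b1.map evx ++ (b2.map evy ++ (F.map (Geta η) ++ (List.range K2).map (res F evy))))
    [] ((List.range d1).map (fun j => Xz 0 (X ^ j)))
    ((List.range k2).map (fun j => Yz 0 (PF F * X ^ j)) ++ F.map (fun f => Yz 0 (ell F f))) []
  have c2 := bd_swap (b1.map evx ++ (b2.map evy ++ (F.map (Geta η) ++ (List.range K2).map (res F evy))))
    [] ((List.range k2).map (fun j => Yz 0 (PF F * X ^ j))) (F.map (fun f => Yz 0 (ell F f)))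
    ((List.range d1).map (fun j => Xz 0 (X ^ j)))
  simp only [List.nil_append, List.append_nil, List.append_assoc] at c1 c2
  rw [c1, c2]
  by_cases hK1 : F.length + k1 < K1
  · -- everything vanishes
    have e1 : d1 = 0 := by omega
    subst e1
    rw [bd_ne, bd_ne (rows := b1.map evx ++ (b2.map evy ++ F.map (Geta η)))]
    · simp
    · simp; omega
    · simp; omega
  have l2 := lemX (Yz 0) (b1.map evx ++ (b2.map evy ++ (F.map (Geta η))))
    ((List.range d1).map (fun j => Xz 0 (X ^ j))) F hF k2 K2 h2
    (res F evy) 1 (by simp; omega) (by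
      intro r hr f hf
      rw [res_ell F hF evy r _ f hf 1 (by intro g hg; simp)]; ring) (by
      intro r hr o ho
      apply res_zero
      intro f hf
      simp only [List.mem_map] at ho
      rcases ho with ⟨j, _, rfl⟩
      simp)
  simp only [List.append_assoc] at l2
  rw [l2, hd2]
  have c3 := bd_swap (b1.map evx ++ (b2.map evy ++ (F.map (Geta η))))
    [] ((List.range d2).map (fun j => Yz 0 (X ^ j)))
    ((List.range d1).map (fun j => Xz 0 (X ^ j))) []
  simp only [List.nil_append, List.append_nil, List.append_assoc] at c3
  rw [c3]
  simp only [List.length_map, List.length_range, List.length_append, one_pow, mul_one, pow_add, VF]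
  have hh : ((-1 : ℂ) ^ F.length.choose 2) ^ 2 = 1 := by
    rw [← pow_mul, mul_comm, pow_mul]; simp
  generalize (-1 : ℂ) ^ F.length.choose 2 = ch at *
  linear_combination ((-1) ^ (K1 * (K2 + F.length)) * (-1) ^ (K2 * F.length) * (-1) ^ (K1 * (k2 + F.length)) *
    (-1) ^ (d1 * (k2 + F.length)) *  (-1) ^ (k2 * F.length) * (-1) ^ (K2 * d1) * (-1) ^ (d2 * d1) *
    (pairProd F fun f f' => f' - f) ^ 2 *
    bd (b1.map evx ++ (b2.map evy ++ F.map (Geta η)))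
      ((List.range d1).map (fun j => Xz 0 (X ^ j)) ++ (List.range d2).map (fun j => Yz 0 (X ^ j)))) * hh

theorem upper_step3 (b1 b2 F : List ℂ)
    (hb0 : ∀ b ∈ b1 ++ b2, b ≠ 0) (hF0 : ∀ f ∈ F, f ≠ 0) (η : ℤ) (d1 d2 : ℕ) :
    bd (b1.map evx ++ (b2.map evy ++ F.map (Geta η)))
      ((List.range d1).map (fun j => Xz 0 (X ^ j)) ++ (List.range d2).map (fun j => Yz 0 (X ^ j))) =
    ((-1) ^ η) ^ (b1.length + d1) * (b1.map (fun b => b ^ (-η))).prod *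
    bd (Om b1 b2 F) ((List.range d1).map (fun j : ℕ => xc (η + j)) ++
      (List.range d2).map (fun j : ℕ => yc (0 + j))) := by
  have hep : ((-1 : ℂ) ^ η) ^ 2 = 1 := by
    rw [← zpow_natCast, ← zpow_mul, mul_comm, zpow_mul]; simp
  have key := listDet_block b1 b2 F ([] : List ℂ) (List.range d1) (List.range d2) ([] : List ℂ)
    evx evy (Geta η) (fun _ => 0) (fun j => Xz 0 (X ^ j)) (fun j => Yz 0 (X ^ j)) (fun _ => 0)
    evx evy gam (fun _ => 0) (fun j : ℕ => xc (η + j)) (fun j : ℕ => yc (0 + j)) (fun _ => 0)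
    (fun φ v => φ v) (fun φ v => φ v)
    (fun b => (-1) ^ η * b ^ (-η)) (fun _ => 1) (fun _ => 1) (fun _ => 1)
    (fun _ => (-1) ^ η) (fun _ => 1) (fun _ => 1)
    (by
      intro b hb j _
      have := hb0 b (by simp [hb])
      simp [zpow_add₀ this]
      field_simp
      rw [hep])
    (by intros; simp) (by intros; simp) (by intros; simp) (by intros; simp) (by intros; simp)
    (by
      intro f hf j _
      have := hF0 f hf
      simp [Geta, zpow_add₀ this]
      rw [neg_eq_neg_one_mul, mul_zpow]; ring)
    (by intros; simp [Geta]) (by intros; simp) (by intros; simp) (by intros; simp) (by intros; simp)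
  simp only [List.map_nil, List.append_nil, List.prod_nil] at key
  unfold bd Om
  rw [key]
  simp only [List.prod_map_mul, pow_add]
  simp
  ring

theorem upper_core (b1 b2 F : List ℂ) (hF : F.Nodup)
    (hbF : ∀ b ∈ b1 ++ b2, b ∉ F) (hb0 : ∀ b ∈ b1 ++ b2, b ≠ 0) (hF0 : ∀ f ∈ F, f ≠ 0)
    (η : ℤ) (K1 k1 K2 k2 d1 d2 : ℕ)
    (h1 : k1 = 0 ∨ K1 = 0) (h2 : k2 = 0 ∨ K2 = 0)
    (hd1 : F.length + k1 - K1 = d1) (hd2 : F.length + k2 - K2 = d2)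
    (hlen : b1.length + b2.length + K1 + K2 = F.length + k1 + k2) :
    Delta id b1 b2 F ((List.range K1).map (fun i : ℕ => 1 + (i : ℤ)) ++
        (List.range K2).map (fun i : ℕ => η + 1 + (i : ℤ))) []
      ((List.range k1).map (fun i : ℕ => 1 + (i : ℤ)))
      ((List.range k2).map (fun i : ℕ => 1 - η + (i : ℤ))) η =
    (-1) ^ (K1 * (K2 + F.length) + K2 * F.length + K1 * (k2 + F.length) + d1 * (k2 + F.length) +
        k2 * F.length + K2 * d1 + d2 * d1 + F.length + F.length.choose 2) *
      ((-1) ^ η) ^ (b1.length + d1) * ((b1 ++ b2).map (fun b => b ^ (-η) / (PF F).eval b)).prod *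
    bd (Om b1 b2 F) ((List.range d1).map (fun j : ℕ => xc (η + j)) ++
      (List.range d2).map (fun j : ℕ => yc (0 + j))) := by
  rw [delta_upper b1 b2 F hF hbF hb0 hF0]
  have s1 := upper_step1 b1 b2 F hF η K1 k1 K2 k2
  rw [upper_step2 b1 b2 F hF η K1 k1 K2 k2 d1 d2 h1 h2 hd1 hd2 hlen, upper_step3 b1 b2 F hb0 hF0] at s1
  have hV := VF_ne F hF
  set H := bd (Om b1 b2 F) ((List.range d1).map (fun j : ℕ => xc (η + j)) ++
      (List.range d2).map (fun j : ℕ => yc (0 + j)))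
  set D := bd (b1.map evx ++ (b2.map evy ++ ((List.range K1).map (res F evx) ++ (List.range K2).map (res F evy))))
      (F.map (fun f => Xz 0 (ell F f) + ((-f) ^ η) • Yz 0 (ell F f)) ++
        ((List.range k1).map (fun j => Xz 0 (PF F * X ^ j)) ++
         (List.range k2).map (fun j => Yz 0 (PF F * X ^ j))))
  have hD : D = (-1) ^ (K1 * (K2 + F.length) + K2 * F.length + K1 * (k2 + F.length) + d1 * (k2 + F.length) +
        k2 * F.length + K2 * d1 + d2 * d1 + F.length + F.length.choose 2) *
      ((-1) ^ η) ^ (b1.length + d1) * (b1.map (fun b => b ^ (-η))).prod * H := by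
    have hh : ((-1 : ℂ) ^ F.length.choose 2) ^ 2 = 1 := by
      rw [← pow_mul, mul_comm, pow_mul]; simp
    have hh' : ((-1 : ℂ) ^ F.length) ^ 2 = 1 := by
      rw [← pow_mul, mul_comm, pow_mul]; simp
    have hs := congrArg (fun w => w * (-1) ^ F.length * (-1) ^ F.length.choose 2 / VF F ^ 2) s1
    have e1 : D * ((-1) ^ F.length * ((-1) ^ F.length.choose 2 * VF F ^ 2)) * (-1) ^ F.length *
        (-1) ^ F.length.choose 2 / VF F ^ 2 = D * ((-1) ^ F.length) ^ 2 * ((-1) ^ F.length.choose 2) ^ 2 := by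
      field_simp
    rw [e1, hh, hh', mul_one, mul_one] at hs
    rw [hs, pow_add _ _ (F.length.choose 2), pow_add _ _ F.length]
    field_simp
  rw [hD]
  simp only [List.map_append, List.prod_append, div_eq_mul_inv, List.prod_map_mul, one_mul]
  ring

end Stmt0

open scoped BigOperators
namespace Stmt0
open Polynomial

theorem bd_congr2 {E γ δ : Type*} [AddCommGroup E] [Module ℂ E] (rows : List (E →ₗ[ℂ] ℂ))
    (A : List γ) (B : List δ) (g g' : γ → E) (h h' : δ → E)
    (hg : ∀ φ ∈ rows, ∀ a ∈ A, φ (g a) = φ (g' a))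
    (hh : ∀ φ ∈ rows, ∀ b ∈ B, φ (h b) = φ (h' b)) :
    bd rows (A.map g ++ B.map h) = bd rows (A.map g' ++ B.map h') := by
  unfold bd
  rw [← map_elim_append A B g h, ← map_elim_append A B g' h']
  have := listDet_cmp rows (A.map (Sum.inl : γ → γ ⊕ δ) ++ B.map Sum.inr) id (Sum.elim g h) id
    (Sum.elim g' h') (fun φ v => φ v) (fun φ v => φ v) (fun _ => 1) (fun _ => 1) (by
      intro φ hφ c hc
      rcases c with c | c
      · simpa using hg φ hφ c (mem_inl_aux hc)
      · simpa using hh φ hφ c (mem_inr_aux hc))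
  simpa [Function.comp_def] using this

noncomputable def Up : ℂ[X] →ₗ[ℂ] EE := Xz 0 + Yz 0

@[simp] theorem evx_Up (c : ℂ) (p : ℂ[X]) : evx c (Up p) = p.eval c := by simp [Up]
@[simp] theorem evy_Up (c : ℂ) (p : ℂ[X]) : evy c (Up p) = p.eval c := by simp [Up]
@[simp] theorem gam_Up (c : ℂ) (p : ℂ[X]) : gam c (Up p) = 0 := by simp [gam]

theorem core_RL (b1 b2 F : List ℂ) (hF : F.Nodup) (hF0 : ∀ f ∈ F, f ≠ 0)
    (hb0 : ∀ b ∈ b1 ++ b2, b ≠ 0)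
    (p : ℤ) (K k a l : ℕ) (W : ℂ[X] →ₗ[ℂ] EE) (wc : ℤ → EE) (σ : ℂ) (hσ : σ ^ 2 = 1)
    (hW1 : ∀ f ∈ F, ∀ q, q.eval f = 0 → evx f (W q) = 0)
    (hW2 : ∀ f ∈ F, ∀ q, gam f (W q) = σ * (f ^ p * q.eval f))
    (hW3 : ∀ c, c ≠ 0 → ∀ j : ℕ, evx c (W (X ^ j)) = evx c (wc (p + j)))
    (hW4 : ∀ c, c ≠ 0 → ∀ j : ℕ, evy c (W (X ^ j)) = evy c (wc (p + j)))
    (hkK : k = 0 ∨ K = 0) (hl : F.length + k - K = l)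
    (hlen : b1.length + b2.length + K = F.length + k + a) :
    bd (b1.map evx ++ (b2.map evy ++ (List.range K).map (res F evx)))
      (F.map (fun f => Up (ell F f)) ++ ((List.range k).map (fun j => Up (PF F * X ^ j)) ++
        (List.range a).map (fun j => W (PF F * X ^ j)))) =
    (-1) ^ (K * a + l * (a + F.length) + a * F.length + F.length.choose 2) * σ ^ F.length *
      (F.map (fun f => f ^ (-p))).prod *
    bd (Om b1 b2 F) ((List.range (F.length + a)).map (fun j : ℕ => wc (p + j)) ++
      (List.range l).map (fun j : ℕ => uc (0 + j))) := by
  have l1 := lemX Up (b1.map evx ++ b2.map evy)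
    ((List.range a).map (fun j => W (PF F * X ^ j))) F hF k K hkK
    (res F evx) 1 (by simp; omega) (by
      intro r hr f hf
      rw [res_ell F hF evx r _ f hf 1 (by intro g hg; simp)]; ring) (by
      intro r hr o ho
      apply res_zero
      intro f hf
      simp only [List.mem_map] at ho
      rcases ho with ⟨j, _, rfl⟩
      exact hW1 f hf _ (by simp [PF_eval_mem F f hf]))
  simp only [List.append_assoc] at l1
  rw [l1, hl]
  by_cases hK1 : F.length + k < K
  · have e1 : l = 0 := by omega
    subst e1
    rw [bd_ne, bd_ne (rows := Om b1 b2 F)]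
    · simp
    · simp [Om]; omega
    · simp; omega
  have h1 := bd_border (b1.map evx ++ b2.map evy)
      ((List.range l).map (fun j => Up (X ^ j)) ++
        (List.range a).map (fun j => W (PF F * X ^ j))) F hF gam
         (fun f => W (ell F f)) (by
      intro f hf v hv
      simp only [List.mem_append, List.mem_map] at hv
      rcases hv with ⟨j, _, rfl⟩ | ⟨j, _, rfl⟩
      · simp
      · rw [hW2 f hf]; simp [PF_eval_mem F f hf]) (by
      intro f hf g hg hfg
      rw [hW2 f hf]; simp [ell_eval_zero F g f hg hf hfg])
  have h2 : (F.map (fun f => gam f (W (ell F f)))).prod =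
      σ ^ F.length * ((F.map (fun f => f ^ p)).prod * ((-1) ^ (F.length.choose 2) * VF F ^ 2)) := by
    have : F.map (fun f => gam f (W (ell F f))) = F.map (fun f => σ * (f ^ p * (ell F f).eval f)) := by
      apply List.map_congr_left; intro f hf; exact hW2 f hf _
    rw [this, List.prod_map_mul, List.prod_map_mul, prod_ell F hF]; simp [VF]
  rw [h2] at h1
  have c1 := bd_swap (Om b1 b2 F) [] ((List.range l).map (fun j => Up (X ^ j)))
    ((List.range a).map (fun j => W (PF F * X ^ j)) ++ F.map (fun f => W (ell F f))) []
  have c2 := bd_swap (Om b1 b2 F) [] ((List.range a).map (fun j => W (PF F * X ^ j)))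
    (F.map (fun f => W (ell F f))) ((List.range l).map (fun j => Up (X ^ j)))
  have l2 := lemX W (Om b1 b2 F) ((List.range l).map (fun j => Up (X ^ j))) F hF a 0 (Or.inr rfl)
    (fun _ => 0) 1 (by simp [Om]; omega) (by simp) (by simp)
  simp only [List.nil_append, List.append_nil, List.append_assoc, List.range_zero, List.map_nil] at c1 c2 l2 h1
  unfold Om at c1 c2 l2
  rw [c1, c2, l2] at h1
  have h3 : bd (b1.map evx ++ (b2.map evy ++ F.map gam))
      ((List.range (F.length + a - 0)).map (fun j => W (X ^ j)) ++ (List.range l).map (fun j => Up (X ^ j))) =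
      bd (Om b1 b2 F) ((List.range (F.length + a)).map (fun j : ℕ => wc (p + j)) ++
      (List.range l).map (fun j : ℕ => uc (0 + j))) := by
    unfold Om
    apply bd_congr2
    · intro φ hφ j _
      simp only [List.mem_append, List.mem_map] at hφ
      rcases hφ with ⟨b, hb, rfl⟩ | ⟨b, hb, rfl⟩ | ⟨f, hf, rfl⟩
      · exact hW3 b (hb0 b (by simp [hb])) j
      · exact hW4 b (hb0 b (by simp [hb])) j
      · simp only [gam, LinearMap.sub_apply]
        rw [hW3 f (hF0 f hf), hW4 f (hF0 f hf)]
    · intro φ hφ j _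
      simp only [List.mem_append, List.mem_map] at hφ
      rcases hφ with ⟨b, hb, rfl⟩ | ⟨b, hb, rfl⟩ | ⟨f, hf, rfl⟩
      · simp [uc]
      · simp [uc]
      · simp [uc]
  rw [h3] at h1
  set H := bd (Om b1 b2 F) ((List.range (F.length + a)).map (fun j : ℕ => wc (p + j)) ++
      (List.range l).map (fun j : ℕ => uc (0 + j)))
  set D := bd (b1.map evx ++ b2.map evy) ((List.range l).map (fun j => Up (X ^ j)) ++
        (List.range a).map (fun j => W (PF F * X ^ j)))
  have hV := VF_ne F hF
  have hh : ((-1 : ℂ) ^ F.length.choose 2) ^ 2 = 1 := by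
    rw [← pow_mul, mul_comm, pow_mul]; simp
  have hs2 : (σ ^ F.length) ^ 2 = 1 := by rw [← pow_mul, mul_comm, pow_mul, hσ, one_pow]
  have hz : (F.map (fun f => f ^ p)).prod * (F.map (fun f => f ^ (-p))).prod = 1 := by
    rw [← List.prod_map_mul]
    apply List.prod_eq_one
    intro x hx
    simp only [List.mem_map] at hx
    obtain ⟨f, hf, rfl⟩ := hx
    rw [← zpow_add₀ (hF0 f hf)]; simp
  simp only [List.length_map, List.length_range, List.length_append, one_pow, mul_one, pow_add, zero_mul, add_zero,
    pow_zero] at h1 ⊢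
  change _ * VF F * _ = _
  change _ * (_ * (_ * VF F * H)) = _ at h1
  have hD : D * VF F = σ ^ F.length * (F.map (fun f => f ^ (-p))).prod *
      ((-1) ^ (l * (a + F.length)) * ((-1) ^ (a * F.length) * H)) := by
    have h4 := congrArg (fun w => w * σ ^ F.length * (F.map (fun f => f ^ (-p))).prod *
      (-1) ^ F.length.choose 2 / VF F) h1
    have e1 : D * (σ ^ F.length * ((F.map (fun f => f ^ p)).prod * ((-1) ^ (F.length.choose 2) * VF F ^ 2))) *
        σ ^ F.length * (F.map (fun f => f ^ (-p))).prod * (-1) ^ F.length.choose 2 / VF F =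
        D * VF F * (σ ^ F.length) ^ 2 * ((F.map (fun f => f ^ p)).prod * (F.map (fun f => f ^ (-p))).prod) *
          ((-1 : ℂ) ^ F.length.choose 2) ^ 2 := by
      field_simp
    simp only [e1, hh, hs2, hz, mul_one] at h4
    rw [← h4]
    have e2 : ∀ S A T U V P : ℂ, V ≠ 0 → S * (A * (U * V * T)) * P * U / V = P * (S * (A * T)) * U ^ 2 := by
      intro S A T U V P hV; field_simp
    have e3 : ∀ S A T U V P Q: ℂ, V ≠ 0 → S * (A * (U * V * T)) * P * Q * U / V = P * Q * (S * (A * T)) * U ^ 2 := by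
      intro S A T U V P Q hV; field_simp
    rw [e3 _ _ _ _ _ _ _ hV, hh, mul_one]
  linear_combination ((-1) ^ F.length.choose 2 * (-1) ^ (K * a)) * hD

theorem delta_right (b1 b2 F : List ℂ) (hF : F.Nodup)
    (hbF : ∀ b ∈ b1 ++ b2, b ∉ F) (hb0 : ∀ b ∈ b1 ++ b2, b ≠ 0)
    (p : ℤ) (K k a : ℕ) :
    Delta id b1 b2 F ((List.range K).map (fun i : ℕ => 1 + (i : ℤ)))
      ((List.range k).map (fun i : ℕ => 1 + (i : ℤ)))
      ((List.range a).map (fun i : ℕ => p + 1 + (i : ℤ))) [] 0 =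
    ((b1 ++ b2).map (fun b => 1 / (PF F).eval b)).prod *
    bd (b1.map evx ++ (b2.map evy ++ (List.range K).map (res F evx)))
      (F.map (fun f => Up (ell F f)) ++ ((List.range k).map (fun j => Up (PF F * X ^ j)) ++
        (List.range a).map (fun j => Xz p (PF F * X ^ j)))) := by
  rw [Delta_eq]
  unfold bd
  simp only [List.map_append, List.map_map, List.map_nil, List.append_nil, List.append_assoc, List.prod_append]
  have key := listDet_block b1 b2 (List.range K) ([] : List ℂ) F (List.range k) (List.range a)
    (Sum.inl : ℂ → ℂ ⊕ (ℂ ⊕ ℤ)) (fun b => (Sum.inr (Sum.inl b) : ℂ ⊕ (ℂ ⊕ ℤ)))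
    ((fun r => (Sum.inr (Sum.inr r) : ℂ ⊕ (ℂ ⊕ ℤ))) ∘ (fun i : ℕ => 1 + (i : ℤ)))
    (fun _ => (Sum.inr (Sum.inr 0) : ℂ ⊕ (ℂ ⊕ ℤ)))
    (Sum.inl : ℂ → ℂ ⊕ (ℤ ⊕ (ℤ ⊕ ℤ)))
    ((fun j => (Sum.inr (Sum.inl j) : ℂ ⊕ (ℤ ⊕ (ℤ ⊕ ℤ)))) ∘ (fun i : ℕ => 1 + (i : ℤ)))
    ((fun j => (Sum.inr (Sum.inr (Sum.inl j)) : ℂ ⊕ (ℤ ⊕ (ℤ ⊕ ℤ)))) ∘ (fun i : ℕ => p + 1 + (i : ℤ)))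
    evx evy (res F evx) (fun _ => 0)
    (fun f => Up (ell F f))
    (fun j => Up (PF F * X ^ j)) (fun j => Xz p (PF F * X ^ j))
    (dEnt id 0) (fun φ v => φ v)
    (fun b => 1 / (PF F).eval b) (fun b => 1 / (PF F).eval b) (fun _ => 1) (fun _ => 1)
    (fun _ => 1) (fun _ => 1) (fun _ => 1)
    ?_ ?_ ?_ ?_ ?_ ?_ ?_ ?_ ?_ ?_ ?_ ?_
  · simp only [List.map_nil, List.append_nil] at key
    rw [key]; simp
  · intro b hb f hf
    have h1 := PF_eval_ne F b (hbF b (by simp [hb]))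
    have h2 : b ≠ f := by rintro rfl; exact hbF b (by simp [hb]) hf
    have h3 := sub_ne_zero.mpr h2
    simp [dEnt, ell_eval_ne F f b hf h2]
    field_simp
  · intro b hb j hj
    have h1 := PF_eval_ne F b (hbF b (by simp [hb]))
    simp [dEnt]
    field_simp
  · intro b hb j hj
    have h1 := PF_eval_ne F b (hbF b (by simp [hb]))
    have h4 := hb0 b (by simp [hb])
    have h5 : b ^ (p + 1 + (j : ℤ) - 1) = b ^ p * b ^ j := by
      rw [show p + 1 + (j : ℤ) - 1 = p + j by ring, zpow_add₀ h4, zpow_natCast]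
    simp [dEnt, h5]
    field_simp
  · intro b hb f hf
    have h1 := PF_eval_ne F b (hbF b (by simp [hb]))
    have h2 : b ≠ f := by rintro rfl; exact hbF b (by simp [hb]) hf
    have h3 := sub_ne_zero.mpr h2
    simp [dEnt, ell_eval_ne F f b hf h2]
    field_simp
  · intro b hb j hj
    have h1 := PF_eval_ne F b (hbF b (by simp [hb]))
    simp [dEnt]
    field_simp
  · intro b hb j hj
    simp [dEnt]
  · intro r hr f hf
    simp only [one_mul]
    rw [res_ell F hF evx r _ f hf 1 (by intro g hg; simp)]
    simp [dEnt]
  · intro r hr j hj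
    simp only [one_mul]
    rw [res_zero _ _ _ _ (by intro f hf; simp [PF_eval_mem F f hf])]
    rfl
  · intro r hr j hj
    simp only [one_mul]
    rw [res_zero _ _ _ _ (by intro f hf; simp [PF_eval_mem F f hf])]
    rfl
  · intro r hr; simp at hr
  · intro r hr; simp at hr
  · intro r hr; simp at hr

theorem delta_left (b1 b2 F : List ℂ) (hF : F.Nodup)
    (hbF : ∀ b ∈ b1 ++ b2, b ∉ F) (hb0 : ∀ b ∈ b1 ++ b2, b ≠ 0)
    (p : ℤ) (K k a : ℕ) :
    Delta id b1 b2 F ((List.range K).map (fun i : ℕ => 1 + (i : ℤ)))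
      ((List.range k).map (fun i : ℕ => 1 + (i : ℤ))) []
      ((List.range a).map (fun i : ℕ => p + 1 + (i : ℤ))) 0 =
    ((b1 ++ b2).map (fun b => 1 / (PF F).eval b)).prod *
    bd (b1.map evx ++ (b2.map evy ++ (List.range K).map (res F evx)))
      (F.map (fun f => Up (ell F f)) ++ ((List.range k).map (fun j => Up (PF F * X ^ j)) ++
        (List.range a).map (fun j => Yz p (PF F * X ^ j)))) := by
  rw [Delta_eq]
  unfold bd
  simp only [List.map_append, List.map_map, List.map_nil, List.append_nil, List.append_assoc, List.prod_append]
  have key := listDet_block b1 b2 (List.range K) ([] : List ℂ) F (List.range k) (List.range a)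
    (Sum.inl : ℂ → ℂ ⊕ (ℂ ⊕ ℤ)) (fun b => (Sum.inr (Sum.inl b) : ℂ ⊕ (ℂ ⊕ ℤ)))
    ((fun r => (Sum.inr (Sum.inr r) : ℂ ⊕ (ℂ ⊕ ℤ))) ∘ (fun i : ℕ => 1 + (i : ℤ)))
    (fun _ => (Sum.inr (Sum.inr 0) : ℂ ⊕ (ℂ ⊕ ℤ)))
    (Sum.inl : ℂ → ℂ ⊕ (ℤ ⊕ (ℤ ⊕ ℤ)))
    ((fun j => (Sum.inr (Sum.inl j) : ℂ ⊕ (ℤ ⊕ (ℤ ⊕ ℤ)))) ∘ (fun i : ℕ => 1 + (i : ℤ)))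
    ((fun j => (Sum.inr (Sum.inr (Sum.inr j)) : ℂ ⊕ (ℤ ⊕ (ℤ ⊕ ℤ)))) ∘ (fun i : ℕ => p + 1 + (i : ℤ)))
    evx evy (res F evx) (fun _ => 0)
    (fun f => Up (ell F f))
    (fun j => Up (PF F * X ^ j)) (fun j => Yz p (PF F * X ^ j))
    (dEnt id 0) (fun φ v => φ v)
    (fun b => 1 / (PF F).eval b) (fun b => 1 / (PF F).eval b) (fun _ => 1) (fun _ => 1)
    (fun _ => 1) (fun _ => 1) (fun _ => 1)
    ?_ ?_ ?_ ?_ ?_ ?_ ?_ ?_ ?_ ?_ ?_ ?_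
  · simp only [List.map_nil, List.append_nil] at key
    rw [key]; simp
  · intro b hb f hf
    have h1 := PF_eval_ne F b (hbF b (by simp [hb]))
    have h2 : b ≠ f := by rintro rfl; exact hbF b (by simp [hb]) hf
    have h3 := sub_ne_zero.mpr h2
    simp [dEnt, ell_eval_ne F f b hf h2]
    field_simp
  · intro b hb j hj
    have h1 := PF_eval_ne F b (hbF b (by simp [hb]))
    simp [dEnt]
    field_simp
  · intro b hb j hj
    simp [dEnt]
  · intro b hb f hf
    have h1 := PF_eval_ne F b (hbF b (by simp [hb]))
    have h2 : b ≠ f := by rintro rfl; exact hbF b (by simp [hb]) hf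
    have h3 := sub_ne_zero.mpr h2
    simp [dEnt, ell_eval_ne F f b hf h2]
    field_simp
  · intro b hb j hj
    have h1 := PF_eval_ne F b (hbF b (by simp [hb]))
    simp [dEnt]
    field_simp
  · intro b hb j hj
    have h1 := PF_eval_ne F b (hbF b (by simp [hb]))
    have h4 := hb0 b (by simp [hb])
    have h5 : b ^ (p + 1 + (j : ℤ) - 1) = b ^ p * b ^ j := by
      rw [show p + 1 + (j : ℤ) - 1 = p + j by ring, zpow_add₀ h4, zpow_natCast]
    simp [dEnt, h5]
    field_simp
  · intro r hr f hf
    simp only [one_mul]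
    rw [res_ell F hF evx r _ f hf 1 (by intro g hg; simp)]
    simp [dEnt]
  · intro r hr j hj
    simp only [one_mul]
    rw [res_zero _ _ _ _ (by intro f hf; simp [PF_eval_mem F f hf])]
    rfl
  · intro r hr j hj
    simp only [one_mul]
    rw [res_zero _ _ _ _ (by intro f hf; simp)]
    rfl
  · intro r hr; simp at hr
  · intro r hr; simp at hr
  · intro r hr; simp at hr

theorem right_core (b1 b2 F : List ℂ) (hF : F.Nodup)
    (hbF : ∀ b ∈ b1 ++ b2, b ∉ F) (hb0 : ∀ b ∈ b1 ++ b2, b ≠ 0) (hF0 : ∀ f ∈ F, f ≠ 0)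
    (p : ℤ) (K k a l : ℕ)
    (hkK : k = 0 ∨ K = 0) (hl : F.length + k - K = l)
    (hlen : b1.length + b2.length + K = F.length + k + a) :
    Delta id b1 b2 F ((List.range K).map (fun i : ℕ => 1 + (i : ℤ)))
      ((List.range k).map (fun i : ℕ => 1 + (i : ℤ)))
      ((List.range a).map (fun i : ℕ => p + 1 + (i : ℤ))) [] 0 =
    ((b1 ++ b2).map (fun b => 1 / (PF F).eval b)).prod *
    ((-1) ^ (K * a + l * (a + F.length) + a * F.length + F.length.choose 2) *
      (F.map (fun f => f ^ (-p))).prod *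
    bd (Om b1 b2 F) ((List.range (F.length + a)).map (fun j : ℕ => xc (p + j)) ++
      (List.range l).map (fun j : ℕ => uc (0 + j)))) := by
  rw [delta_right b1 b2 F hF hbF hb0, core_RL b1 b2 F hF hF0 hb0 p K k a l (Xz p) xc 1 (by simp) ?_ ?_ ?_ ?_ hkK hl hlen]
  · simp
  · intro f _ q hq; simp [hq]
  · intro f _ q; simp [gam]
  · intro c hc j; simp [zpow_add₀ hc]
  · intro c hc j; simp

theorem left_core (b1 b2 F : List ℂ) (hF : F.Nodup)
    (hbF : ∀ b ∈ b1 ++ b2, b ∉ F) (hb0 : ∀ b ∈ b1 ++ b2, b ≠ 0) (hF0 : ∀ f ∈ F, f ≠ 0)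
    (p : ℤ) (K k a l : ℕ)
    (hkK : k = 0 ∨ K = 0) (hl : F.length + k - K = l)
    (hlen : b1.length + b2.length + K = F.length + k + a) :
    Delta id b1 b2 F ((List.range K).map (fun i : ℕ => 1 + (i : ℤ)))
      ((List.range k).map (fun i : ℕ => 1 + (i : ℤ))) []
      ((List.range a).map (fun i : ℕ => p + 1 + (i : ℤ))) 0 =
    ((b1 ++ b2).map (fun b => 1 / (PF F).eval b)).prod *
    ((-1) ^ (K * a + l * (a + F.length) + a * F.length + F.length.choose 2) * (-1) ^ F.length *
      (F.map (fun f => f ^ (-p))).prod *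
    bd (Om b1 b2 F) ((List.range (F.length + a)).map (fun j : ℕ => yc (p + j)) ++
      (List.range l).map (fun j : ℕ => uc (0 + j)))) := by
  rw [delta_left b1 b2 F hF hbF hb0, core_RL b1 b2 F hF hF0 hb0 p K k a l (Yz p) yc (-1) (by simp) ?_ ?_ ?_ ?_ hkK hl hlen]
  · intro f _ q hq; simp
  · intro f _ q; simp [gam]
  · intro c hc j; simp
  · intro c hc j; simp [zpow_add₀ hc]

end Stmt0

open scoped BigOperators
namespace Stmt0
open Polynomial
set_option linter.all false

theorem sgn_eq (x y : ℤ) (h : (x : ZMod 2) = y) : (-1 : ℂ) ^ x = (-1) ^ y := by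
  have h1 : (2 : ℤ) ∣ y - x := by
    have := (ZMod.intCast_eq_intCast_iff_dvd_sub x y 2).1 h
    simpa using this
  obtain ⟨k, hk⟩ := h1
  have : y = x + 2 * k := by linarith
  rw [this, zpow_add₀ (by norm_num), zpow_mul]
  norm_num

theorem choose_two_int (m : ℕ) : (m : ℤ) * (m - 1) / 2 = (m.choose 2 : ℕ) := by
  rw [Nat.choose_two_right]
  rcases m with _ | m
  · simp
  · push_cast; simp

/-- A segment of a sequence of test vectors. -/
noncomputable def sq (v : ℤ → EE) (p : ℤ) (k : ℤ) : List EE :=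
  (List.range k.toNat).map (fun j : ℕ => v (p + j))

theorem sq_length (v : ℤ → EE) (p k : ℤ) : (sq v p k).length = k.toNat := by simp [sq]

theorem prod_PF (B F : List ℂ) : (B.map (fun b => 1 / (PF F).eval b)).prod =
    (prodLL B F (fun b f => b - f))⁻¹ := by
  unfold prodLL
  induction B with
  | nil => simp
  | cons b B ih =>
    rw [List.map_cons, List.prod_cons, ih, PF_eval, List.map_cons, List.prod_cons, mul_inv, one_div]

theorem prodLL_ne (B F : List ℂ) (h : ∀ b ∈ B, b ∉ F) : prodLL B F (fun b f => b - f) ≠ 0 := by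
  unfold prodLL
  rw [Ne, List.prod_eq_zero_iff]
  intro h0
  simp only [List.mem_map] at h0
  obtain ⟨b, hb, h1⟩ := h0
  rw [List.prod_eq_zero_iff] at h1
  simp only [List.mem_map] at h1
  obtain ⟨f, hf, h2⟩ := h1
  exact h b hb (by rw [sub_eq_zero.1 h2]; exact hf)

theorem prod_zpow (B : List ℂ) (e : ℤ) : (B.map (fun b => b ^ e)).prod = B.prod ^ e := by
  induction B with
  | nil => simp
  | cons b B ih => rw [List.map_cons, List.prod_cons, ih, List.prod_cons, mul_zpow]

/-- Genericity hypotheses on the parameters. -/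
structure Good (b1 b2 F : List ℂ) : Prop where
  hB : (b1 ++ b2).Nodup
  hF : F.Nodup
  hbF : ∀ b ∈ b1 ++ b2, b ∉ F
  hb0 : ∀ b ∈ b1 ++ b2, b ≠ 0
  hF0 : ∀ f ∈ F, f ≠ 0

/-- The common constant in all the normal forms. -/
noncomputable def cc (b1 b2 F : List ℂ) : ℂ :=
  (-1) ^ (((b1.length + b2.length).choose 2 : ℕ) : ℤ) / (pairProd (b1 ++ b2) (fun b b' => b - b') * VF F)

theorem Good.VB {b1 b2 F : List ℂ} (G : Good b1 b2 F) :
    pairProd (b1 ++ b2) (fun b b' => b - b') ≠ 0 :=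
  pairProd_ne _ _ G.hB (fun _ _ _ _ h => sub_ne_zero.mpr h)

theorem Good.cc_ne {b1 b2 F : List ℂ} (G : Good b1 b2 F) : cc b1 b2 F ≠ 0 :=
  div_ne_zero (zpow_ne_zero _ (by norm_num)) (mul_ne_zero G.VB (VF_ne F G.hF))

theorem Dden_id (B F : List ℂ) : Dden id B F =
    pairProd B (fun b b' => b - b') * VF F / prodLL B F (fun b f => b - f) := rfl

theorem two_add (x : ZMod 2) : x + x = 0 := by revert x; decide
theorem zmod_neg (x : ZMod 2) : -x = x := by revert x; decide

set_option maxRecDepth 100000 in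
set_option maxHeartbeats 1000000 in
theorem signU1 : ∀ a s m1 m2 n1 n2 : ZMod 2,
    (s + (m1 + n1)) * (s + n2) + ((m1 + n2 + s) * ((m2 + n2 + s) + (n1 + n2)) +
      (m2 + n2 + s) * (n1 + n2) + (m2 + n1 + s) * (m1 + n2 + s) + (n1 + n2)) +
      (a + s + (m1 + n1)) * (m1 + (m1 + n2 + s)) =
    a * (n2 + s) + (n1 + n2) * (m2 + n2 + s) + (n1 + n2) := by decide

set_option maxRecDepth 100000 in
set_option maxHeartbeats 1000000 in
theorem signU2 : ∀ a s m1 m2 n1 n2 : ZMod 2,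
    (s + (m1 + n1)) * (s + n2) + ((m2 + n2 + s) * (n1 + n2) + (m1 + n2 + s) * (n1 + n2) +
      (m2 + n2 + s) * (m1 + n2 + s) + (m2 + n1 + s) * (m1 + n2 + s) + (n1 + n2)) +
      (a + s + (m1 + n1)) * (m1 + (m1 + n2 + s)) =
    a * (n2 + s) + (n1 + n2) * (m2 + n2 + s) + (n1 + n2) := by decide

set_option maxRecDepth 100000 in
set_option maxHeartbeats 1000000 in
theorem signU3 : ∀ a s m1 m2 n1 n2 : ZMod 2,
    (s + (m1 + n1)) * m2 + ((s + m1 + n1) * (n1 + n2) + (s + m1 + n1) * ((m2 + n2 + s) + (n1 + n2)) +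
      (m1 + n2 + s) * ((m2 + n2 + s) + (n1 + n2)) +
      (m2 + n2 + s) * (n1 + n2) + (m2 + n1 + s) * (m1 + n2 + s) + (n1 + n2)) +
      (a + s + (m1 + n1)) * (m1 + (m1 + n2 + s)) =
    a * (n2 + s) + (n1 + n2) * (m2 + n2 + s) + (n1 + n2) := by decide

set_option maxRecDepth 100000 in
set_option maxHeartbeats 1000000 in
theorem signU4 : ∀ a s m1 m2 n1 n2 : ZMod 2,
    (s + (m1 + n1)) * m2 + ((s + m1 + n1) * ((m2 + n2 + s) + (n1 + n2)) + (m2 + n2 + s) * (n1 + n2) +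
      (s + m1 + n1) * (n1 + n2) +
      (m1 + n2 + s) * (n1 + n2) + (m2 + n2 + s) * (m1 + n2 + s) +
      (m2 + n1 + s) * (m1 + n2 + s) + (n1 + n2)) +
      (a + s + (m1 + n1)) * (m1 + (m1 + n2 + s)) =
    a * (n2 + s) + (n1 + n2) * (m2 + n2 + s) + (n1 + n2) := by decide

theorem signU (a s : ℤ) (m1 m2 n1 n2 K1 k1 K2 k2 d1 d2 : ℕ) (σ : ℤ)
    (h2 : k2 = 0 ∨ K2 = 0)
    (hk1 : (k1 : ℤ) - K1 = s + (m1 - n1)) (hk2 : (k2 : ℤ) - K2 = (m2 - n2) - s)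
    (hd1 : (d1 : ℤ) = m1 + n2 + s) (hd2 : (d2 : ℤ) = m2 + n1 - s)
    (hσ : (K1 = 0 ∧ σ = (s + (m1 - n1)) * (s + n2)) ∨ (k1 = 0 ∧ σ = (s + (m1 - n1)) * m2)) :
    ((σ + (K1 * (K2 + (n1 + n2)) + K2 * (n1 + n2) + K1 * (k2 + (n1 + n2)) +
      d1 * (k2 + (n1 + n2)) +
        k2 * (n1 + n2) + K2 * d1 + d2 * d1 + (n1 + n2)) + (a - s - (m1 - n1)) * (m1 + d1) : ℤ) : ZMod 2) =
    ((a * (n2 + s) + (n1 + n2) * (m2 + n2 + s) + (n1 + n2) : ℤ) : ZMod 2) := by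
  have e1 : (d1 : ZMod 2) = m1 + n2 + s := by exact_mod_cast congrArg (Int.cast : ℤ → ZMod 2) hd1
  have e2 : (d2 : ZMod 2) = m2 + n1 + s := by
    have := congrArg (Int.cast : ℤ → ZMod 2) hd2
    push_cast at this; rw [this, sub_eq_add_neg, zmod_neg]
  rcases hσ with ⟨h, hs⟩ | ⟨h, hs⟩ <;> rcases h2 with h' | h' <;> subst h <;> subst h' <;> subst hs
  · have e3 : (K2 : ZMod 2) = m2 + n2 + s := by
      have := congrArg (Int.cast : ℤ → ZMod 2) hk2
      push_cast at this; simp only [sub_eq_add_neg, zmod_neg, zero_add, add_zero] at this; rw [this]; 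
    push_cast
    rw [e1, e2, e3]
    simp only [sub_eq_add_neg, zmod_neg, zero_add, add_zero, zero_mul, mul_zero]
    rw [← signU2 a s m1 m2 n1 n2]
  · have e3 : (k2 : ZMod 2) = m2 + n2 + s := by
      have := congrArg (Int.cast : ℤ → ZMod 2) hk2
      push_cast at this; simp only [sub_eq_add_neg, zmod_neg, zero_add, add_zero] at this; rw [this]; 
    push_cast
    rw [e1, e2, e3]
    simp only [sub_eq_add_neg, zmod_neg, zero_add, add_zero, zero_mul, mul_zero]
    rw [← signU1 a s m1 m2 n1 n2]
  · have e3 : (K2 : ZMod 2) = m2 + n2 + s := by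
      have := congrArg (Int.cast : ℤ → ZMod 2) hk2
      push_cast at this; simp only [sub_eq_add_neg, zmod_neg, zero_add, add_zero] at this; rw [this]; 
    have e4 : (K1 : ZMod 2) = s + m1 + n1 := by
      have := congrArg (Int.cast : ℤ → ZMod 2) hk1
      push_cast at this; simp only [sub_eq_add_neg, zmod_neg, zero_add, add_zero] at this; rw [this]; ring
    push_cast
    rw [e1, e2, e3, e4]
    simp only [sub_eq_add_neg, zmod_neg, zero_add, add_zero, zero_mul, mul_zero]
    rw [← signU4 a s m1 m2 n1 n2]
  · have e3 : (k2 : ZMod 2) = m2 + n2 + s := by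
      have := congrArg (Int.cast : ℤ → ZMod 2) hk2
      push_cast at this; simp only [sub_eq_add_neg, zmod_neg, zero_add, add_zero] at this; rw [this]; 
    have e4 : (K1 : ZMod 2) = s + m1 + n1 := by
      have := congrArg (Int.cast : ℤ → ZMod 2) hk1
      push_cast at this; simp only [sub_eq_add_neg, zmod_neg, zero_add, add_zero] at this; rw [this]; ring
    push_cast
    rw [e1, e2, e3, e4]
    simp only [sub_eq_add_neg, zmod_neg, zero_add, add_zero, zero_mul, mul_zero]
    rw [← signU3 a s m1 m2 n1 n2]

end Stmt0

open scoped BigOperators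
namespace Stmt0
open Polynomial
set_option linter.all false

theorem length_Om (b1 b2 F : List ℂ) : (Om b1 b2 F).length = b1.length + b2.length + F.length := by
  simp [Om]; ring

theorem neg_one_pow_int (k : ℕ) : (-1 : ℂ) ^ k = (-1 : ℂ) ^ (k : ℤ) := (zpow_natCast _ _).symm

theorem U_norm {b1 b2 F : List ℂ} (G : Good b1 b2 F) (n1 n2 : ℕ) (hn : F.length = n1 + n2)
    (a s σ θ η : ℤ) (K1 k1 K2 k2 : ℕ) (R T1 T2 : List ℤ)
    (hη : η = a - s - ((b1.length : ℤ) - n1))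
    (hθ : θ = ((b1.length + b2.length).choose 2 : ℕ) + ((n1 + n2).choose 2 : ℕ))
    (h1 : k1 = 0 ∨ K1 = 0) (h2 : k2 = 0 ∨ K2 = 0)
    (hk1 : (k1 : ℤ) - K1 = s + ((b1.length : ℤ) - n1)) (hk2 : (k2 : ℤ) - K2 = ((b2.length : ℤ) - n2) - s)
    (hσ : (K1 = 0 ∧ σ = (s + ((b1.length : ℤ) - n1)) * (s + n2)) ∨
      (k1 = 0 ∧ σ = (s + ((b1.length : ℤ) - n1)) * b2.length))
    (hR : R = (List.range K1).map (fun i : ℕ => 1 + (i : ℤ)) ++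
        (List.range K2).map (fun i : ℕ => η + 1 + (i : ℤ)))
    (hT1 : T1 = ((List.range k1).map (fun i : ℕ => 1 + (i : ℤ))))
    (hT2 : T2 = ((List.range k2).map (fun i : ℕ => 1 - η + (i : ℤ)))) :
    (-1 : ℂ) ^ (σ + θ) * Delta id b1 b2 F R [] T1 T2 η / Dden id (b1 ++ b2) F =
    cc b1 b2 F * (-1) ^ (a * (n2 + s) + (n1 + n2) * ((b2.length : ℤ) + n2 + s) + (n1 + n2)) *
      (b1 ++ b2).prod ^ (-η) *
      bd (Om b1 b2 F) (sq xc η (b1.length + n2 + s) ++ sq yc 0 (b2.length + n1 - s)) := by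
  rw [hR, hT1, hT2, upper_core b1 b2 F G.hF G.hbF G.hb0 G.hF0 η K1 k1 K2 k2 (b1.length + n2 + s).toNat (b2.length + n1 - s).toNat h1 h2 (by omega) (by omega) (by omega)]
  change _ * (_ * bd (Om b1 b2 F) (sq xc η (b1.length + n2 + s) ++ sq yc 0 (b2.length + n1 - s))) / _ = _
  by_cases hd : 0 ≤ (b1.length + n2 + s) ∧ 0 ≤ (b2.length + n1 - s)
  swap
  · rw [bd_ne]
    · simp
    · rw [length_Om, List.length_append, sq_length, sq_length]; omega
  have e1 : (((b1.length + n2 + s).toNat : ℕ) : ℤ) = b1.length + n2 + s := by omega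
  have e2 : (((b2.length + n1 - s).toNat : ℕ) : ℤ) = b2.length + n1 - s := by omega
  have hs := signU a s b1.length b2.length n1 n2 K1 k1 K2 k2 _ _ σ h2 hk1 hk2 e1 e2 hσ
  generalize (b1.length + n2 + s).toNat = d1 at *
  generalize (b2.length + n1 - s).toNat = d2 at *
  generalize bd (Om b1 b2 F) _ = H
  have hP : ((b1 ++ b2).map (fun b => b ^ (-η) / (PF F).eval b)).prod =
      (b1 ++ b2).prod ^ (-η) * (prodLL (b1 ++ b2) F (fun b f => b - f))⁻¹ := by
    rw [← prod_PF, ← prod_zpow, ← List.prod_map_mul]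
    congr 1
    apply List.map_congr_left
    intro b _
    ring
  rw [hP, Dden_id, cc]
  have hD := prodLL_ne _ _ G.hbF
  have hV := G.VB
  have hV2 := VF_ne F G.hF
  have hsg : (-1 : ℂ) ^ (σ + θ) * ((-1) ^ (K1 * (K2 + F.length) + K2 * F.length + K1 * (k2 + F.length) + d1 * (k2 + F.length) +
        k2 * F.length + K2 * d1 + d2 * d1 + F.length + F.length.choose 2) *
      ((-1) ^ η) ^ (b1.length + d1)) = (-1) ^ (((b1.length + b2.length).choose 2 : ℕ) : ℤ) *
      (-1) ^ (a * (n2 + s) + (n1 + n2) * ((b2.length : ℤ) + n2 + s) + (n1 + n2)) := by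
    rw [neg_one_pow_int, ← zpow_natCast ((-1 : ℂ) ^ η), ← zpow_mul, ← zpow_add₀ (by norm_num), ← zpow_add₀ (by norm_num),
      ← zpow_add₀ (by norm_num)]
    apply sgn_eq
    rw [Int.cast_add (((b1.length + b2.length).choose 2 : ℕ) : ℤ), ← hs, hθ, hn, hη]
    have h0 := two_add (((n1 + n2).choose 2 : ℕ) : ZMod 2)
    push_cast
    linear_combination h0
  generalize pairProd _ _ = V1 at *
  generalize prodLL _ _ _ = V2 at *
  generalize VF F = V3 at *
  generalize (b1 ++ b2).prod ^ (-η) = V4 at *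
  have : ∀ A1 A2 A3 A4 A5 : ℂ, A1 * (A2 * A3) = A4 * A5 → A1 * (A2 * A3 * (V4 * V2⁻¹) * H) / (V1 * V3 / V2) = A4 / (V1 * V3) * A5 * V4 * H := by
    intro A1 A2 A3 A4 A5 h
    field_simp
    linear_combination V4 * H * h
  exact this _ _ _ _ _ hsg

theorem R_norm {b1 b2 F : List ℂ} (G : Good b1 b2 F) 
    (σ θ p : ℤ) (K k a : ℕ) (R S T : List ℤ)
    (hθ : θ = ((b1.length + b2.length).choose 2 : ℕ) + ((F.length).choose 2 : ℕ))
    (h1 : k = 0 ∨ K = 0)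
    (hk : (k : ℤ) - K = (b1.length : ℤ) + b2.length - F.length - a)
    (hσ : ((σ : ℤ) : ZMod 2) = (a * b2.length + K * a : ℕ))
    (hR : R = (List.range K).map (fun i : ℕ => 1 + (i : ℤ)))
    (hS : S = ((List.range k).map (fun i : ℕ => 1 + (i : ℤ))))
    (hT : T = ((List.range a).map (fun i : ℕ => p + 1 + (i : ℤ)))) :
    (-1 : ℂ) ^ (σ + θ) * Delta id b1 b2 F R S T [] 0 / Dden id (b1 ++ b2) F =
    cc b1 b2 F * (-1) ^ ((a : ℤ) * b2.length + a * F.length + ((b1.length : ℤ) + b2.length - a) * (a + F.length)) *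
      F.prod ^ (-p) *
      bd (Om b1 b2 F) (sq xc p (F.length + a) ++ sq uc 0 ((b1.length : ℤ) + b2.length - a)) := by
  rw [hR, hS, hT, right_core b1 b2 F G.hF G.hbF G.hb0 G.hF0 p K k a ((b1.length : ℤ) + b2.length - a).toNat h1 (by omega) (by omega)]
  have e0 : F.length + a = ((F.length : ℤ) + a).toNat := by omega
  rw [e0]
  change _ * (_ * (_ * bd (Om b1 b2 F) (sq xc p (F.length + a) ++ sq uc 0 ((b1.length : ℤ) + b2.length - a)))) / _ = _
  by_cases hd : 0 ≤ ((b1.length : ℤ) + b2.length - a)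
  swap
  · rw [bd_ne]
    · simp
    · rw [length_Om, List.length_append, sq_length, sq_length]; omega
  have e1 : ((((b1.length : ℤ) + b2.length - a).toNat : ℕ) : ℤ) = b1.length + b2.length - a := by omega
  generalize ((b1.length : ℤ) + b2.length - a).toNat = l at *
  generalize bd (Om b1 b2 F) _ = H
  rw [prod_PF, prod_zpow, Dden_id, cc]
  have hD := prodLL_ne _ _ G.hbF
  have hV := G.VB
  have hV2 := VF_ne F G.hF
  have hsg : (-1 : ℂ) ^ (σ + θ) * ((-1) ^ (K * a + l * (a + F.length) + a * F.length + F.length.choose 2)) =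
       (-1) ^ (((b1.length + b2.length).choose 2 : ℕ) : ℤ) *
      (-1) ^ ((a : ℤ) * b2.length + a * F.length + ((b1.length : ℤ) + b2.length - a) * (a + F.length)) := by
    rw [neg_one_pow_int, ← zpow_add₀ (by norm_num), ← zpow_add₀ (by norm_num)]
    apply sgn_eq
    have h0 := two_add (((F.length).choose 2 : ℕ) : ZMod 2)
    have h3 := two_add ((K * a : ℕ) : ZMod 2)
    have e3 : (l : ZMod 2) = b1.length + b2.length - a := by exact_mod_cast congrArg (Int.cast : ℤ → ZMod 2) e1
    push_cast
    push_cast at hσ h3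
    rw [hσ, hθ, e3]
    push_cast
    linear_combination h0 + h3
  generalize pairProd _ _ = V1 at *
  generalize prodLL _ _ _ = V2 at *
  generalize VF F = V3 at *
  generalize F.prod ^ (-p) = V4 at *
  have : ∀ A1 A2 A4 A5 : ℂ, A1 * A2 = A4 * A5 → A1 * (V2⁻¹ * (A2 * V4 * H)) / (V1 * V3 / V2) = A4 / (V1 * V3) * A5 * V4 * H := by
    intro A1 A2 A4 A5 h
    field_simp
    linear_combination V4 * H * h
  exact this _ _ _ _ hsg

theorem L_norm {b1 b2 F : List ℂ} (G : Good b1 b2 F) 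
    (σ θ p : ℤ) (K k a : ℕ) (R S T : List ℤ)
    (hθ : θ = ((b1.length + b2.length).choose 2 : ℕ) + ((F.length).choose 2 : ℕ))
    (h1 : k = 0 ∨ K = 0)
    (hk : (k : ℤ) - K = (b1.length : ℤ) + b2.length - F.length - a)
    (hσ : ((σ : ℤ) : ZMod 2) = (a * b2.length + K * a + a : ℕ))
    (hR : R = (List.range K).map (fun i : ℕ => 1 + (i : ℤ)))
    (hS : S = ((List.range k).map (fun i : ℕ => 1 + (i : ℤ))))
    (hT : T = ((List.range a).map (fun i : ℕ => p + 1 + (i : ℤ)))) :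
    (-1 : ℂ) ^ (σ + θ) * Delta id b1 b2 F R S [] T 0 / Dden id (b1 ++ b2) F =
    cc b1 b2 F * (-1) ^ ((a : ℤ) * b2.length + a * F.length + ((b1.length : ℤ) + b2.length - a) * (a + F.length) + a + F.length) *
      F.prod ^ (-p) *
      bd (Om b1 b2 F) (sq yc p (F.length + a) ++ sq uc 0 ((b1.length : ℤ) + b2.length - a)) := by
  rw [hR, hS, hT, left_core b1 b2 F G.hF G.hbF G.hb0 G.hF0 p K k a ((b1.length : ℤ) + b2.length - a).toNat h1 (by omega) (by omega)]
  have e0 : F.length + a = ((F.length : ℤ) + a).toNat := by omega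
  rw [e0]
  change _ * (_ * (_ * bd (Om b1 b2 F) (sq yc p (F.length + a) ++ sq uc 0 ((b1.length : ℤ) + b2.length - a)))) / _ = _
  by_cases hd : 0 ≤ ((b1.length : ℤ) + b2.length - a)
  swap
  · rw [bd_ne]
    · simp
    · rw [length_Om, List.length_append, sq_length, sq_length]; omega
  have e1 : ((((b1.length : ℤ) + b2.length - a).toNat : ℕ) : ℤ) = b1.length + b2.length - a := by omega
  generalize ((b1.length : ℤ) + b2.length - a).toNat = l at *
  generalize bd (Om b1 b2 F) _ = H
  rw [prod_PF, prod_zpow, Dden_id, cc]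
  have hD := prodLL_ne _ _ G.hbF
  have hV := G.VB
  have hV2 := VF_ne F G.hF
  have hsg : (-1 : ℂ) ^ (σ + θ) * ((-1) ^ (K * a + l * (a + F.length) + a * F.length + F.length.choose 2) * (-1) ^ F.length) =
       (-1) ^ (((b1.length + b2.length).choose 2 : ℕ) : ℤ) *
      (-1) ^ ((a : ℤ) * b2.length + a * F.length + ((b1.length : ℤ) + b2.length - a) * (a + F.length) + a + F.length) := by
    rw [neg_one_pow_int, neg_one_pow_int F.length, ← zpow_add₀ (by norm_num), ← zpow_add₀ (by norm_num), ← zpow_add₀ (by norm_num)]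
    apply sgn_eq
    have h0 := two_add (((F.length).choose 2 : ℕ) : ZMod 2)
    have h3 := two_add ((K * a : ℕ) : ZMod 2)
    have e3 : (l : ZMod 2) = b1.length + b2.length - a := by exact_mod_cast congrArg (Int.cast : ℤ → ZMod 2) e1
    push_cast
    push_cast at hσ h3
    rw [hσ, hθ, e3]
    push_cast
    linear_combination h0 + h3
  generalize pairProd _ _ = V1 at *
  generalize prodLL _ _ _ = V2 at *
  generalize VF F = V3 at *
  generalize F.prod ^ (-p) = V4 at *
  have : ∀ A1 A2 A4 A5 : ℂ, A1 * A2 = A4 * A5 → A1 * (V2⁻¹ * (A2 * V4 * H)) / (V1 * V3 / V2) = A4 / (V1 * V3) * A5 * V4 * H := by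
    intro A1 A2 A4 A5 h
    field_simp
    linear_combination V4 * H * h
  exact this _ _ _ _ hsg

end Stmt0

open scoped BigOperators
namespace Stmt0
open Polynomial
set_option linter.all false

theorem Delta_map {ι : Type*} (z : ι → ℂ) (B1 B2 F : List ι) (R S T1 T2 : List ℤ) (η : ℤ) :
    Delta z B1 B2 F R S T1 T2 η = Delta id (B1.map z) (B2.map z) (F.map z) R S T1 T2 η := by
  rw [Delta_eq, Delta_eq]
  have h := listDet_map ((B1.map (Sum.inl : ι → ι ⊕ (ι ⊕ ℤ)) ++
      B2.map (fun b => (Sum.inr (Sum.inl b) : ι ⊕ (ι ⊕ ℤ))) ++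
      R.map (fun r => (Sum.inr (Sum.inr r) : ι ⊕ (ι ⊕ ℤ)))))
    ((F.map (Sum.inl : ι → ι ⊕ (ℤ ⊕ (ℤ ⊕ ℤ))) ++
      S.map (fun j => (Sum.inr (Sum.inl j) : ι ⊕ (ℤ ⊕ (ℤ ⊕ ℤ)))) ++
      T1.map (fun j => (Sum.inr (Sum.inr (Sum.inl j)) : ι ⊕ (ℤ ⊕ (ℤ ⊕ ℤ)))) ++
      T2.map (fun j => (Sum.inr (Sum.inr (Sum.inr j)) : ι ⊕ (ℤ ⊕ (ℤ ⊕ ℤ))))))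
      (Sum.map z (Sum.map z id) : ι ⊕ (ι ⊕ ℤ) → ℂ ⊕ (ℂ ⊕ ℤ)) (Sum.map z id : ι ⊕ (ℤ ⊕ (ℤ ⊕ ℤ)) → ℂ ⊕ (ℤ ⊕ (ℤ ⊕ ℤ))) (dEnt id η)
  have e1 : (fun r c => dEnt id η ((Sum.map z (Sum.map z id) : ι ⊕ (ι ⊕ ℤ) → ℂ ⊕ (ℂ ⊕ ℤ)) r) ((Sum.map z id : ι ⊕ (ℤ ⊕ (ℤ ⊕ ℤ)) → ℂ ⊕ (ℤ ⊕ (ℤ ⊕ ℤ))) c)) = dEnt z η := by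
    funext r c
    rcases r with r | r | r <;> rcases c with c | c | c | c <;> simp [dEnt]
  rw [e1] at h
  rw [← h]
  simp only [List.map_append, List.map_map]
  rfl

theorem pairProd_map {ι : Type*} (z : ι → ℂ) (L : List ι) (g : ℂ → ℂ → ℂ) :
    pairProd L (fun a b => g (z a) (z b)) = pairProd (L.map z) g := by
  induction L with
  | nil => simp [pairProd_nil]
  | cons a L ih => rw [List.map_cons, pairProd_cons, pairProd_cons, ih, List.map_map]; rfl

theorem prodLL_map {ι : Type*} (z : ι → ℂ) (L M : List ι) (g : ℂ → ℂ → ℂ) :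
    prodLL L M (fun a b => g (z a) (z b)) = prodLL (L.map z) (M.map z) g := by
  simp only [prodLL, List.map_map]; rfl

theorem prodL_map {ι : Type*} (z : ι → ℂ) (L : List ι) (g : ℂ → ℂ) :
    prodL L (fun a => g (z a)) = prodL (L.map z) g := by
  simp only [prodL, List.map_map]; rfl

theorem Dden_map {ι : Type*} (z : ι → ℂ) (B F : List ι) :
    Dden z B F = Dden id (B.map z) (F.map z) := by
  unfold Dden
  rw [← pairProd_map z B (fun b b' => id b - id b'), ← pairProd_map z F (fun b b' => id b' - id b),
    ← prodLL_map z B F (fun b b' => id b - id b')]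
  rfl

theorem isChi_map {ι : Type*} (z : ι → ℂ) (B1 B2 F1 F2 : List ι) (χ : ℤ → ℤ → ℂ)
    (h : IsChi z B1 B2 F1 F2 χ) : IsChi id (B1.map z) (B2.map z) (F1.map z) (F2.map z) χ := by
  unfold IsChi at h ⊢
  simp only [Delta_map z, Dden_map z, List.map_append] at h
  simp only [List.length_map]
  exact h

/-- The three normal forms. -/
structure Forms (b1 b2 F : List ℂ) (n1 n2 : ℕ) (χ : ℤ → ℤ → ℂ) : Prop where
  zero : ∀ a s : ℤ, (a < 0 ∨ ((b1.length : ℤ) < a ∧ (n1 : ℤ) < s) ∨ ((b2.length : ℤ) < a ∧ s < -(n2 : ℤ))) →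
    χ a s = 0
  U : ∀ a s : ℤ, s + ((b1.length : ℤ) - n1) ≤ a → -s + ((b2.length : ℤ) - n2) ≤ a → 0 ≤ a →
    χ a s = cc b1 b2 F * (-1) ^ (a * (n2 + s) + (n1 + n2) * ((b2.length : ℤ) + n2 + s) + (n1 + n2)) *
      (b1 ++ b2).prod ^ (-(a - s - ((b1.length : ℤ) - n1))) *
      bd (Om b1 b2 F) (sq xc (a - s - ((b1.length : ℤ) - n1)) (b1.length + n2 + s) ++
        sq yc 0 (b2.length + n1 - s))
  R : ∀ a s : ℤ, 0 ≤ a → a ≤ s + ((b1.length : ℤ) - n1) →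
    χ a s = cc b1 b2 F * (-1) ^ ((a : ℤ) * b2.length + a * (n1 + n2) + ((b1.length : ℤ) + b2.length - a) * (a + (n1 + n2))) *
      F.prod ^ (-(s - a + ((b1.length : ℤ) - n1))) *
      bd (Om b1 b2 F) (sq xc (s - a + ((b1.length : ℤ) - n1)) (n1 + n2 + a) ++
        sq uc 0 ((b1.length : ℤ) + b2.length - a))
  L : ∀ a s : ℤ, 0 ≤ a → a ≤ -s + ((b2.length : ℤ) - n2) →
    χ a s = cc b1 b2 F * (-1) ^ ((a : ℤ) * b2.length + a * (n1 + n2) + ((b1.length : ℤ) + b2.length - a) * (a + (n1 + n2)) + a + (n1 + n2)) *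
      F.prod ^ (-(s - a + ((b1.length : ℤ) - n1))) *
      bd (Om b1 b2 F) (sq yc (s - a + ((b1.length : ℤ) - n1)) (n1 + n2 + a) ++
        sq uc 0 ((b1.length : ℤ) + b2.length - a))

theorem seg_shift (a b a' : ℤ) (k : ℕ) (h : (b - a + 1).toNat = k) (ha : a = a') :
    seg a b = (List.range k).map (fun i : ℕ => a' + (i : ℤ)) := by
  rw [← ha]; exact seg_eq a b k h

theorem zs1 : ∀ a m1 m2 n1 n2 : ZMod 2, a * (m1 + n1 + n2 + 1) = a * m2 + (a + m1 + n1 + m2 + n2) * a := by decide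

theorem forms_of_isChi (b1 b2 f1 f2 : List ℂ) (χ : ℤ → ℤ → ℂ) (G : Good b1 b2 (f1 ++ f2))
    (h : IsChi id b1 b2 f1 f2 χ) : Forms b1 b2 (f1 ++ f2) f1.length f2.length χ := by
  unfold IsChi at h
  obtain ⟨h0, h1, h2, h3, h4, h5, h6, h7, h8⟩ := h
  have hθ1 : ((b1.length : ℤ) + b2.length) * ((b1.length : ℤ) + b2.length - 1) / 2 = ((b1.length + b2.length).choose 2 : ℕ) := by
    rw [← choose_two_int]; push_cast; rfl
  have hθ2 : ((f1.length : ℤ) + f2.length) * ((f1.length : ℤ) + f2.length - 1) / 2 = ((f1.length + f2.length).choose 2 : ℕ) := by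
    rw [← choose_two_int]; push_cast; rfl
  have hF : (f1 ++ f2).length = f1.length + f2.length := List.length_append
  refine ⟨h0, ?_, ?_, ?_⟩
  · intro a s e1 e2 e3
    rcases le_total (-((b1.length : ℤ) - f1.length)) s with g1 | g1 <;>
    rcases le_total s ((b2.length : ℤ) - f2.length) with g2 | g2
    · rw [h1 a s e1 e2 e3 g1 g2]
      refine U_norm G _ _ hF a s _ _ _ 0 (s + ((b1.length : ℤ) - f1.length)).toNat 0 ((b2.length : ℤ) - f2.length - s).toNat _ _ _ rfl (by rw [hθ1, hθ2]) (by omega) (by omega) (by omega) (by omega) (Or.inl ⟨rfl, rfl⟩) (by simp) ?_ ?_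
      · exact seg_shift _ _ _ _ (by omega) rfl
      · exact seg_shift _ _ _ _ (by omega) (by ring)
    · rw [h2 a s e1 e2 e3 g1 g2]
      refine U_norm G _ _ hF a s _ _ _ 0 (s + ((b1.length : ℤ) - f1.length)).toNat (s - ((b2.length : ℤ) - f2.length)).toNat 0 _ _ _ rfl (by rw [hθ1, hθ2]) (by omega) (by omega) (by omega) (by omega) (Or.inl ⟨rfl, rfl⟩) ?_ ?_ rfl
      · exact seg_shift _ _ _ _ (by omega) rfl
      · exact seg_shift _ _ _ _ (by omega) (by ring)
    · rw [h3 a s e1 e2 e3 g1 g2]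
      refine U_norm G _ _ hF a s _ _ _ (-s - ((b1.length : ℤ) - f1.length)).toNat 0 0 ((b2.length : ℤ) - f2.length - s).toNat _ _ _ rfl (by rw [hθ1, hθ2]) (by omega) (by omega) (by omega) (by omega) (Or.inr ⟨rfl, rfl⟩) ?_ rfl ?_
      · rw [List.range_zero, List.map_nil, List.append_nil]; exact seg_shift _ _ _ _ (by omega) rfl
      · exact seg_shift _ _ _ _ (by omega) (by ring)
    · rw [h4 a s e1 e2 e3 g2 g1]
      refine U_norm G _ _ hF a s _ _ _ (-s - ((b1.length : ℤ) - f1.length)).toNat 0 (s - ((b2.length : ℤ) - f2.length)).toNat 0 _ _ _ rfl (by rw [hθ1, hθ2]) (by omega) (by omega) (by omega) (by omega) (Or.inr ⟨rfl, rfl⟩) ?_ rfl rfl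
      congr 1
      · exact seg_shift _ _ _ _ (by omega) rfl
      · exact seg_shift _ _ _ _ (by omega) (by ring)
  · intro a s e1 e2
    obtain ⟨a, rfl⟩ := Int.eq_ofNat_of_zero_le e1
    have hF' : (f1.length : ℤ) + f2.length = (f1 ++ f2).length := by rw [hF]; push_cast; ring
    rcases le_total (a : ℤ) (((b1.length : ℤ) - f1.length) + ((b2.length : ℤ) - f2.length)) with g | g
    · rw [h5 a s e2 g, hF']
      refine R_norm G _ _ _ 0 (((b1.length : ℤ) - f1.length) + ((b2.length : ℤ) - f2.length) - a).toNat a _ _ _ (by rw [← hF', hθ1, hθ2, hF]) (by omega) (by rw [hF]; omega) (by push_cast; ring) rfl ?_ ?_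
      · exact seg_shift _ _ _ _ (by omega) rfl
      · exact seg_shift _ _ _ _ (by omega) (by ring)
    · rw [h6 a s g e2, hF']
      refine R_norm G _ _ _ (a - (((b1.length : ℤ) - f1.length) + ((b2.length : ℤ) - f2.length))).toNat 0 a _ _ _ (by rw [← hF', hθ1, hθ2, hF]) (by omega) (by rw [hF]; omega) ?_ ?_ rfl ?_
      · have e3 : (((a - (((b1.length : ℤ) - f1.length) + ((b2.length : ℤ) - f2.length))).toNat : ℕ) : ZMod 2) = a + b1.length + f1.length + b2.length + f2.length := by
          have := congrArg (Int.cast : ℤ → ZMod 2) (Int.toNat_of_nonneg (sub_nonneg.2 g))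
          push_cast at this
          simp only [sub_eq_add_neg, zmod_neg] at this ⊢
          rw [this]; ring
        push_cast
        rw [e3, ← zs1]
        simp only [sub_eq_add_neg, zmod_neg]
      · exact seg_shift _ _ _ _ (by omega) rfl
      · exact seg_shift _ _ _ _ (by omega) (by ring)
  · intro a s e1 e2
    obtain ⟨a, rfl⟩ := Int.eq_ofNat_of_zero_le e1
    have hF' : (f1.length : ℤ) + f2.length = (f1 ++ f2).length := by rw [hF]; push_cast; ring
    rcases le_total (a : ℤ) (((b1.length : ℤ) - f1.length) + ((b2.length : ℤ) - f2.length)) with g | g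
    · rw [h7 a s e2 g, hF']
      refine L_norm G _ _ _ 0 (((b1.length : ℤ) - f1.length) + ((b2.length : ℤ) - f2.length) - a).toNat a _ _ _ (by rw [← hF', hθ1, hθ2, hF]) (by omega) (by rw [hF]; omega) (by push_cast; ring) rfl ?_ ?_
      · exact seg_shift _ _ _ _ (by omega) rfl
      · exact seg_shift _ _ _ _ (by omega) (by ring)
    · rw [h8 a s g e2, hF']
      refine L_norm G _ _ _ (a - (((b1.length : ℤ) - f1.length) + ((b2.length : ℤ) - f2.length))).toNat 0 a _ _ _ (by rw [← hF', hθ1, hθ2, hF]) (by omega) (by rw [hF]; omega) ?_ ?_ rfl ?_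
      · have e3 : (((a - (((b1.length : ℤ) - f1.length) + ((b2.length : ℤ) - f2.length))).toNat : ℕ) : ZMod 2) = a + b1.length + f1.length + b2.length + f2.length := by
          have := congrArg (Int.cast : ℤ → ZMod 2) (Int.toNat_of_nonneg (sub_nonneg.2 g))
          push_cast at this
          simp only [sub_eq_add_neg, zmod_neg] at this ⊢
          rw [this]; ring
        push_cast
        rw [e3, ← zs1]
        simp only [sub_eq_add_neg, zmod_neg]
        linear_combination - two_add (a : ZMod 2)
      · exact seg_shift _ _ _ _ (by omega) rfl
      · exact seg_shift _ _ _ _ (by omega) (by ring)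

end Stmt0

open scoped BigOperators
namespace Stmt0
open Polynomial
set_option linter.all false

theorem sq_succ_first (v : ℤ → EE) (p : ℤ) (k : ℕ) : sq v p ((k : ℤ) + 1) = v p :: sq v (p + 1) k := by
  unfold sq
  rw [show ((k : ℤ) + 1).toNat = k + 1 by omega, List.range_succ_eq_map, List.map_cons, List.map_map,
    show ((k : ℤ)).toNat = k by omega]
  congr 1
  · simp
  · apply List.map_congr_left; intro j _; simp; congr 1; ring

theorem sq_succ_last (v : ℤ → EE) (p : ℤ) (k : ℕ) : sq v p ((k : ℤ) + 1) = sq v p k ++ [v (p + k)] := by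
  unfold sq
  rw [show ((k : ℤ) + 1).toNat = k + 1 by omega, List.range_succ, List.map_append,
    show ((k : ℤ)).toNat = k by omega]
  simp

theorem sq_zero (v : ℤ → EE) (p : ℤ) : sq v p 0 = [] := by simp [sq]

theorem mem_sq (v : ℤ → EE) (p k j : ℤ) (h1 : p ≤ j) (h2 : j < p + k) : v j ∈ sq v p k := by
  unfold sq
  rw [List.mem_map]
  refine ⟨(j - p).toNat, ?_, ?_⟩
  · rw [List.mem_range]; omega
  · congr 1; omega

/-- the two-segment determinant -/
noncomputable def hh (Ω : List (EE →ₗ[ℂ] ℂ)) (v : ℤ → EE) (p k : ℤ) (w : ℤ → EE) (c l : ℤ) : ℂ :=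
  bd Ω (sq v p k ++ sq w c l)

theorem hh_zero (Ω : List (EE →ₗ[ℂ] ℂ)) (v : ℤ → EE) (p k : ℤ) (w : ℤ → EE) (c l : ℤ)
    (h : k.toNat + l.toNat ≠ Ω.length) : hh Ω v p k w c l = 0 := by
  unfold hh
  rw [bd_ne]
  rw [List.length_append, sq_length, sq_length]; omega

variable (Ω : List (EE →ₗ[ℂ] ℂ))

theorem sgn_sq (k : ℕ) : (-1 : ℂ) ^ k * (-1) ^ k = 1 := by
  rw [← mul_pow]; norm_num

/-- list with first/first -/
theorem bdFF (A B : List EE) (x y : EE) :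
    bd Ω (x :: A ++ y :: B) = (-1) ^ A.length * bd Ω (x :: y :: (A ++ B)) := by
  have := bd_move Ω [x] A B y
  simp only [List.singleton_append, List.cons_append, List.nil_append] at this ⊢
  rw [this, ← mul_assoc, sgn_sq, one_mul]

theorem bdLF (A B : List EE) (x y : EE) :
    bd Ω (A ++ [x] ++ y :: B) = bd Ω (x :: y :: (A ++ B)) := by
  have := bd_move Ω [] A (y :: B) x
  have h2 := bdFF Ω A B x y
  simp only [List.singleton_append, List.cons_append, List.nil_append, List.append_assoc] at this h2 ⊢
  rw [h2] at this
  have h3 := congrArg (fun t => (-1 : ℂ) ^ A.length * t) this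
  simp only [← mul_assoc, sgn_sq, one_mul] at h3
  exact h3.symm

theorem bdFL (A B : List EE) (x y : EE) :
    bd Ω (x :: A ++ (B ++ [y])) = (-1) ^ (A.length + B.length) * bd Ω (x :: y :: (A ++ B)) := by
  have := bd_move Ω [x] (A ++ B) [] y
  simp only [List.singleton_append, List.cons_append, List.nil_append, List.append_nil, List.append_assoc] at this ⊢
  rw [this, ← mul_assoc, List.length_append, sgn_sq, one_mul]

theorem bdLL (A B : List EE) (x y : EE) :
    bd Ω (A ++ [x] ++ (B ++ [y])) = (-1) ^ (B.length) * bd Ω (x :: y :: (A ++ B)) := by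
  have := bd_move Ω [] A (B ++ [y]) x
  have h2 := bdFL Ω A B x y
  simp only [List.singleton_append, List.cons_append, List.nil_append, List.append_assoc] at this h2 ⊢
  rw [h2] at this
  have h3 := congrArg (fun t => (-1 : ℂ) ^ A.length * t) this
  simp only [pow_add, ← mul_assoc, sgn_sq, one_mul] at h3
  exact h3.symm

theorem bdNB (A B : List EE) (x y : EE) :
    bd Ω (A ++ x :: (B ++ [y])) = (-1) ^ (B.length) * bd Ω (x :: y :: (A ++ B)) := by
  have := bdLL Ω A B x y
  simpa using this

theorem bdBN (A B : List EE) (x y : EE) :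
    bd Ω (x :: (A ++ [y]) ++ B) = (-1) ^ (A.length) * bd Ω (x :: y :: (A ++ B)) := by
  have := bdFF Ω A B x y
  simpa using this

theorem len_sq (v : ℤ → EE) (p : ℤ) (k : ℕ) : (sq v p k).length = k := by rw [sq_length]; omega

/-- universal three-term identity for a pair of segments -/
theorem hh_Q (v w : ℤ → EE) (p k c l : ℤ) (hM : k + l = Ω.length) :
    hh Ω v p k w c l * hh Ω v (p + 1) k w (c + 1) l =
    hh Ω v (p + 1) k w c l * hh Ω v p k w (c + 1) l +
    hh Ω v (p + 1) (k - 1) w c (l + 1) * hh Ω v p (k + 1) w (c + 1) (l - 1) := by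
  rcases lt_trichotomy k 0 with hk | hk | hk
  · rw [hh_zero Ω v p k w c l (by omega), hh_zero Ω v (p+1) k w c l (by omega),
      hh_zero Ω v (p+1) (k-1) w c (l+1) (by omega)]
    ring
  · rw [hh_zero Ω v (p+1) (k-1) w c (l+1) (by omega)]
    subst hk
    simp only [hh, sq_zero]
    ring
  rcases lt_trichotomy l 0 with hl | hl | hl
  · rw [hh_zero Ω v p k w c l (by omega), hh_zero Ω v (p+1) k w c l (by omega),
      hh_zero Ω v p (k+1) w (c+1) (l-1) (by omega)]
    ring
  · rw [hh_zero Ω v p (k+1) w (c+1) (l-1) (by omega)]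
    subst hl
    simp only [hh, sq_zero]
    ring
  obtain ⟨k', rfl⟩ : ∃ k' : ℕ, k = (k' : ℤ) + 1 := ⟨(k - 1).toNat, by omega⟩
  obtain ⟨l', rfl⟩ : ∃ l' : ℕ, l = (l' : ℤ) + 1 := ⟨(l - 1).toNat, by omega⟩
  rw [add_sub_cancel_right, add_sub_cancel_right]
  have E1 : hh Ω v p (k' + 1) w c (l' + 1) =
      (-1) ^ k' * bd Ω (v p :: w c :: (sq v (p + 1) k' ++ sq w (c + 1) l')) := by
    rw [hh, sq_succ_first, sq_succ_first, bdFF, len_sq]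
  have E2 : hh Ω v (p + 1) (k' + 1) w (c + 1) (l' + 1) =
      (-1) ^ l' * bd Ω (v (p + 1 + k') :: w (c + 1 + l') :: (sq v (p + 1) k' ++ sq w (c + 1) l')) := by
    rw [hh, sq_succ_last, sq_succ_last, bdLL, len_sq]
  have E3 : hh Ω v (p + 1) (k' + 1) w c (l' + 1) =
      bd Ω (v (p + 1 + k') :: w c :: (sq v (p + 1) k' ++ sq w (c + 1) l')) := by
    rw [hh, sq_succ_last, sq_succ_first, bdLF]
  have E4 : hh Ω v p (k' + 1) w (c + 1) (l' + 1) =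
      (-1) ^ (k' + l') * bd Ω (v p :: w (c + 1 + l') :: (sq v (p + 1) k' ++ sq w (c + 1) l')) := by
    rw [hh, sq_succ_first, sq_succ_last, bdFL, len_sq, len_sq]
  have E5 : hh Ω v (p + 1) k' w c (l' + 1 + 1) =
      (-1) ^ l' * bd Ω (w c :: w (c + 1 + l') :: (sq v (p + 1) k' ++ sq w (c + 1) l')) := by
    rw [hh, show (l' : ℤ) + 1 = ((l' + 1 : ℕ) : ℤ) by push_cast; rfl, sq_succ_first, Nat.cast_add, Nat.cast_one, sq_succ_last, bdNB, len_sq]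
  have E6 : hh Ω v p (k' + 1 + 1) w (c + 1) l' =
      (-1) ^ k' * bd Ω (v p :: v (p + 1 + k') :: (sq v (p + 1) k' ++ sq w (c + 1) l')) := by
    rw [hh, show (k' : ℤ) + 1 = ((k' + 1 : ℕ) : ℤ) by push_cast; rfl, sq_succ_first, Nat.cast_add, Nat.cast_one, sq_succ_last, bdBN, len_sq]
  have hp := plucker Ω (sq v (p + 1) k' ++ sq w (c + 1) l') (v p) (w c) (v (p + 1 + k')) (w (c + 1 + l'))
  rw [E1, E2, E3, E4, E5, E6, pow_add]
  linear_combination (-1) ^ k' * (-1) ^ l' * hp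

end Stmt0

open scoped BigOperators
namespace Stmt0
open Polynomial
set_option linter.all false

variable (Ω : List (EE →ₗ[ℂ] ℂ))

theorem sub_seg (A C : List EE) (v w : ℤ → EE) (p : ℤ) (l : ℤ)
    (h : ∀ j, p ≤ j → j < p + l → ∃ e ∈ A ++ C, v j - w j = e ∨ v j - w j = -e) :
    bd Ω (A ++ (sq v p l ++ C)) = bd Ω (A ++ (sq w p l ++ C)) := by
  unfold sq
  apply bd_sub
  intro i hi
  rw [List.mem_range] at hi
  obtain ⟨e, he, h1 | h1⟩ := h (p + i) (by omega) (by omega)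
  · rw [h1]; exact Submodule.subset_span he
  · rw [h1]; exact Submodule.neg_mem _ (Submodule.subset_span he)

theorem y_u (j : ℤ) : yc j - uc j = - xc j := by simp [uc]
theorem x_u (j : ℤ) : xc j - uc j = - yc j := by simp [uc]
theorem u_y (j : ℤ) : uc j - yc j = xc j := by simp [uc]
theorem u_x (j : ℤ) : uc j - xc j = yc j := by simp [uc]
theorem y_eq (j : ℤ) : yc j = uc j - xc j := by simp [uc]
theorem x_eq (j : ℤ) : xc j = uc j - yc j := by simp [uc]

theorem bd_first_sub (x y : EE) (C : List EE) : bd Ω ((x - y) :: C) = bd Ω (x :: C) - bd Ω (y :: C) := by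
  obtain ⟨f, h1, -⟩ := bd_lin Ω [] C
  simp only [List.nil_append] at h1
  rw [h1, h1, h1, map_sub]

theorem bd_first_add (x y : EE) (C : List EE) : bd Ω ((x + y) :: C) = bd Ω (x :: C) + bd Ω (y :: C) := by
  obtain ⟨f, h1, -⟩ := bd_lin Ω [] C
  simp only [List.nil_append] at h1
  rw [h1, h1, h1, map_add]

theorem bd_second_sub (z x y : EE) (C : List EE) : bd Ω (z :: (x - y) :: C) = bd Ω (z :: x :: C) - bd Ω (z :: y :: C) := by
  obtain ⟨f, h1, -⟩ := bd_lin Ω [z] C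
  simp only [List.singleton_append] at h1
  rw [h1, h1, h1, map_sub]

theorem bd_second_add (z x y : EE) (C : List EE) : bd Ω (z :: (x + y) :: C) = bd Ω (z :: x :: C) + bd Ω (z :: y :: C) := by
  obtain ⟨f, h1, -⟩ := bd_lin Ω [z] C
  simp only [List.singleton_append] at h1
  rw [h1, h1, h1, map_add]

theorem bd_last (A : List EE) (x : EE) : bd Ω (A ++ [x]) = (-1) ^ A.length * bd Ω (x :: A) := by
  have := bd_move Ω [] A [] x
  simp only [List.nil_append, List.append_nil] at this
  rw [this, ← mul_assoc, sgn_sq, one_mul]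

theorem right_diag (k' : ℕ) (l : ℤ) (hl : l ≤ k') (hM : k' + 1 + l = Ω.length) :
    hh Ω xc 0 (k' + 1) uc 0 l * hh Ω xc 1 (k' + 1) uc 1 l =
    (-1) ^ k' * (-(hh Ω xc 1 k' yc 0 (l + 1) * hh Ω xc 1 (k' + 1) uc 0 l) +
      hh Ω xc 1 k' uc 0 (l + 1) * hh Ω xc 1 (k' + 1) yc 0 l) := by
  rcases lt_trichotomy l 0 with h | h | h
  · rw [hh_zero Ω xc 0 (k' + 1) uc 0 l (by omega), hh_zero Ω xc 1 (k' + 1) uc 0 l (by omega),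
      hh_zero Ω xc 1 (k' + 1) yc 0 l (by omega)]
    ring
  · subst h
    have e1 : ∀ v : ℤ → EE, sq v 0 (0 + 1) = [v 0] := by
      intro v; have := sq_succ_first v 0 0
      simpa [sq_zero] using this
    have E1 : hh Ω xc 0 (k' + 1) uc 0 0 = bd Ω (xc 0 :: sq xc 1 k') := by
      rw [hh, sq_zero, List.append_nil, sq_succ_first]; rfl
    have E2 : hh Ω xc 1 k' yc 0 (0 + 1) = (-1) ^ k' * (bd Ω (uc 0 :: sq xc 1 k') - bd Ω (xc 0 :: sq xc 1 k')) := by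
      rw [hh, e1, bd_last, len_sq, y_eq, bd_first_sub]
    have E3 : hh Ω xc 1 k' uc 0 (0 + 1) = (-1) ^ k' * (bd Ω (uc 0 :: sq xc 1 k')) := by
      rw [hh, e1, bd_last, len_sq]
    rw [E1, E2, E3]
    simp only [hh, sq_zero]
    have := sgn_sq k'
    linear_combination (- bd Ω (xc 0 :: sq xc 1 k') * bd Ω (sq xc 1 (k' + 1) ++ [])) * this
  obtain ⟨l', rfl⟩ : ∃ l' : ℕ, l = (l' : ℤ) + 1 := ⟨(l - 1).toNat, by omega⟩
  set C := sq xc 1 k' ++ sq uc 1 l' with hC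
  have E1 : hh Ω xc 0 (k' + 1) uc 0 (l' + 1) = (-1) ^ k' * bd Ω (xc 0 :: uc 0 :: C) := by
    rw [hh, sq_succ_first, sq_succ_first, bdFF, len_sq]; rfl
  have E2 : hh Ω xc 1 (k' + 1) uc 1 (l' + 1) = (-1) ^ l' * bd Ω (xc (1 + k') :: uc (1 + l') :: C) := by
    rw [hh, sq_succ_last, sq_succ_last, bdLL, len_sq]
  have E3 : hh Ω xc 1 (k' + 1) uc 0 (l' + 1) = bd Ω (xc (1 + k') :: uc 0 :: C) := by
    rw [hh, sq_succ_last, sq_succ_first, bdLF]; rfl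
  have E5 : hh Ω xc 1 k' uc 0 (l' + 1 + 1) = (-1) ^ l' * bd Ω (uc 0 :: uc (1 + l') :: C) := by
    rw [hh, show (l' : ℤ) + 1 = ((l' + 1 : ℕ) : ℤ) by push_cast; rfl, sq_succ_first, Nat.cast_add, Nat.cast_one, sq_succ_last, bdNB, len_sq]; rfl
  have E6 : hh Ω xc 1 (k' + 1) yc 0 (l' + 1) = bd Ω (xc (1 + k') :: uc 0 :: C) - bd Ω (xc (1 + k') :: xc 0 :: C) := by
    rw [← bd_second_sub, ← y_eq, hC, ← bdLF, ← sq_succ_last, hh, sq_succ_first yc]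
    have := sub_seg Ω (sq xc 1 (k' + 1) ++ [yc 0]) [] yc uc 1 l' (by
      intro j h1 h2
      refine ⟨xc j, ?_, Or.inr (y_u j)⟩
      simp [mem_sq xc 1 (k' + 1) j h1 (by omega)])
    simpa using this
  have E7 : hh Ω xc 1 k' yc 0 (l' + 1 + 1) = (-1) ^ l' * (bd Ω (uc 0 :: uc (1 + l') :: C) - bd Ω (xc 0 :: uc (1 + l') :: C)) := by
    have nb := bdNB Ω (sq xc 1 k') (sq uc 1 l') (yc 0) (uc (1 + l'))
    rw [len_sq] at nb
    rw [← bd_first_sub, ← y_eq, hC, ← nb, ← sq_succ_last, hh, show (l' : ℤ) + 1 = ((l' + 1 : ℕ) : ℤ) by push_cast; rfl, sq_succ_first yc]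
    have := sub_seg Ω (sq xc 1 k' ++ [yc 0]) [] yc uc 1 (l' + 1) (by
      intro j h1 h2
      refine ⟨xc j, ?_, Or.inr (y_u j)⟩
      simp [mem_sq xc 1 k' j h1 (by omega)])
    simpa using this
  have hp := plucker Ω C (xc 0) (uc 0) (xc (1 + k')) (uc (1 + l'))
  have hs := bd_two_swap Ω C (xc (1 + k')) (xc 0)
  rw [E1, E2, E3, E5, E6, E7, hs]
  linear_combination (-1) ^ k' * (-1) ^ l' * hp


theorem sq_one (v : ℤ → EE) (p : ℤ) : sq v p (0 + 1) = [v p] := by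
  have := sq_succ_first v p 0
  simpa [sq_zero] using this

theorem left_diag (k' : ℕ) (l η : ℤ) (hl : l ≤ k') (hη : η = k' + 1 - l) (hM : k' + 1 + l = Ω.length) :
    hh Ω yc 0 (k' + 1) uc η l * hh Ω yc 1 (k' + 1) uc (η + 1) l =
    (-1 : ℂ) ^ l * (-(hh Ω yc 1 k' xc η (l + 1) * hh Ω yc 0 (k' + 1) uc (η + 1) l) +
      hh Ω yc 1 k' uc η (l + 1) * hh Ω yc 0 (k' + 1) xc (η + 1) l) := by
  rcases lt_trichotomy l 0 with h | h | h
  · rw [hh_zero Ω yc 0 (k' + 1) uc η l (by omega), hh_zero Ω yc 0 (k' + 1) uc (η + 1) l (by omega),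
      hh_zero Ω yc 0 (k' + 1) xc (η + 1) l (by omega)]
    ring
  · subst h
    have hη' : η = 1 + k' := by omega
    subst hη'
    have E1 : hh Ω yc 1 (k' + 1) uc (1 + k' + 1) 0 = (-1) ^ k' * bd Ω (yc (1 + k') :: sq yc 1 k') := by
      rw [hh, sq_zero, List.append_nil, sq_succ_last, bd_last, len_sq]
    have E2 : hh Ω yc 1 k' xc (1 + k') (0 + 1) = (-1) ^ k' * (bd Ω (uc (1 + k') :: sq yc 1 k') - bd Ω (yc (1 + k') :: sq yc 1 k')) := by
      rw [hh, sq_one, bd_last, len_sq, x_eq, bd_first_sub]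
    have E3 : hh Ω yc 1 k' uc (1 + k') (0 + 1) = (-1) ^ k' * (bd Ω (uc (1 + k') :: sq yc 1 k')) := by
      rw [hh, sq_one, bd_last, len_sq]
    rw [E1, E2, E3]
    simp only [hh, sq_zero]
    simp
    ring
  obtain ⟨l', rfl⟩ : ∃ l' : ℕ, l = (l' : ℤ) + 1 := ⟨(l - 1).toNat, by omega⟩
  have hη' : (k' : ℤ) = η + l' := by omega
  set C := sq yc 1 k' ++ sq uc (η + 1) l' with hC
  have E1 : hh Ω yc 0 (k' + 1) uc η (l' + 1) = (-1) ^ k' * bd Ω (yc 0 :: uc η :: C) := by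
    rw [hh, sq_succ_first, sq_succ_first, bdFF, len_sq]; rfl
  have E2 : hh Ω yc 1 (k' + 1) uc (η + 1) (l' + 1) = (-1) ^ l' * bd Ω (yc (1 + k') :: uc (1 + k') :: C) := by
    rw [hh, sq_succ_last, sq_succ_last, bdLL, len_sq, show η + 1 + (l' : ℤ) = 1 + k' by omega]
  have E4 : hh Ω yc 0 (k' + 1) uc (η + 1) (l' + 1) = (-1) ^ (k' + l') * bd Ω (yc 0 :: uc (1 + k') :: C) := by
    rw [hh, sq_succ_first, sq_succ_last, bdFL, len_sq, len_sq, show η + 1 + (l' : ℤ) = 1 + k' by omega]; rfl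
  have E5 : hh Ω yc 1 k' uc η (l' + 1 + 1) = (-1) ^ l' * bd Ω (uc η :: uc (1 + k') :: C) := by
    rw [hh, show (l' : ℤ) + 1 = ((l' + 1 : ℕ) : ℤ) by push_cast; rfl, sq_succ_first, Nat.cast_add, Nat.cast_one, sq_succ_last, bdNB, len_sq, show η + 1 + (l' : ℤ) = 1 + k' by omega]
  have E6 : hh Ω yc 0 (k' + 1) xc (η + 1) (l' + 1) = (-1) ^ (k' + l') * (bd Ω (yc 0 :: uc (1 + k') :: C) - bd Ω (yc 0 :: yc (1 + k') :: C)) := by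
    have nb := bdFL Ω (sq yc 1 k') (sq uc (η + 1) l') (yc 0) (xc (1 + k'))
    rw [len_sq, len_sq] at nb
    rw [← bd_second_sub, ← x_eq, hC, ← nb, hh, sq_succ_last xc, sq_succ_first yc, show η + 1 + (l' : ℤ) = 1 + k' by omega]
    have := sub_seg Ω (yc 0 :: sq yc 1 k') [xc (1 + k')] xc uc (η + 1) l' (by
      intro j h1 h2
      refine ⟨yc j, ?_, Or.inr (x_u j)⟩
      simp [mem_sq yc 1 k' j (by omega) (by omega)])
    simpa using this
  have E7 : hh Ω yc 1 k' xc η (l' + 1 + 1) = (-1) ^ l' * (bd Ω (uc η :: uc (1 + k') :: C) - bd Ω (uc η :: yc (1 + k') :: C)) := by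
    have nb := bdNB Ω (sq yc 1 k') (sq uc (η + 1) l') (uc η) (xc (1 + k'))
    rw [len_sq] at nb
    rw [← bd_second_sub, ← x_eq, hC, ← nb, hh, show (l' : ℤ) + 1 = ((l' + 1 : ℕ) : ℤ) by push_cast; rfl, sq_succ_last xc]
    have := sub_seg Ω (sq yc 1 k') [xc (1 + k')] xc uc η (l' + 1) (by
      intro j h1 h2
      refine ⟨yc j, ?_, Or.inr (x_u j)⟩
      simp [mem_sq yc 1 k' j (by omega) (by omega)])
    rw [sq_succ_first uc] at this
    push_cast
    rw [show η + ((l' : ℤ) + 1) = 1 + k' by omega]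
    simpa using this
  have hp := plucker Ω C (yc 0) (uc η) (yc (1 + k')) (uc (1 + k'))
  have hs := bd_two_swap Ω C (uc η) (yc (1 + k'))
  rw [E1, E2, E4, E5, E6, E7, hs, zpow_add₀ (by norm_num), zpow_natCast, zpow_one, pow_add]
  have h3 := sgn_sq l'
  linear_combination (-1) ^ k' * (-1) ^ l' * hp - (-1) ^ k' * (-1) ^ l' * (bd Ω (yc (1+k') :: uc η :: C) * bd Ω (yc 0 :: uc (1+k') :: C) + bd Ω (yc 0 :: yc (1+k') :: C) * bd Ω (uc η :: uc (1+k') :: C)) * h3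

theorem apex (q : ℕ) (hM : 2 * q + 2 = Ω.length) :
    hh Ω xc 0 (q + 1) yc 0 (q + 1) * hh Ω xc 1 (q + 1) yc 1 (q + 1) =
    (-1) ^ q * (-(hh Ω yc 0 (q + 1) uc 1 (q + 1) * hh Ω xc 1 (q + 1) uc 0 (q + 1)) +
      hh Ω xc 1 q uc 0 (q + 1 + 1) * hh Ω xc 1 (q + 1) yc 0 (q + 1)) := by
  set C := sq xc 1 q ++ sq yc 1 q with hC
  have E1 : hh Ω xc 0 (q + 1) yc 0 (q + 1) = (-1) ^ q * bd Ω (xc 0 :: yc 0 :: C) := by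
    rw [hh, sq_succ_first, sq_succ_first, bdFF, len_sq]; rfl
  have E2 : hh Ω xc 1 (q + 1) yc 1 (q + 1) = (-1) ^ q * bd Ω (xc (1 + q) :: yc (1 + q) :: C) := by
    rw [hh, sq_succ_last, sq_succ_last, bdLL, len_sq]
  have E3 : hh Ω xc 1 (q + 1) yc 0 (q + 1) = bd Ω (xc (1 + q) :: yc 0 :: C) := by
    rw [hh, sq_succ_last, sq_succ_first, bdLF]; rfl
  have E4 : hh Ω xc 1 (q + 1) uc 0 (q + 1) = bd Ω (xc (1 + q) :: xc 0 :: C) + bd Ω (xc (1 + q) :: yc 0 :: C) := by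
    rw [← bd_second_add]
    change _ = bd Ω (xc (1 + q) :: uc 0 :: C)
    rw [hC, ← bdLF, hh, ← sq_succ_last, sq_succ_first uc]
    have := sub_seg Ω (sq xc 1 (q + 1) ++ [uc 0]) [] uc yc 1 q (by
      intro j h1 h2
      refine ⟨xc j, ?_, Or.inl (u_y j)⟩
      simp [mem_sq xc 1 (q + 1) j (by omega) (by omega)])
    simpa using this
  have E5 : hh Ω xc 1 q uc 0 (q + 1 + 1) = (-1) ^ q * (bd Ω (xc 0 :: xc (1 + q) :: C) + bd Ω (xc 0 :: yc (1 + q) :: C)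
      + (bd Ω (yc 0 :: xc (1 + q) :: C) + bd Ω (yc 0 :: yc (1 + q) :: C))) := by
    have nb := bdNB Ω (sq xc 1 q) (sq yc 1 q) (uc 0) (uc (1 + q))
    rw [len_sq] at nb
    rw [← bd_second_add, ← bd_second_add, ← bd_first_add]
    change _ = (-1) ^ q * bd Ω (uc 0 :: uc (1 + q) :: C)
    rw [hC, ← nb, hh, show (q : ℤ) + 1 = ((q + 1 : ℕ) : ℤ) by push_cast; rfl, sq_succ_first, Nat.cast_add, Nat.cast_one, sq_succ_last]
    have := sub_seg Ω (sq xc 1 q ++ [uc 0]) [uc (1 + q)] uc yc 1 q (by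
      intro j h1 h2
      refine ⟨xc j, ?_, Or.inl (u_y j)⟩
      simp [mem_sq xc 1 q j (by omega) (by omega)])
    simpa using this
  have E6 : hh Ω yc 0 (q + 1) uc 1 (q + 1) = (-1) ^ q * (bd Ω (yc 0 :: xc (1 + q) :: C) + bd Ω (yc 0 :: yc (1 + q) :: C)) := by
    have nb := bdFL Ω (sq yc 1 q) (sq xc 1 q) (yc 0) (uc (1 + q))
    have sw := bd_swap Ω [yc 0, uc (1 + q)] (sq yc 1 q) (sq xc 1 q) []
    simp only [len_sq, List.append_nil, List.cons_append, List.nil_append] at nb sw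
    rw [sw, ← mul_assoc] at nb
    rw [← bd_second_add]
    change _ = (-1) ^ q * bd Ω (yc 0 :: uc (1 + q) :: C)
    have hs : (-1 : ℂ) ^ (q + q) * (-1) ^ (q * q) = (-1) ^ q := by
      rw [pow_add, sgn_sq, one_mul]
      rcases Nat.even_or_odd q with h | h
      · rw [h.neg_one_pow, (h.mul_right q).neg_one_pow]
      · rw [h.neg_one_pow, (h.mul h).neg_one_pow]
    rw [hs] at nb
    rw [hC, ← nb, hh, sq_succ_first, sq_succ_last]
    have := sub_seg Ω (yc 0 :: sq yc 1 q) [uc (1 + q)] uc xc 1 q (by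
      intro j h1 h2
      refine ⟨yc j, ?_, Or.inl (u_x j)⟩
      simp [mem_sq yc 1 q j (by omega) (by omega)])
    simpa using this
  have hp := plucker Ω C (xc 0) (yc 0) (xc (1 + q)) (yc (1 + q))
  have hs := bd_two_swap Ω C (xc (1 + q)) (xc 0)
  have hs2 := bd_two_swap Ω C (yc 0) (xc (1 + q))
  rw [E1, E2, E3, E4, E5, E6, hs, hs2]
  have h3 := sgn_sq q
  linear_combination (-1) ^ q * (-1) ^ q * hp

end Stmt0

open scoped BigOperators
namespace Stmt0
open Polynomial
set_option linter.all false

/-- column sequences compatible with the degree shift -/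
def Sh (v : ℤ → EE) : Prop := ∀ c : ℂ, c ≠ 0 → ∀ e j : ℤ,
  evx c (v (j + e)) = c ^ e * evx c (v j) ∧ evy c (v (j + e)) = c ^ e * evy c (v j)

theorem Sh_xc : Sh xc := by
  intro c hc e j
  simp [zpow_add₀ hc, mul_comm]
theorem Sh_yc : Sh yc := by
  intro c hc e j
  simp [zpow_add₀ hc, mul_comm]
theorem Sh_uc : Sh uc := by
  intro c hc e j
  simp [uc, zpow_add₀ hc, mul_comm]

theorem hh_shift {b1 b2 F : List ℂ} (G : Good b1 b2 F) (v w : ℤ → EE) (hv : Sh v) (hw : Sh w)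
    (e p p' k c c' l : ℤ) (hp : p' = p + e) (hc : c' = c + e) :
    hh (Om b1 b2 F) v p' k w c' l = ((b1 ++ b2).prod * F.prod) ^ e * hh (Om b1 b2 F) v p k w c l := by
  subst hp hc
  unfold hh bd Om sq
  rw [← map_elim_append b2 F evy gam, ← map_elim_append b1 _ evx,
    ← map_elim_append (List.range k.toNat) (List.range l.toNat) (fun j : ℕ => v (p + e + j)),
    ← map_elim_append (List.range k.toNat) (List.range l.toNat) (fun j : ℕ => v (p + j))]
  rw [listDet_cmp _ _ _ _ (Sum.elim evx (Sum.elim evy gam)) (Sum.elim (fun j : ℕ => v (p + j)) (fun j : ℕ => w (c + j))) _ (fun (φ : EE →ₗ[ℂ] ℂ) (v : EE) => φ v)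
    (Sum.elim (fun b => b ^ e) (Sum.elim (fun b => b ^ e) (fun b => b ^ e))) (Sum.elim (fun _ => 1) (fun _ => 1))]
  · rw [prod_elim_append, prod_elim_append, prod_elim_append, prod_zpow, prod_zpow, prod_zpow, List.prod_append, mul_zpow, mul_zpow]
    simp only [List.map_const', List.prod_replicate, one_pow, one_mul, mul_assoc]
  · intro r hr cc hcc
    have key : ∀ b : ℂ, b ≠ 0 → ∀ cc : ℕ ⊕ ℕ,
      evx b (Sum.elim (fun j : ℕ => v (p + e + j)) (fun j : ℕ => w (c + e + j)) cc) =
        b ^ e * evx b (Sum.elim (fun j : ℕ => v (p + j)) (fun j : ℕ => w (c + j)) cc) ∧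
      evy b (Sum.elim (fun j : ℕ => v (p + e + j)) (fun j : ℕ => w (c + e + j)) cc) =
        b ^ e * evy b (Sum.elim (fun j : ℕ => v (p + j)) (fun j : ℕ => w (c + j)) cc) := by
      intro b hb cc
      rcases cc with j | j
      · simp only [Sum.elim_inl]
        rw [add_right_comm]; exact hv b hb e _
      · simp only [Sum.elim_inr]
        rw [add_right_comm]; exact hw b hb e _
    rcases r with r | r | r
    · have hr := mem_inl_aux hr
      have := key r (G.hb0 r (by simp [hr])) cc
      have one : Sum.elim (fun _ : ℕ => (1 : ℂ)) (fun _ : ℕ => 1) cc = 1 := by rcases cc with j | j <;> rfl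
      rw [one]
      simp only [Sum.elim_inl, one_mul]; exact this.1
    · have hr := mem_inl_aux (mem_inr_aux hr)
      have := key r (G.hb0 r (by simp [hr])) cc
      have one : Sum.elim (fun _ : ℕ => (1 : ℂ)) (fun _ : ℕ => 1) cc = 1 := by rcases cc with j | j <;> rfl
      rw [one]
      simp only [Sum.elim_inl, Sum.elim_inr, one_mul]; exact this.2
    · have hr := mem_inr_aux (mem_inr_aux hr)
      have := key r (G.hF0 r hr) cc
      have one : Sum.elim (fun _ : ℕ => (1 : ℂ)) (fun _ : ℕ => 1) cc = 1 := by rcases cc with j | j <;> rfl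
      rw [one]
      rw [Sum.elim_inr, Sum.elim_inr, Sum.elim_inr, Sum.elim_inr, one_mul, gam, LinearMap.sub_apply, LinearMap.sub_apply, this.1, this.2]; ring

theorem hh_swap (Ω : List (EE →ₗ[ℂ] ℂ)) (v w : ℤ → EE) (p k c l : ℤ) (h : k + l = Ω.length) :
    hh Ω v p k w c l = (-1 : ℂ) ^ (k * l) * hh Ω w c l v p k := by
  by_cases hk : k < 0
  · rw [hh_zero _ _ _ _ _ _ _ (by omega), hh_zero _ _ _ _ _ _ _ (by omega), mul_zero]
  by_cases hl : l < 0
  · rw [hh_zero _ _ _ _ _ _ _ (by omega), hh_zero _ _ _ _ _ _ _ (by omega), mul_zero]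
  have := bd_swap Ω [] (sq v p k) (sq w c l) []
  simp only [List.nil_append, List.append_nil, sq_length] at this
  rw [hh, hh, this, neg_one_pow_int]
  push_cast
  rw [Int.toNat_of_nonneg (by omega), Int.toNat_of_nonneg (by omega)]

def sU (m2 n1 n2 a s : ℤ) : ℤ := a * (n2 + s) + (n1 + n2) * (m2 + n2 + s) + (n1 + n2)
def sR (m1 m2 n1 n2 a : ℤ) : ℤ := a * m2 + a * (n1 + n2) + (m1 + m2 - a) * (a + (n1 + n2))
def sL (m1 m2 n1 n2 a : ℤ) : ℤ := a * m2 + a * (n1 + n2) + (m1 + m2 - a) * (a + (n1 + n2)) + a + (n1 + n2)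


theorem Forms.U' {b1 b2 F : List ℂ} {n1 n2 : ℕ} {χ : ℤ → ℤ → ℂ} (H : Forms b1 b2 F n1 n2 χ) (a s E k l : ℤ) (hE : a - s - ((b1.length : ℤ) - n1) = E) (hE0 : 0 ≤ E)
    (h2 : -s + ((b2.length : ℤ) - n2) ≤ a) (h3 : 0 ≤ a)
    (hk : b1.length + n2 + s = k) (hl : b2.length + n1 - s = l) :
    χ a s = cc b1 b2 F * (-1) ^ sU b2.length n1 n2 a s * (b1 ++ b2).prod ^ (-E) *
      hh (Om b1 b2 F) xc E k yc 0 l := by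
  subst hE hk hl
  exact H.U a s (by omega) h2 h3

theorem Forms.R' {b1 b2 F : List ℂ} {n1 n2 : ℕ} {χ : ℤ → ℤ → ℂ} (H : Forms b1 b2 F n1 n2 χ) (a s p k l : ℤ) (h3 : 0 ≤ a) (hp : s - a + ((b1.length : ℤ) - n1) = p) (hp0 : 0 ≤ p)
    (hk : n1 + n2 + a = k) (hl : (b1.length : ℤ) + b2.length - a = l) :
    χ a s = cc b1 b2 F * (-1) ^ sR b1.length b2.length n1 n2 a * F.prod ^ (-p) *
      hh (Om b1 b2 F) xc p k uc 0 l := by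
  subst hp hk hl
  exact H.R a s h3 (by omega)

theorem Forms.L' {b1 b2 F : List ℂ} {n1 n2 : ℕ} {χ : ℤ → ℤ → ℂ} (H : Forms b1 b2 F n1 n2 χ) (a s p k l : ℤ) (h3 : 0 ≤ a) (h2 : a ≤ -s + ((b2.length : ℤ) - n2))
    (hp : s - a + ((b1.length : ℤ) - n1) = p)
    (hk : n1 + n2 + a = k) (hl : (b1.length : ℤ) + b2.length - a = l) :
    χ a s = cc b1 b2 F * (-1) ^ sL b1.length b2.length n1 n2 a * F.prod ^ (-p) *
      hh (Om b1 b2 F) yc p k uc 0 l := by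
  subst hp hk hl
  exact H.L a s h3 h2

theorem comb (c e0 e1 e2 e3 e4 q0 q1 q2 q3 q4 h0 h1 h2 h3 h4 : ℂ) (he0 : e0 * e0 = 1)
    (Hm : q0 * q0 * (h0 * h0) = e1 * e2 * (q1 * q2 * (h1 * h2)) + e3 * e4 * (q3 * q4 * (h3 * h4))) :
    (c * e0 * q0 * h0) ^ 2 = (c * e1 * q1 * h1) * (c * e2 * q2 * h2) +
      (c * e3 * q3 * h3) * (c * e4 * q4 * h4) := by
  linear_combination c ^ 2 * Hm + c ^ 2 * (q0 * q0 * (h0 * h0)) * he0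

theorem sgn_mul (x y z : ℤ) (h : (x : ZMod 2) + y = z) : (-1 : ℂ) ^ x * (-1) ^ y = (-1) ^ z := by
  rw [← zpow_add₀ (by norm_num)]; exact sgn_eq _ _ (by push_cast; exact h)

theorem sgn_self (x : ℤ) : (-1 : ℂ) ^ x * (-1) ^ x = 1 := by
  rw [sgn_mul x x 0 (by rw [two_add]; simp)]; simp

theorem Good.be {b1 b2 F : List ℂ} (G : Good b1 b2 F) : (b1 ++ b2).prod ≠ 0 := by
  rw [Ne, List.prod_eq_zero_iff]; intro h; exact G.hb0 _ h rfl
theorem Good.ph {b1 b2 F : List ℂ} (G : Good b1 b2 F) : F.prod ≠ 0 := by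
  rw [Ne, List.prod_eq_zero_iff]; intro h; exact G.hF0 _ h rfl

theorem Q_strictU {b1 b2 F : List ℂ} {n1 n2 : ℕ} {χ : ℤ → ℤ → ℂ} (G : Good b1 b2 F)
    (hn : F.length = n1 + n2) (H : Forms b1 b2 F n1 n2 χ) (a s : ℤ) (ha : 1 ≤ a)
    (h1 : s + ((b1.length : ℤ) - n1) < a) (h2 : -s + ((b2.length : ℤ) - n2) < a) :
    χ a s ^ 2 = χ a (s - 1) * χ a (s + 1) + χ (a - 1) s * χ (a + 1) s := by
  obtain ⟨E, hE⟩ : ∃ E, a - s - ((b1.length : ℤ) - n1) = E := ⟨_, rfl⟩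
  obtain ⟨k, hk⟩ : ∃ k, (b1.length : ℤ) + n2 + s = k := ⟨_, rfl⟩
  obtain ⟨l, hl⟩ : ∃ l, (b2.length : ℤ) + n1 - s = l := ⟨_, rfl⟩
  rw [H.U' a s E k l (by omega) (by omega) (by omega) (by omega) (by omega) (by omega),
    H.U' a (s - 1) (E + 1) (k - 1) (l + 1) (by omega) (by omega) (by omega) (by omega) (by omega) (by omega),
    H.U' a (s + 1) (E - 1) (k + 1) (l - 1) (by omega) (by omega) (by omega) (by omega) (by omega) (by omega),
    H.U' (a - 1) s (E - 1) k l (by omega) (by omega) (by omega) (by omega) (by omega) (by omega),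
    H.U' (a + 1) s (E + 1) k l (by omega) (by omega) (by omega) (by omega) (by omega) (by omega)]
  apply comb _ _ _ _ _ _ _ _ _ _ _ _ _ _ _ _ (sgn_self _)
  have hQ := hh_Q (Om b1 b2 F) xc yc E k 0 l (by rw [length_Om, hn]; push_cast; omega)
  rw [hh_shift G xc yc Sh_xc Sh_yc 1 E (E + 1) k 0 (0 + 1) l rfl rfl,
    hh_shift G xc yc Sh_xc Sh_yc 1 (E - 1) E k 0 (0 + 1) l (by ring) rfl,
    hh_shift G xc yc Sh_xc Sh_yc 1 (E - 1) E (k + 1) 0 (0 + 1) (l - 1) (by ring) rfl] at hQ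
  have hΛ := mul_ne_zero G.be G.ph
  rw [zpow_one] at hQ
  have hb := G.be
  rw [sgn_mul _ _ 0, sgn_mul _ _ 0]
  · simp only [← zpow_add₀ hb, zpow_zero, one_mul]
    rw [show -E + -E = -(2 * E) by ring, show -(E + 1) + -(E - 1) = -(2 * E) by ring, show -(E - 1) + -(E + 1) = -(2 * E) by ring]
    apply mul_left_cancel₀ hΛ
    linear_combination (b1 ++ b2).prod ^ (-(2 * E)) * hQ
  · unfold sU; push_cast; simp only [sub_eq_add_neg, zmod_neg]
    generalize (a : ZMod 2) = a; generalize (s : ZMod 2) = s; generalize (b2.length : ZMod 2) = m2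
    generalize (n1 : ZMod 2) = n1; generalize (n2 : ZMod 2) = n2
    revert a s m2 n1 n2; decide
  · unfold sU; push_cast; simp only [sub_eq_add_neg, zmod_neg]
    generalize (a : ZMod 2) = a; generalize (s : ZMod 2) = s; generalize (b2.length : ZMod 2) = m2
    generalize (n1 : ZMod 2) = n1; generalize (n2 : ZMod 2) = n2
    revert a s m2 n1 n2; decide

end Stmt0

open scoped BigOperators
namespace Stmt0
open Polynomial
set_option linter.all false

theorem Q_strictR {b1 b2 F : List ℂ} {n1 n2 : ℕ} {χ : ℤ → ℤ → ℂ} (G : Good b1 b2 F)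
    (hn : F.length = n1 + n2) (H : Forms b1 b2 F n1 n2 χ) (a s : ℤ) (ha : 1 ≤ a)
    (h1 : a < s + ((b1.length : ℤ) - n1)) :
    χ a s ^ 2 = χ a (s - 1) * χ a (s + 1) + χ (a - 1) s * χ (a + 1) s := by
  obtain ⟨p, hp⟩ : ∃ p, s - a + ((b1.length : ℤ) - n1) = p := ⟨_, rfl⟩
  obtain ⟨k, hk⟩ : ∃ k, (n1 : ℤ) + n2 + a = k := ⟨_, rfl⟩
  obtain ⟨l, hl⟩ : ∃ l, (b1.length : ℤ) + b2.length - a = l := ⟨_, rfl⟩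
  rw [H.R' a s p k l (by omega) (by omega) (by omega) (by omega) (by omega),
    H.R' a (s - 1) (p - 1) k l (by omega) (by omega) (by omega) (by omega) (by omega),
    H.R' a (s + 1) (p + 1) k l (by omega) (by omega) (by omega) (by omega) (by omega),
    H.R' (a - 1) s (p + 1) (k - 1) (l + 1) (by omega) (by omega) (by omega) (by omega) (by omega),
    H.R' (a + 1) s (p - 1) (k + 1) (l - 1) (by omega) (by omega) (by omega) (by omega) (by omega)]
  apply comb _ _ _ _ _ _ _ _ _ _ _ _ _ _ _ _ (sgn_self _)
  have hQ := hh_Q (Om b1 b2 F) xc uc p k 0 l (by rw [length_Om, hn]; push_cast; omega)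
  rw [hh_shift G xc uc Sh_xc Sh_uc 1 p (p + 1) k 0 (0 + 1) l rfl rfl,
    hh_shift G xc uc Sh_xc Sh_uc 1 (p - 1) p k 0 (0 + 1) l (by ring) rfl,
    hh_shift G xc uc Sh_xc Sh_uc 1 (p - 1) p (k + 1) 0 (0 + 1) (l - 1) (by ring) rfl] at hQ
  have hΛ := mul_ne_zero G.be G.ph
  rw [zpow_one] at hQ
  have hb := G.ph
  rw [sgn_mul _ _ 0, sgn_mul _ _ 0]
  · simp only [← zpow_add₀ hb, zpow_zero, one_mul]
    rw [show -p + -p = -(2 * p) by ring, show -(p + 1) + -(p - 1) = -(2 * p) by ring, show -(p - 1) + -(p + 1) = -(2 * p) by ring]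
    apply mul_left_cancel₀ hΛ
    linear_combination F.prod ^ (-(2 * p)) * hQ
  · unfold sR; push_cast; simp only [sub_eq_add_neg, zmod_neg]
    generalize (a : ZMod 2) = a; generalize (b1.length : ZMod 2) = m1; generalize (b2.length : ZMod 2) = m2
    generalize (n1 : ZMod 2) = n1; generalize (n2 : ZMod 2) = n2
    revert a m1 m2 n1 n2; decide
  · unfold sR; push_cast; simp only [sub_eq_add_neg, zmod_neg]
    generalize (a : ZMod 2) = a; generalize (b1.length : ZMod 2) = m1; generalize (b2.length : ZMod 2) = m2
    generalize (n1 : ZMod 2) = n1; generalize (n2 : ZMod 2) = n2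
    revert a m1 m2 n1 n2; decide

theorem Q_strictL {b1 b2 F : List ℂ} {n1 n2 : ℕ} {χ : ℤ → ℤ → ℂ} (G : Good b1 b2 F)
    (hn : F.length = n1 + n2) (H : Forms b1 b2 F n1 n2 χ) (a s : ℤ) (ha : 1 ≤ a)
    (h1 : a < -s + ((b2.length : ℤ) - n2)) :
    χ a s ^ 2 = χ a (s - 1) * χ a (s + 1) + χ (a - 1) s * χ (a + 1) s := by
  obtain ⟨p, hp⟩ : ∃ p, s - a + ((b1.length : ℤ) - n1) = p := ⟨_, rfl⟩
  obtain ⟨k, hk⟩ : ∃ k, (n1 : ℤ) + n2 + a = k := ⟨_, rfl⟩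
  obtain ⟨l, hl⟩ : ∃ l, (b1.length : ℤ) + b2.length - a = l := ⟨_, rfl⟩
  rw [H.L' a s p k l (by omega) (by omega) (by omega) (by omega) (by omega),
    H.L' a (s - 1) (p - 1) k l (by omega) (by omega) (by omega) (by omega) (by omega),
    H.L' a (s + 1) (p + 1) k l (by omega) (by omega) (by omega) (by omega) (by omega),
    H.L' (a - 1) s (p + 1) (k - 1) (l + 1) (by omega) (by omega) (by omega) (by omega) (by omega),
    H.L' (a + 1) s (p - 1) (k + 1) (l - 1) (by omega) (by omega) (by omega) (by omega) (by omega)]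
  apply comb _ _ _ _ _ _ _ _ _ _ _ _ _ _ _ _ (sgn_self _)
  have hQ := hh_Q (Om b1 b2 F) yc uc p k 0 l (by rw [length_Om, hn]; push_cast; omega)
  rw [hh_shift G yc uc Sh_yc Sh_uc 1 p (p + 1) k 0 (0 + 1) l rfl rfl,
    hh_shift G yc uc Sh_yc Sh_uc 1 (p - 1) p k 0 (0 + 1) l (by ring) rfl,
    hh_shift G yc uc Sh_yc Sh_uc 1 (p - 1) p (k + 1) 0 (0 + 1) (l - 1) (by ring) rfl] at hQ
  have hΛ := mul_ne_zero G.be G.ph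
  rw [zpow_one] at hQ
  have hb := G.ph
  rw [sgn_mul _ _ 0, sgn_mul _ _ 0]
  · simp only [← zpow_add₀ hb, zpow_zero, one_mul]
    rw [show -p + -p = -(2 * p) by ring, show -(p + 1) + -(p - 1) = -(2 * p) by ring, show -(p - 1) + -(p + 1) = -(2 * p) by ring]
    apply mul_left_cancel₀ hΛ
    linear_combination F.prod ^ (-(2 * p)) * hQ
  · unfold sL; push_cast; simp only [sub_eq_add_neg, zmod_neg]
    generalize (a : ZMod 2) = a; generalize (b1.length : ZMod 2) = m1; generalize (b2.length : ZMod 2) = m2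
    generalize (n1 : ZMod 2) = n1; generalize (n2 : ZMod 2) = n2
    revert a m1 m2 n1 n2; decide
  · unfold sL; push_cast; simp only [sub_eq_add_neg, zmod_neg]
    generalize (a : ZMod 2) = a; generalize (b1.length : ZMod 2) = m1; generalize (b2.length : ZMod 2) = m2
    generalize (n1 : ZMod 2) = n1; generalize (n2 : ZMod 2) = n2
    revert a m1 m2 n1 n2; decide

theorem Q_diagR {b1 b2 F : List ℂ} {n1 n2 : ℕ} {χ : ℤ → ℤ → ℂ} (G : Good b1 b2 F)
    (hn : F.length = n1 + n2) (H : Forms b1 b2 F n1 n2 χ) (a s : ℤ) (ha : 1 ≤ a)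
    (h1 : a = s + ((b1.length : ℤ) - n1)) (h2 : -s + ((b2.length : ℤ) - n2) < a) :
    χ a s ^ 2 = χ a (s - 1) * χ a (s + 1) + χ (a - 1) s * χ (a + 1) s := by
  obtain ⟨k', hk⟩ : ∃ k' : ℕ, (n1 : ℤ) + n2 + a = k' + 1 := ⟨((n1 : ℤ) + n2 + a - 1).toNat, by omega⟩
  obtain ⟨l, hl⟩ : ∃ l, (b1.length : ℤ) + b2.length - a = l := ⟨_, rfl⟩
  rw [H.R' a s 0 (k' + 1) l (by omega) (by omega) (by omega) (by omega) (by omega),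
    H.U' a (s - 1) 1 k' (l + 1) (by omega) (by omega) (by omega) (by omega) (by omega) (by omega),
    H.R' a (s + 1) 1 (k' + 1) l (by omega) (by omega) (by omega) (by omega) (by omega),
    H.R' (a - 1) s 1 k' (l + 1) (by omega) (by omega) (by omega) (by omega) (by omega),
    H.U' (a + 1) s 1 (k' + 1) l (by omega) (by omega) (by omega) (by omega) (by omega) (by omega)]
  apply comb _ _ _ _ _ _ _ _ _ _ _ _ _ _ _ _ (sgn_self _)
  have hQ := right_diag (Om b1 b2 F) k' l (by omega) (by rw [length_Om, hn]; push_cast; omega)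
  rw [hh_shift G xc uc Sh_xc Sh_uc 1 0 1 (k' + 1) 0 1 l rfl rfl, zpow_one] at hQ
  have hΛ := mul_ne_zero G.be G.ph
  have hb := G.be
  have hp := G.ph
  have hk2 : (k' : ZMod 2) = n1 + n2 + a + 1 := by
    have := congrArg (Int.cast : ℤ → ZMod 2) hk
    push_cast at this
    rw [this, add_assoc, two_add, add_zero]
  have hs : (s : ZMod 2) = a + b1.length + n1 := by
    have h1' : s = a - b1.length + n1 := by omega
    rw [h1']; push_cast; simp only [sub_eq_add_neg, zmod_neg]
  rw [sgn_mul _ _ (k' + 1), sgn_mul _ _ k', zpow_add₀ (by norm_num), zpow_natCast, zpow_one, neg_zero, zpow_zero, zpow_neg_one, zpow_neg_one]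
  · apply mul_left_cancel₀ hΛ
    have e1 : ∀ t : ℂ, ((b1 ++ b2).prod * F.prod) * (((b1 ++ b2).prod⁻¹ * F.prod⁻¹) * t) = t := by
      intro t; field_simp
    have e2 : ∀ t : ℂ, ((b1 ++ b2).prod * F.prod) * ((F.prod⁻¹ * (b1 ++ b2).prod⁻¹) * t) = t := by
      intro t; field_simp
    rw [mul_add, mul_left_comm _ ((-1) ^ k' * -1), e1, mul_left_comm _ ((-1) ^ k'), e2]
    linear_combination hQ
  · unfold sR sU; push_cast; rw [hk2, hs]; simp only [sub_eq_add_neg, zmod_neg]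
    generalize (a : ZMod 2) = a; generalize (b1.length : ZMod 2) = m1; generalize (b2.length : ZMod 2) = m2
    generalize (n1 : ZMod 2) = n1; generalize (n2 : ZMod 2) = n2
    revert a m1 m2 n1 n2; decide
  · unfold sR sU; push_cast; rw [hk2, hs]; simp only [sub_eq_add_neg, zmod_neg]
    generalize (a : ZMod 2) = a; generalize (b1.length : ZMod 2) = m1; generalize (b2.length : ZMod 2) = m2
    generalize (n1 : ZMod 2) = n1; generalize (n2 : ZMod 2) = n2
    revert a m1 m2 n1 n2; decide

theorem Q_apex {b1 b2 F : List ℂ} {n1 n2 : ℕ} {χ : ℤ → ℤ → ℂ} (G : Good b1 b2 F)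
    (hn : F.length = n1 + n2) (H : Forms b1 b2 F n1 n2 χ) (a s : ℤ) (ha : 1 ≤ a)
    (h1 : a = s + ((b1.length : ℤ) - n1)) (h2 : -s + ((b2.length : ℤ) - n2) = a) :
    χ a s ^ 2 = χ a (s - 1) * χ a (s + 1) + χ (a - 1) s * χ (a + 1) s := by
  obtain ⟨q, hk⟩ : ∃ q : ℕ, (n1 : ℤ) + n2 + a = q + 1 := ⟨((n1 : ℤ) + n2 + a - 1).toNat, by omega⟩
  rw [H.U' a s 0 (q + 1) (q + 1) (by omega) (by omega) (by omega) (by omega) (by omega) (by omega),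
    H.L' a (s - 1) (-1) (q + 1) (q + 1) (by omega) (by omega) (by omega) (by omega) (by omega),
    H.R' a (s + 1) 1 (q + 1) (q + 1) (by omega) (by omega) (by omega) (by omega) (by omega),
    H.R' (a - 1) s 1 q (q + 1 + 1) (by omega) (by omega) (by omega) (by omega) (by omega),
    H.U' (a + 1) s 1 (q + 1) (q + 1) (by omega) (by omega) (by omega) (by omega) (by omega) (by omega)]
  apply comb _ _ _ _ _ _ _ _ _ _ _ _ _ _ _ _ (sgn_self _)
  have hQ := apex (Om b1 b2 F) q (by rw [length_Om, hn]; omega)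
  rw [hh_shift G xc yc Sh_xc Sh_yc 1 0 1 (q + 1) 0 1 (q + 1) rfl rfl,
    hh_shift G yc uc Sh_yc Sh_uc 1 (-1) 0 (q + 1) 0 1 (q + 1) rfl rfl, zpow_one] at hQ
  have hΛ := mul_ne_zero G.be G.ph
  have hb := G.be
  have hp := G.ph
  have hk2 : (q : ZMod 2) = n1 + n2 + a + 1 := by
    have := congrArg (Int.cast : ℤ → ZMod 2) hk
    push_cast at this
    rw [this, add_assoc, two_add, add_zero]
  have hs : (s : ZMod 2) = a + b1.length + n1 := by
    have h1' : s = a - b1.length + n1 := by omega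
    rw [h1']; push_cast; simp only [sub_eq_add_neg, zmod_neg]
  have hm2 : (b2.length : ZMod 2) = b1.length + n1 + n2 := by
    have h1' : (b2.length : ℤ) = a + a - b1.length + n1 + n2 := by omega
    have := congrArg (Int.cast : ℤ → ZMod 2) h1'
    push_cast at this
    rw [this, two_add, zero_sub, zmod_neg]
  rw [sgn_mul _ _ (q + 1), sgn_mul _ _ q, zpow_add₀ (by norm_num), zpow_natCast, zpow_one, neg_zero, zpow_zero, zpow_neg_one, zpow_neg_one, neg_neg, zpow_one]
  · apply mul_left_cancel₀ hΛ
    have e1 : ∀ t : ℂ, ((F.prod * F.prod⁻¹) * t) = t := by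
      intro t; field_simp
    have e2 : ∀ t : ℂ, ((b1 ++ b2).prod * F.prod) * ((F.prod⁻¹ * (b1 ++ b2).prod⁻¹) * t) = t := by
      intro t; field_simp
    rw [mul_add, e1, mul_left_comm _ ((-1) ^ q), e2]
    linear_combination hQ
  · unfold sR sU; push_cast; rw [hk2, hs, hm2]; simp only [sub_eq_add_neg, zmod_neg]
    generalize (a : ZMod 2) = a; generalize (b1.length : ZMod 2) = m1
    generalize (n1 : ZMod 2) = n1; generalize (n2 : ZMod 2) = n2
    revert a m1 n1 n2; decide
  · unfold sL sR; push_cast; rw [hk2, hm2]; simp only [sub_eq_add_neg, zmod_neg]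
    generalize (a : ZMod 2) = a; generalize (b1.length : ZMod 2) = m1
    generalize (n1 : ZMod 2) = n1; generalize (n2 : ZMod 2) = n2
    revert a m1 n1 n2; decide

theorem Q_diagL {b1 b2 F : List ℂ} {n1 n2 : ℕ} {χ : ℤ → ℤ → ℂ} (G : Good b1 b2 F)
    (hn : F.length = n1 + n2) (H : Forms b1 b2 F n1 n2 χ) (a s : ℤ) (ha : 1 ≤ a)
    (h1 : s + ((b1.length : ℤ) - n1) < a) (h2 : -s + ((b2.length : ℤ) - n2) = a) :
    χ a s ^ 2 = χ a (s - 1) * χ a (s + 1) + χ (a - 1) s * χ (a + 1) s := by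
  obtain ⟨k', hk⟩ : ∃ k' : ℕ, (n1 : ℤ) + n2 + a = k' + 1 := ⟨((n1 : ℤ) + n2 + a - 1).toNat, by omega⟩
  obtain ⟨l, hl⟩ : ∃ l, (b1.length : ℤ) + b2.length - a = l := ⟨_, rfl⟩
  obtain ⟨η, hη⟩ : ∃ η, (k' : ℤ) + 1 - l = η := ⟨_, rfl⟩
  have hM : (k' : ℤ) + 1 + l = (Om b1 b2 F).length := by rw [length_Om, hn]; push_cast; omega
  rw [H.L' a s (-η) (k' + 1) l (by omega) (by omega) (by omega) (by omega) (by omega),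
    H.L' a (s - 1) (-η - 1) (k' + 1) l (by omega) (by omega) (by omega) (by omega) (by omega),
    H.U' a (s + 1) (η - 1) (l + 1) k' (by omega) (by omega) (by omega) (by omega) (by omega) (by omega),
    H.L' (a - 1) s (1 - η) k' (l + 1) (by omega) (by omega) (by omega) (by omega) (by omega),
    H.U' (a + 1) s (η + 1) l (k' + 1) (by omega) (by omega) (by omega) (by omega) (by omega) (by omega)]
  apply comb _ _ _ _ _ _ _ _ _ _ _ _ _ _ _ _ (sgn_self _)
  have hQ := left_diag (Om b1 b2 F) k' l η (by omega) (by omega) hM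
  rw [hh_shift G yc uc Sh_yc Sh_uc η (-η) 0 (k' + 1) 0 η l (by ring) (by ring),
    hh_shift G yc uc Sh_yc Sh_uc (η + 1) (-η) 1 (k' + 1) 0 (η + 1) l (by ring) (by ring),
    hh_shift G yc xc Sh_yc Sh_xc 1 0 1 k' (η - 1) η (l + 1) (by ring) (by ring),
    hh_shift G yc uc Sh_yc Sh_uc (η + 1) (-η - 1) 0 (k' + 1) 0 (η + 1) l (by ring) (by ring),
    hh_shift G yc uc Sh_yc Sh_uc η (1 - η) 1 k' 0 η (l + 1) (by ring) (by ring),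
    hh_swap (Om b1 b2 F) yc xc 0 k' (η - 1) (l + 1) (by omega),
    hh_swap (Om b1 b2 F) yc xc 0 (k' + 1) (η + 1) l (by omega)] at hQ
  have hΛ := mul_ne_zero G.be G.ph
  have hb := G.be
  have hp := G.ph
  have hk2 : (k' : ZMod 2) = n1 + n2 + a + 1 := by
    have := congrArg (Int.cast : ℤ → ZMod 2) hk
    push_cast at this
    rw [this, add_assoc, two_add, add_zero]
  have hl2 : (l : ZMod 2) = b1.length + b2.length + a := by
    rw [← hl]; push_cast; simp only [sub_eq_add_neg, zmod_neg]
  have hs : (s : ZMod 2) = a + b2.length + n2 := by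
    have h1' : s = b2.length - n2 - a := by omega
    rw [h1']; push_cast; simp only [sub_eq_add_neg, zmod_neg]; ring
  rw [sgn_mul _ _ (l + 1 + k' * (l + 1)), sgn_mul _ _ (l + (k' + 1) * l)]
  · have hm1 : (-1 : ℂ) ≠ 0 := by norm_num
    rw [zpow_add₀ hm1 (l + 1), zpow_add₀ hm1 l, zpow_add₀ hm1 l ((k' + 1) * l), zpow_one]
    have hX := zpow_ne_zero (2 * η + 1) hΛ
    apply mul_left_cancel₀ hX
    generalize (-1 : ℂ) ^ l = t0 at *
    generalize (-1 : ℂ) ^ ((k' : ℤ) * (l + 1)) = t1 at *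
    generalize (-1 : ℂ) ^ (((k' : ℤ) + 1) * l) = t2 at *
    have e0 : ((b1 ++ b2).prod * F.prod) ^ (2 * η + 1) = ((b1 ++ b2).prod * F.prod) ^ η * ((b1 ++ b2).prod * F.prod) ^ (η + 1) := by
      rw [← zpow_add₀ hΛ]; congr 1; ring
    have ep : F.prod ^ (- -η) * F.prod ^ (- -η) = F.prod ^ (2 * η) := by
      rw [← zpow_add₀ hp]; congr 1; ring
    have e1 : ((b1 ++ b2).prod * F.prod) ^ (2 * η + 1) * (F.prod ^ (-(-η - 1)) * (b1 ++ b2).prod ^ (-(η - 1))) =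
        F.prod ^ (2 * η) * (((b1 ++ b2).prod * F.prod) ^ (1 : ℤ) * ((b1 ++ b2).prod * F.prod) ^ (η + 1)) := by
      rw [← zpow_add₀ hΛ, mul_zpow, mul_zpow]
      rw [show ∀ x y z w : ℂ, x * y * (z * w) = (x * w) * (y * z) by intros; ring, ← zpow_add₀ hp, ← zpow_add₀ hb, mul_left_comm, ← zpow_add₀ hp]
      congr 2 <;> ring
    have e2 : ((b1 ++ b2).prod * F.prod) ^ (2 * η + 1) * (F.prod ^ (-(1 - η)) * (b1 ++ b2).prod ^ (-(η + 1))) =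
        F.prod ^ (2 * η) * (((b1 ++ b2).prod * F.prod) ^ η) := by
      rw [mul_zpow, mul_zpow]
      rw [show ∀ x y z w : ℂ, x * y * (z * w) = (x * w) * (y * z) by intros; ring, ← zpow_add₀ hp, ← zpow_add₀ hb, mul_left_comm, ← zpow_add₀ hp]
      congr 2 <;> ring
    rw [ep]
    rw [e0]
    rw [e0] at e1 e2
    linear_combination F.prod ^ (2 * η) * hQ + t0 * t1 * (hh (Om b1 b2 F) yc (-η - 1) (k' + 1) uc 0 l * hh (Om b1 b2 F) xc (η - 1) (l + 1) yc 0 k') * e1 - t0 * t2 * (hh (Om b1 b2 F) yc (1 - η) k' uc 0 (l + 1) * hh (Om b1 b2 F) xc (η + 1) l yc 0 (k' + 1)) * e2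
  · unfold sL sU; push_cast; rw [hk2, hs, hl2]; simp only [sub_eq_add_neg, zmod_neg]
    generalize (a : ZMod 2) = a; generalize (b1.length : ZMod 2) = m1; generalize (b2.length : ZMod 2) = m2
    generalize (n1 : ZMod 2) = n1; generalize (n2 : ZMod 2) = n2
    revert a m1 m2 n1 n2; decide
  · unfold sL sU; push_cast; rw [hk2, hs, hl2]; simp only [sub_eq_add_neg, zmod_neg]
    generalize (a : ZMod 2) = a; generalize (b1.length : ZMod 2) = m1; generalize (b2.length : ZMod 2) = m2
    generalize (n1 : ZMod 2) = n1; generalize (n2 : ZMod 2) = n2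
    revert a m1 m2 n1 n2; decide

theorem Q_all {b1 b2 F : List ℂ} {n1 n2 : ℕ} {χ : ℤ → ℤ → ℂ} (G : Good b1 b2 F)
    (hn : F.length = n1 + n2) (H : Forms b1 b2 F n1 n2 χ) (h0 : ∀ s, χ 0 s = 1) (a s : ℤ) :
    χ a s ^ 2 = χ a (s - 1) * χ a (s + 1) + χ (a - 1) s * χ (a + 1) s := by
  rcases lt_trichotomy a 0 with ha | ha | ha
  · rw [H.zero a s (by omega), H.zero a (s - 1) (by omega), H.zero (a - 1) s (by omega)]; ring
  · subst ha
    rw [h0, h0, h0, H.zero (0 - 1) s (by omega)]; ring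
  rcases lt_trichotomy a (s + ((b1.length : ℤ) - n1)) with h1 | h1 | h1
  · exact Q_strictR G hn H a s ha h1
  all_goals rcases lt_trichotomy a (-s + ((b2.length : ℤ) - n2)) with h2 | h2 | h2
  · exact Q_strictL G hn H a s ha h2
  · exact Q_apex G hn H a s ha h1 h2.symm
  · exact Q_diagR G hn H a s ha h1 h2
  · exact Q_strictL G hn H a s ha h2
  · exact Q_diagL G hn H a s ha h1 h2.symm
  · exact Q_strictU G hn H a s ha h1 h2

end Stmt0

open scoped BigOperators
namespace Stmt0
open Polynomial
set_option linter.all false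

theorem vdm (L : List ℂ) : listDet L (List.range L.length) (fun c j => c ^ j) = VF L := by
  unfold listDet VF pairProd
  rw [dif_pos (by simp)]
  have : (Matrix.of fun i j : Fin L.length => L.get i ^ ((List.range L.length).get (Fin.cast (by simp) j))) =
      Matrix.vandermonde (fun i => L.get i) := by
    ext i j; simp [Matrix.vandermonde]
  rw [this, Matrix.det_vandermonde]
  apply Finset.prod_congr rfl
  intro i _
  rw [← Finset.prod_filter]
  apply Finset.prod_congr _ (fun _ _ => rfl)
  ext j; simp

theorem prodLL_nil_left {ι : Type*} (M : List ι) (g : ι → ι → ℂ) : prodLL [] M g = 1 := by simp [prodLL]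
theorem prodLL_cons_left {ι : Type*} (a : ι) (L M : List ι) (g : ι → ι → ℂ) :
    prodLL (a :: L) M g = (M.map (g a)).prod * prodLL L M g := by simp [prodLL]

theorem pairProd_append {ι : Type*} (A B : List ι) (g : ι → ι → ℂ) :
    pairProd (A ++ B) g = pairProd A g * pairProd B g * prodLL A B g := by
  induction A with
  | nil => simp [pairProd_nil, prodLL_nil_left]
  | cons a A ih =>
    rw [List.cons_append, pairProd_cons, pairProd_cons, ih, prodLL_cons_left, List.map_append, List.prod_append]; ring

theorem prodLL_comm {ι : Type*} (A B : List ι) (g : ι → ι → ℂ) :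
    prodLL A B g = prodLL B A (fun b a => g a b) := by
  induction A with
  | nil => simp [prodLL]
  | cons a A ih =>
    rw [prodLL_cons_left, ih]
    unfold prodLL
    simp only [List.map_cons, List.prod_cons]
    rw [List.prod_map_mul]

theorem prod_neg_list {ι : Type*} (B : List ι) (g : ι → ℂ) :
    (B.map (fun b => - g b)).prod = (-1) ^ B.length * (B.map g).prod := by
  induction B with
  | nil => simp
  | cons b B ih => simp only [List.map_cons, List.prod_cons, List.length_cons, ih, pow_succ]; ring

theorem prodLL_neg (A B : List ℂ) :
    prodLL A B (fun a b => b - a) = (-1) ^ (A.length * B.length) * prodLL A B (fun a b => a - b) := by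
  induction A with
  | nil => simp [prodLL]
  | cons a A ih =>
    have := prod_neg_list B (fun b => a - b)
    simp only [neg_sub] at this
    rw [prodLL_cons_left, ih, prodLL_cons_left, this, List.length_cons, add_mul, pow_add, one_mul]; ring

theorem pairProd_rev (L : List ℂ) :
    pairProd L (fun b b' => b - b') = (-1) ^ (L.length.choose 2) * VF L := by
  unfold VF
  induction L with
  | nil => simp [pairProd_nil]
  | cons a L ih =>
    have := prod_neg_list L (fun b => b - a)
    simp only [neg_sub] at this
    rw [pairProd_cons, pairProd_cons, ih, this, List.length_cons, Nat.choose_succ_succ' _ 1, Nat.choose_one_right, pow_add]; ring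

theorem cc_eq (b1 b2 F : List ℂ) : cc b1 b2 F = (VF (b1 ++ b2) * VF F)⁻¹ := by
  unfold cc
  rw [pairProd_rev, List.length_append, zpow_natCast, mul_assoc, div_mul_eq_div_div, div_self (pow_ne_zero _ (by norm_num)), one_div]

theorem VD (A B : List ℂ) (f g : ℂ → (EE →ₗ[ℂ] ℂ)) (v : ℤ → EE) (p k : ℤ) (ε : ℂ)
    (hA : ∀ c ∈ A, c ≠ 0) (hB : ∀ c ∈ B, c ≠ 0)
    (hf : ∀ c j, f c (v j) = c ^ j) (hg : ∀ c j, g c (v j) = ε * c ^ j)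
    (hk : k = A.length + B.length) :
    bd (A.map f ++ B.map g) (sq v p k) = ε ^ B.length * ((A ++ B).prod ^ p * VF (A ++ B)) := by
  have hk' : k.toNat = (A ++ B).length := by rw [List.length_append]; omega
  unfold bd sq
  rw [← map_elim_append A B f g, hk', listDet_cmp _ _ _ _ (Sum.elim (fun a => a) (fun a => a)) id _ (fun c j => c ^ j)
    (Sum.elim (fun c => c ^ p) (fun c => ε * c ^ p)) (fun _ => 1), prod_elim_append, map_elim_append]
  · simp only [List.map_id, List.map_id']
    rw [vdm, prod_zpow, List.prod_map_mul, prod_zpow, List.prod_append, mul_zpow]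
    simp only [List.map_const', List.prod_replicate, one_pow, one_mul, mul_assoc]
    ring
  · intro r hr j hj
    rcases r with r | r
    · have hr := mem_inl_aux hr
      simp only [Sum.elim_inl, hf, one_mul, id, zpow_add₀ (hA r hr), zpow_natCast]
    · have hr := mem_inr_aux hr
      simp only [Sum.elim_inr, hg, one_mul, id, zpow_add₀ (hB r hr), zpow_natCast, mul_assoc]

theorem gam_uc (c : ℂ) (j : ℤ) : gam c (uc j) = 0 := by simp [uc]

section
variable {b1 b2 F : List ℂ} (G : Good b1 b2 F)

theorem Good.b10 (G : Good b1 b2 F) : ∀ c ∈ b1, c ≠ 0 := fun c hc => G.hb0 c (by simp [hc])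
theorem Good.b20 (G : Good b1 b2 F) : ∀ c ∈ b2, c ≠ 0 := fun c hc => G.hb0 c (by simp [hc])

theorem mem_sq' (v : ℤ → EE) (p k : ℤ) (e : EE) (h : e ∈ sq v p k) : ∃ j, e = v j := by
  unfold sq at h; rw [List.mem_map] at h; obtain ⟨i, -, h⟩ := h; exact ⟨_, h.symm⟩

theorem blockA (G : Good b1 b2 F) (c : ℤ) (X : List EE) (hX : X.length = F.length) :
    bd (Om b1 b2 F) (sq uc c (b1.length + b2.length) ++ X) =
      (b1 ++ b2).prod ^ c * VF (b1 ++ b2) * bd (F.map gam) X := by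
  have h1 := VD b1 b2 evx evy uc c (b1.length + b2.length) 1 G.b10 G.b20 (by simp [uc]) (by simp [uc]) rfl
  unfold bd at h1 ⊢
  unfold Om
  rw [← List.append_assoc, listDet_append, h1]
  · ring
  · simp [hX]
  · intro r hr e he
    obtain ⟨j, rfl⟩ := mem_sq' _ _ _ _ he
    rw [List.mem_map] at hr
    obtain ⟨f, -, rfl⟩ := hr
    exact gam_uc _ _

theorem blockF (G : Good b1 b2 F) (p k : ℤ) (hk : k = F.length) (v : ℤ → EE) (ε : ℂ)
    (hv : ∀ c j, gam c (v j) = ε * c ^ j) :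
    bd (F.map gam) (sq v p k) = ε ^ F.length * (F.prod ^ p * VF F) := by
  have := VD [] F (fun c => evx c) gam v p k ε (by simp) G.hF0
  simp only [List.map_nil, List.nil_append] at this
  have h2 := VD F [] evx evy xc
  unfold bd sq
  rw [show k.toNat = F.length by omega, listDet_cmp _ _ _ _ id id _ (fun c j => c ^ j)
    (fun c => ε * c ^ p) (fun _ => 1)]
  · simp only [List.map_id, List.map_id']
    rw [vdm, List.prod_map_mul, prod_zpow]
    simp only [List.map_const', List.prod_replicate, one_pow, one_mul, mul_assoc]
  · intro r hr j hj
    simp only [hv, one_mul, id, zpow_add₀ (G.hF0 r hr), zpow_natCast, mul_assoc]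

theorem blockB (G : Good b1 b2 F) (p k c l : ℤ) (w : ℤ → EE) (hk : k = b1.length + F.length) (hl : l = b2.length)
    (hw : ∀ b j, evy b (w j) = b ^ j) :
    hh (Om b1 b2 F) xc p k w c l = (-1) ^ (b2.length * F.length) *
      ((b1.prod * F.prod) ^ p * VF (b1 ++ F)) * (b2.prod ^ c * VF b2) := by
  have h1 := VD b1 F evx gam xc p k 1 G.b10 G.hF0 (by simp) (by simp) hk
  have h2 := VD b2 [] evy evy w c l 1 G.b20 (by simp) hw (by simp [hw]) (by simp [hl])
  have h3 := bd_rowswap (b1.map evx) (b2.map evy) (F.map gam) [] (sq xc p k ++ sq w c l)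
  simp only [List.append_nil, List.length_map, List.map_nil, one_pow, one_mul, List.prod_append] at h1 h2 h3
  unfold hh Om
  rw [h3]
  unfold bd at h1 h2 ⊢
  rw [← List.append_assoc, listDet_append, h1, h2]
  · ring
  · simp [sq_length, hl]
  · intro r hr e he
    obtain ⟨j, rfl⟩ := mem_sq' _ _ _ _ he
    rw [List.mem_map] at hr
    obtain ⟨f, -, rfl⟩ := hr
    exact evy_xc _ _

theorem blockC (G : Good b1 b2 F) (p k c l : ℤ) (w : ℤ → EE) (hk : k = b2.length + F.length) (hl : l = b1.length)
    (hw : ∀ b j, evx b (w j) = b ^ j) :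
    hh (Om b1 b2 F) yc p k w c l = (-1) ^ (b1.length * (b2.length + F.length)) * ((-1) ^ F.length *
      ((b2.prod * F.prod) ^ p * VF (b2 ++ F))) * (b1.prod ^ c * VF b1) := by
  have h1 := VD b2 F evy gam yc p k (-1) G.b20 G.hF0 (by simp) (by simp) hk
  have h2 := VD b1 [] evx evx w c l 1 G.b10 (by simp) hw (by simp [hw]) (by simp [hl])
  have h3 := bd_rowswap [] (b1.map evx) (b2.map evy ++ F.map gam) [] (sq yc p k ++ sq w c l)
  simp only [List.append_nil, List.nil_append, List.length_map, List.length_append, List.map_nil, one_pow, one_mul, List.prod_append, List.length_nil, pow_zero] at h1 h2 h3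
  unfold hh Om
  rw [h3]
  unfold bd at h1 h2 ⊢
  rw [listDet_append, h1, h2]
  · ring
  · simp [sq_length, hl]
  · intro r hr e he
    obtain ⟨j, rfl⟩ := mem_sq' _ _ _ _ he
    rw [List.mem_map] at hr
    obtain ⟨f, -, rfl⟩ := hr
    exact evx_yc _ _
end

end Stmt0

open scoped BigOperators
namespace Stmt0
open Polynomial
set_option linter.all false

theorem VF_append (A B : List ℂ) : VF (A ++ B) = VF A * VF B * prodLL A B (fun a b => b - a) := by
  unfold VF; rw [pairProd_append]

theorem Good.V21 {b1 b2 F : List ℂ} (G : Good b1 b2 F) : prodLL b2 b1 (fun b' b => b' - b) ≠ 0 := by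
  apply prodLL_ne
  intro b hb h
  have := List.nodup_append.1 G.hB
  exact this.2.2 b h b hb rfl

theorem valB {b1 b2 F : List ℂ} (G : Good b1 b2 F) :
    cc b1 b2 F * (VF (b1 ++ F) * VF b2) = (-1 : ℂ) ^ ((b1.length : ℤ) * F.length) *
      (prodLL b1 F (fun b f => b - f) / prodLL b2 b1 (fun b' b => b' - b)) := by
  have h1 := VF_ne b1 (List.nodup_append.1 G.hB).1
  have h2 := VF_ne b2 (List.nodup_append.1 G.hB).2.1
  have h3 := VF_ne F G.hF
  have h4 := G.V21
  rw [cc_eq, VF_append b1 b2, VF_append _ F, prodLL_neg _ F, prodLL_comm b1 b2, neg_one_pow_int]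
  push_cast
  field_simp

theorem valC {b1 b2 F : List ℂ} (G : Good b1 b2 F) :
    cc b1 b2 F * (VF (b2 ++ F) * VF b1) = (-1 : ℂ) ^ ((b2.length : ℤ) * F.length) *
      (prodLL b2 F (fun b f => b - f) / prodLL b2 b1 (fun b' b => b' - b)) := by
  have h1 := VF_ne b1 (List.nodup_append.1 G.hB).1
  have h2 := VF_ne b2 (List.nodup_append.1 G.hB).2.1
  have h3 := VF_ne F G.hF
  have h4 := G.V21
  rw [cc_eq, VF_append b1 b2, VF_append _ F, prodLL_neg _ F, prodLL_comm b1 b2, neg_one_pow_int]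
  push_cast
  field_simp

theorem Good.p1 {b1 b2 F : List ℂ} (G : Good b1 b2 F) : b1.prod ≠ 0 := by
  rw [Ne, List.prod_eq_zero_iff]; intro h; exact G.b10 _ h rfl
theorem Good.p2 {b1 b2 F : List ℂ} (G : Good b1 b2 F) : b2.prod ≠ 0 := by
  rw [Ne, List.prod_eq_zero_iff]; intro h; exact G.b20 _ h rfl

theorem comb2 (c e1 e2 e3 q q' V1 V2 b r : ℂ) (h : c * (V1 * V2) = e3 * r) (he : e1 * e2 * e3 = 1) (hq : q * q' = 1) :
    c * e1 * q * (e2 * (b * q' * V1) * (1 * V2)) = b * r := by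
  linear_combination (e1 * e2 * b * (q * q')) * h + b * r * (q * q') * he + b * r * hq

theorem comb3 (c e1 e2 e3 e4 q q' V1 V2 b r : ℂ) (h : c * (V1 * V2) = e3 * r) (he : e1 * e2 * e4 * e3 = 1) (hq : q * q' = 1) :
    c * e1 * q * (e2 * (e4 * (b * q' * V1)) * (1 * V2)) = b * r := by
  linear_combination (e1 * e2 * e4 * b * (q * q')) * h + b * r * (q * q') * he + b * r * hq

section
variable {b1 b2 F : List ℂ} {n1 n2 : ℕ} {χ : ℤ → ℤ → ℂ}

theorem chi_m1 (G : Good b1 b2 F) (hn : F.length = n1 + n2) (H : Forms b1 b2 F n1 n2 χ) (s : ℤ) (hs : (n1 : ℤ) ≤ s) :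
    χ b1.length s = b1.prod ^ (s - n1) * (prodLL b1 F (fun b f => b - f) / prodLL b2 b1 (fun b' b => b' - b)) := by
  rw [H.R' b1.length s (s - n1) (b1.length + F.length) b2.length (by omega) (by omega) (by omega) (by omega) (by omega),
    blockB G _ _ _ _ uc rfl rfl (by simp [uc]), mul_zpow, zpow_zero]
  apply comb2 _ _ _ _ _ _ _ _ _ _ (valB G)
  · rw [neg_one_pow_int, sgn_mul _ _ ((b1.length : ℤ) * F.length), sgn_self]
    unfold sR; rw [hn]; push_cast; simp only [sub_eq_add_neg, zmod_neg]
    generalize (b1.length : ZMod 2) = m1; generalize (b2.length : ZMod 2) = m2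
    generalize (n1 : ZMod 2) = n1; generalize (n2 : ZMod 2) = n2
    revert m1 m2 n1 n2; decide
  · rw [← zpow_add₀ G.ph]; simp

theorem chi_m2 (G : Good b1 b2 F) (hn : F.length = n1 + n2) (H : Forms b1 b2 F n1 n2 χ) (s : ℤ) (hs : s ≤ -(n2 : ℤ)) :
    χ b2.length s = b2.prod ^ (s - b2.length + (b1.length - n1)) * (prodLL b2 F (fun b f => b - f) / prodLL b2 b1 (fun b' b => b' - b)) := by
  rw [H.L' b2.length s (s - b2.length + (b1.length - n1)) (b2.length + F.length) b1.length (by omega) (by omega) (by omega) (by omega) (by omega),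
    blockC G _ _ _ _ uc rfl rfl (by simp [uc]), mul_zpow, zpow_zero]
  apply comb3 _ _ _ _ _ _ _ _ _ _ _ (valC G)
  · rw [neg_one_pow_int, neg_one_pow_int, sgn_mul _ _ ((b2.length : ℤ) * F.length + F.length), sgn_mul _ _ ((b2.length : ℤ) * F.length), sgn_self]
    · push_cast; rw [add_assoc, two_add, add_zero]
    unfold sL; rw [hn]; push_cast; simp only [sub_eq_add_neg, zmod_neg]
    generalize (b1.length : ZMod 2) = m1; generalize (b2.length : ZMod 2) = m2
    generalize (n1 : ZMod 2) = n1; generalize (n2 : ZMod 2) = n2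
    revert m1 m2 n1 n2; decide
  · rw [← zpow_add₀ G.ph, neg_add_cancel, zpow_zero]

theorem chi_n1 (G : Good b1 b2 F) (hn : F.length = n1 + n2) (H : Forms b1 b2 F n1 n2 χ) (a : ℤ) (hs : (b1.length : ℤ) ≤ a)
    (h2 : (b2.length : ℤ) - n1 - n2 ≤ a) :
    χ a n1 = (b2.prod / ((-1) ^ F.length * F.prod)) ^ ((b1.length : ℤ) - a) * (prodLL b1 F (fun b f => b - f) / prodLL b2 b1 (fun b' b => b' - b)) := by
  rw [H.U' a n1 (a - b1.length) (b1.length + F.length) b2.length (by omega) (by omega) (by omega) (by omega) (by omega) (by omega),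
    blockB G _ _ _ _ yc rfl rfl (by simp), zpow_zero]
  have e1 : (b2.prod / ((-1) ^ F.length * F.prod)) ^ ((b1.length : ℤ) - a) =
     (-1 : ℂ) ^ ((F.length : ℤ) * (a - b1.length)) * (b2.prod ^ ((b1.length : ℤ) - a) * F.prod ^ (a - b1.length)) := by
    rw [div_zpow, mul_zpow, neg_one_pow_int, ← zpow_mul, div_eq_mul_inv, mul_inv, ← zpow_neg, ← zpow_neg]
    rw [show -((F.length : ℤ) * (b1.length - a)) = F.length * (a - b1.length) by ring, neg_sub]; ring
  rw [e1, mul_zpow, List.prod_append, mul_zpow]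
  have hv := valB G
  have hs : (-1 : ℂ) ^ sU b2.length n1 n2 a n1 * (-1) ^ ((b2.length : ℤ) * F.length) * (-1) ^ ((b1.length : ℤ) * F.length) = (-1 : ℂ) ^ ((F.length : ℤ) * (a - b1.length)) := by
    rw [sgn_mul _ _ (sU b2.length n1 n2 a n1 + (b2.length : ℤ) * F.length) (by push_cast; rfl), sgn_mul]
    unfold sU; rw [hn]; push_cast; simp only [sub_eq_add_neg, zmod_neg]
    generalize (b1.length : ZMod 2) = m1; generalize (b2.length : ZMod 2) = m2; generalize (a : ZMod 2) = a
    generalize (n1 : ZMod 2) = n1; generalize (n2 : ZMod 2) = n2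
    revert m1 m2 a n1 n2; decide
  have hb : b1.prod ^ (-(a - b1.length)) * b1.prod ^ (a - b1.length) = 1 := by
    rw [← zpow_add₀ G.p1]; simp
  rw [neg_one_pow_int (b2.length * F.length), show (b1.length : ℤ) - a = -(a - b1.length) by ring]
  push_cast at hs ⊢
  rw [← hs]
  generalize prodLL b1 F (fun b f => b - f) / prodLL b2 b1 (fun b' b => b' - b) = r at *
  generalize (-1 : ℂ) ^ ((b2.length : ℤ) * F.length) = x1 at *
  generalize (-1 : ℂ) ^ ((b1.length : ℤ) * F.length) = x2 at *
  generalize b1.prod ^ (-(a - b1.length)) = y1 at *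
  generalize b1.prod ^ (a - b1.length) = y2 at *
  generalize b2.prod ^ (-(a - b1.length)) = y3 at *
  generalize F.prod ^ (a - b1.length) = y4 at *
  generalize (-1 : ℂ) ^ sU b2.length n1 n2 a n1 = x3 at *
  linear_combination (x1 * x3 * y3 * y4 * (y1 * y2)) * hv + x1 * x2 * x3 * r * y3 * y4 * hb

theorem chi_n2 (G : Good b1 b2 F) (hn : F.length = n1 + n2) (H : Forms b1 b2 F n1 n2 χ) (a : ℤ) (hs : (b2.length : ℤ) ≤ a)
    (h2 : (b1.length : ℤ) - n1 - n2 ≤ a) :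
    χ a (-n2) = b2.prod ^ ((b1.length : ℤ) - n1 - a - n2) * (prodLL b2 F (fun b f => b - f) / prodLL b2 b1 (fun b' b => b' - b)) := by
  obtain ⟨E, hE⟩ : ∃ E : ℤ, a - b1.length + n1 + n2 = E := ⟨_, rfl⟩
  rw [H.U' a (-n2) E b1.length (b2.length + F.length) (by omega) (by omega) (by omega) (by omega) (by omega) (by omega),
    hh_swap _ _ _ _ _ _ _ (by rw [length_Om]; push_cast; ring),
    blockC G _ _ _ _ xc rfl rfl (by simp), zpow_zero, show (b1.length : ℤ) - n1 - a - n2 = -E by omega]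
  rw [List.prod_append, mul_zpow]
  have hv := valC G
  have hs : (-1 : ℂ) ^ sU b2.length n1 n2 a (-n2) * (-1) ^ ((b1.length : ℤ) * (b2.length + F.length)) * ((-1) ^ ((b1.length : ℤ) * (b2.length + F.length)) * (-1) ^ (F.length : ℤ)) * (-1) ^ ((b2.length : ℤ) * F.length) = 1 := by
    rw [mul_assoc (_ ^ _) (_ ^ _) (_ * _), ← mul_assoc (_ ^ _) (_ ^ _) (_ ^ _), sgn_self, one_mul, sgn_mul _ _ ((b2.length : ℤ) * F.length), sgn_self]
    unfold sU; rw [hn]; push_cast; simp only [sub_eq_add_neg, zmod_neg]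
    generalize (b1.length : ZMod 2) = m1; generalize (b2.length : ZMod 2) = m2; generalize (a : ZMod 2) = a
    generalize (n1 : ZMod 2) = n1; generalize (n2 : ZMod 2) = n2
    revert m1 m2 a n1 n2; decide
  have hb : b1.prod ^ (-E) * b1.prod ^ E = 1 := by
    rw [← zpow_add₀ G.p1]; simp
  rw [neg_one_pow_int, neg_one_pow_int]
  push_cast at hs ⊢
  generalize prodLL b2 F (fun b f => b - f) / prodLL b2 b1 (fun b' b => b' - b) = r at *
  generalize (-1 : ℂ) ^ ((b2.length : ℤ) * F.length) = x1 at *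
  generalize (-1 : ℂ) ^ ((b1.length : ℤ) * (b2.length + F.length)) = x2 at *
  generalize (-1 : ℂ) ^ (F.length : ℤ) = x4 at *
  generalize b1.prod ^ (-E) = y1 at *
  generalize b1.prod ^ E = y2 at *
  generalize b2.prod ^ (-E) = y3 at *
  generalize (-1 : ℂ) ^ sU b2.length n1 n2 a (-n2) = x3 at *
  linear_combination (x2 * x2 * x3 * x4 * y3 * (y1 * y2)) * hv + (x1 * x2 * x2 * x3 * x4) * r * y3 * hb + r * y3 * hs

/-- a sequence that is eventually geometric and log-linear is geometric -/
theorem geom (f : ℤ → ℂ) (A r : ℂ) (hA : A ≠ 0) (hr : r ≠ 0) (m N : ℤ)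
    (h1 : ∀ a, N ≤ a → m ≤ a → f a = r ^ (m - a) * A) (h2 : ∀ a, m < a → f a ^ 2 = f (a - 1) * f (a + 1)) :
    ∀ a, m ≤ a → f a = r ^ (m - a) * A := by
  have key : ∀ k : ℕ, ∀ a, m ≤ a → N - k ≤ a → f a = r ^ (m - a) * A := by
    intro k
    induction k with
    | zero => intro a ha hN; exact h1 a (by simpa using hN) ha
    | succ k ih =>
      intro a ha hN
      push_cast at hN
      have e1 := ih (a + 1) (by omega) (by omega)
      have e2 := ih (a + 1 + 1) (by omega) (by omega)
      have e3 := h2 (a + 1) (by omega)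
      rw [e1, e2, show a + 1 - 1 = a by ring] at e3
      have hne : r ^ (m - (a + 1 + 1)) * A ≠ 0 := mul_ne_zero (zpow_ne_zero _ hr) hA
      apply mul_right_cancel₀ hne
      rw [← e3]
      have : r ^ (m - (a + 1)) * r ^ (m - (a + 1)) = r ^ (m - a) * r ^ (m - (a + 1 + 1)) := by
        rw [← zpow_add₀ hr, ← zpow_add₀ hr]; congr 1; ring
      linear_combination A ^ 2 * this
  intro a ha
  exact key (N - a).toNat a ha (by omega)

end
end Stmt0

open scoped BigOperators
namespace Stmt0
open Polynomial
set_option linter.all false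

theorem sq_split (v : ℤ → EE) (p k l : ℤ) (hk : 0 ≤ k) (hl : 0 ≤ l) :
    sq v p (k + l) = sq v p k ++ sq v (p + k) l := by
  unfold sq
  rw [Int.toNat_add hk hl, List.range_add, List.map_append, List.map_map]
  congr 1
  apply List.map_congr_left
  intro j _
  simp only [Function.comp]
  congr 1
  push_cast
  rw [Int.toNat_of_nonneg hk]; ring

/-- sign-flipped comparison of the two kinds of columns on the rows `gam` -/
theorem gam_flip (F : List ℂ) (p k c l : ℤ) :
    bd (F.map gam) (sq yc c l ++ sq xc p k) = (-1) ^ l.toNat * bd (F.map gam) (sq xc c l ++ sq xc p k) := by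
  unfold bd sq
  rw [← map_elim_append (List.range l.toNat) (List.range k.toNat) (fun j : ℕ => yc (c + j)),
    ← map_elim_append (List.range l.toNat) (List.range k.toNat) (fun j : ℕ => xc (c + j)),
    listDet_cmp _ _ _ _ gam (Sum.elim (fun j : ℕ => xc (c + j)) (fun j : ℕ => xc (p + j))) _ (fun (φ : EE →ₗ[ℂ] ℂ) (v : EE) => φ v)
    (fun _ => 1) (Sum.elim (fun _ => -1) (fun _ => 1))]
  · rw [prod_elim_append]
    simp only [List.map_const', List.prod_replicate, one_pow, one_mul, mul_one, List.length_range]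
  · intro r hr e he
    rcases e with e | e
    · simp only [Sum.elim_inl, gam_yc, gam_xc]; ring
    · simp only [Sum.elim_inr, gam_yc, gam_xc]; ring

section
variable {b1 b2 F : List ℂ} {n1 n2 : ℕ} {χ : ℤ → ℤ → ℂ}

theorem chi0R (G : Good b1 b2 F) (hn : F.length = n1 + n2) (H : Forms b1 b2 F n1 n2 χ) (s : ℤ)
    (hs : 0 ≤ s + (b1.length - n1)) : χ 0 s = 1 := by
  obtain ⟨p, hp⟩ : ∃ p : ℤ, s - 0 + (b1.length - n1) = p := ⟨_, rfl⟩
  rw [H.R' 0 s p F.length (b1.length + b2.length) (by omega) hp (by omega) (by omega) (by omega),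
    hh_swap _ _ _ _ _ _ _ (by rw [length_Om]; push_cast; ring), hh, blockA G 0 _ (by simp [sq_length]),
    blockF G p _ rfl xc 1 (by simp), cc_eq, zpow_zero, one_pow]
  have h1 := VF_ne _ G.hB
  have h3 := VF_ne F G.hF
  have hs : (-1 : ℂ) ^ sR b1.length b2.length n1 n2 0 * (-1) ^ ((F.length : ℤ) * (b1.length + b2.length)) = 1 := by
    rw [sgn_mul _ _ 0]
    · simp
    unfold sR; rw [hn]; push_cast; simp only [sub_eq_add_neg, zmod_neg]
    generalize (b1.length : ZMod 2) = m1; generalize (b2.length : ZMod 2) = m2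
    generalize (n1 : ZMod 2) = n1; generalize (n2 : ZMod 2) = n2
    revert m1 m2 n1 n2; decide
  have hq : F.prod ^ (-p) * F.prod ^ p = 1 := by rw [← zpow_add₀ G.ph, neg_add_cancel, zpow_zero]
  rw [mul_inv]
  have i1 := inv_mul_cancel₀ h1
  have i2 := inv_mul_cancel₀ h3
  calc _ = ((VF (b1 ++ b2))⁻¹ * VF (b1 ++ b2)) * ((VF F)⁻¹ * VF F) * (F.prod ^ (-p) * F.prod ^ p) * ((-1 : ℂ) ^ sR b1.length b2.length n1 n2 0 * (-1) ^ ((F.length : ℤ) * (b1.length + b2.length))) := by ring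
    _ = 1 := by rw [i1, i2, hq, hs]; ring

theorem chi0L (G : Good b1 b2 F) (hn : F.length = n1 + n2) (H : Forms b1 b2 F n1 n2 χ) (s : ℤ)
    (hs : 0 ≤ -s + ((b2.length : ℤ) - n2)) : χ 0 s = 1 := by
  obtain ⟨p, hp⟩ : ∃ p : ℤ, s - 0 + (b1.length - n1) = p := ⟨_, rfl⟩
  rw [H.L' 0 s p F.length (b1.length + b2.length) (by omega) (by omega) hp (by omega) (by omega),
    hh_swap _ _ _ _ _ _ _ (by rw [length_Om]; push_cast; ring), hh, blockA G 0 _ (by simp [sq_length]),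
    blockF G p _ rfl yc (-1) (by simp), cc_eq, zpow_zero, neg_one_pow_int F.length]
  have h1 := VF_ne _ G.hB
  have h3 := VF_ne F G.hF
  have hs : (-1 : ℂ) ^ sL b1.length b2.length n1 n2 0 * (-1) ^ ((F.length : ℤ) * (b1.length + b2.length)) * (-1) ^ (F.length : ℤ) = 1 := by
    rw [sgn_mul _ _ (F.length : ℤ), sgn_self]
    unfold sL; rw [hn]; push_cast; simp only [sub_eq_add_neg, zmod_neg]
    generalize (b1.length : ZMod 2) = m1; generalize (b2.length : ZMod 2) = m2
    generalize (n1 : ZMod 2) = n1; generalize (n2 : ZMod 2) = n2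
    revert m1 m2 n1 n2; decide
  have hq : F.prod ^ (-p) * F.prod ^ p = 1 := by rw [← zpow_add₀ G.ph, neg_add_cancel, zpow_zero]
  rw [mul_inv]
  have i1 := inv_mul_cancel₀ h1
  have i2 := inv_mul_cancel₀ h3
  calc _ = ((VF (b1 ++ b2))⁻¹ * VF (b1 ++ b2)) * ((VF F)⁻¹ * VF F) * (F.prod ^ (-p) * F.prod ^ p) * ((-1 : ℂ) ^ sL b1.length b2.length n1 n2 0 * (-1) ^ ((F.length : ℤ) * (b1.length + b2.length)) * (-1) ^ (F.length : ℤ)) := by ring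
    _ = 1 := by rw [i1, i2, hq, hs]; ring

theorem chi0U (G : Good b1 b2 F) (hn : F.length = n1 + n2) (H : Forms b1 b2 F n1 n2 χ) (s : ℤ)
    (hs1 : s + (b1.length - n1) < 0) (hs2 : -s + ((b2.length : ℤ) - n2) < 0) : χ 0 s = 1 := by
  obtain ⟨E, hE⟩ : ∃ E : ℤ, 0 - s - (b1.length - n1) = E := ⟨_, rfl⟩
  rw [H.U' 0 s E (F.length - E) (E + (b1.length + b2.length)) hE (by omega) (by omega) (by omega) (by omega) (by omega)]
  have e1 : hh (Om b1 b2 F) xc E (F.length - E) yc 0 (E + (b1.length + b2.length)) =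
      (-1) ^ ((F.length : ℤ) * (b1.length + b2.length)) * ((-1) ^ ((F.length - E) * E) * ((-1) ^ E * ((b1 ++ b2).prod ^ E * VF (b1 ++ b2) * VF F))) := by
    have l1 := sub_seg (Ω := Om b1 b2 F) (sq xc E (F.length - E) ++ sq yc 0 E) [] yc uc (0 + E) (b1.length + b2.length) (by
      intro j hj1 hj2
      refine ⟨xc j, ?_, Or.inr (y_u j)⟩
      rw [List.append_nil, List.mem_append]; left
      exact mem_sq _ _ _ _ (by omega) (by omega))
    have l2 := bd_swap (Om b1 b2 F) [] (sq xc E (F.length - E) ++ sq yc 0 E) (sq uc E (b1.length + b2.length)) []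
    have l3 := bd_swap (F.map gam) [] (sq xc E (F.length - E)) (sq yc 0 E) []
    have l4 := gam_flip F E (F.length - E) 0 E
    have l5 := blockF G 0 F.length rfl xc 1 (by simp)
    have l6 := sq_split xc 0 E (F.length - E) (by omega) (by omega)
    rw [show E + ((F.length : ℤ) - E) = F.length by ring, zero_add] at l6
    rw [← l6] at l4
    simp only [List.append_nil, List.nil_append, zero_add] at l1 l2 l3
    rw [hh, sq_split _ _ _ _ (by omega) (by omega), zero_add, ← List.append_assoc, l1, l2,
      blockA G _ _ (by simp [sq_length]; omega), l3, l4, l5]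
    simp only [List.length_append, sq_length, neg_one_pow_int]
    push_cast
    rw [Int.toNat_of_nonneg (show 0 ≤ (F.length : ℤ) - E by omega), Int.toNat_of_nonneg (show 0 ≤ E by omega),
      Int.toNat_of_nonneg (show 0 ≤ (b1.length : ℤ) + b2.length by omega), sub_add_cancel]
    simp only [one_zpow, zpow_zero, one_pow]
    ring
  rw [e1, cc_eq]
  have h1 := VF_ne _ G.hB
  have h3 := VF_ne F G.hF
  have hs : (-1 : ℂ) ^ sU b2.length n1 n2 0 s * (-1) ^ ((F.length : ℤ) * (b1.length + b2.length)) * ((-1) ^ ((F.length - E) * E) * (-1) ^ E) = 1 := by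
    rw [sgn_mul ((F.length - E) * E) E ((F.length - E) * E + E) (by push_cast; rfl), sgn_mul _ _ ((F.length - E) * E + E), sgn_self]
    rw [← hE]
    unfold sU; rw [hn]; push_cast; simp only [sub_eq_add_neg, zmod_neg]
    generalize (b1.length : ZMod 2) = m1; generalize (b2.length : ZMod 2) = m2; generalize (s : ZMod 2) = s
    generalize (n1 : ZMod 2) = n1; generalize (n2 : ZMod 2) = n2
    revert m1 m2 s n1 n2; decide
  have hq : (b1 ++ b2).prod ^ (-E) * (b1 ++ b2).prod ^ E = 1 := by rw [← zpow_add₀ G.be, neg_add_cancel, zpow_zero]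
  rw [mul_inv]
  have i1 := inv_mul_cancel₀ h1
  have i2 := inv_mul_cancel₀ h3
  calc _ = ((VF (b1 ++ b2))⁻¹ * VF (b1 ++ b2)) * ((VF F)⁻¹ * VF F) * ((b1 ++ b2).prod ^ (-E) * (b1 ++ b2).prod ^ E) * ((-1 : ℂ) ^ sU b2.length n1 n2 0 s * (-1) ^ ((F.length : ℤ) * (b1.length + b2.length)) * ((-1) ^ ((F.length - E) * E) * (-1) ^ E)) := by ring
    _ = 1 := by rw [i1, i2, hq, hs]; ring

theorem chi0 (G : Good b1 b2 F) (hn : F.length = n1 + n2) (H : Forms b1 b2 F n1 n2 χ) (s : ℤ) : χ 0 s = 1 := by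
  by_cases h1 : 0 ≤ s + (b1.length - n1)
  · exact chi0R G hn H s h1
  by_cases h2 : 0 ≤ -s + ((b2.length : ℤ) - n2)
  · exact chi0L G hn H s h2
  exact chi0U G hn H s (by omega) (by omega)

theorem chi_n1' (G : Good b1 b2 F) (hn : F.length = n1 + n2) (H : Forms b1 b2 F n1 n2 χ) (a : ℤ) (ha : (b1.length : ℤ) ≤ a) :
    χ a n1 = (b2.prod / ((-1) ^ F.length * F.prod)) ^ ((b1.length : ℤ) - a) * (prodLL b1 F (fun b f => b - f) / prodLL b2 b1 (fun b' b => b' - b)) := by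
  refine geom (fun a => χ a n1) _ _ ?_ ?_ b1.length ((b2.length : ℤ) - n1 - n2) ?_ ?_ a ha
  · exact div_ne_zero (prodLL_ne _ _ (fun b hb => G.hbF b (by simp [hb]))) G.V21
  · exact div_ne_zero G.p2 (mul_ne_zero (pow_ne_zero _ (by norm_num)) G.ph)
  · intro a h1 h2; exact chi_n1 G hn H a h2 h1
  · intro a h1
    have := Q_all G hn H (chi0 G hn H) a n1
    rw [H.zero a (n1 + 1) (by omega)] at this
    simpa using this

theorem chi_n2' (G : Good b1 b2 F) (hn : F.length = n1 + n2) (H : Forms b1 b2 F n1 n2 χ) (a : ℤ) (ha : (b2.length : ℤ) ≤ a) :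
    χ a (-n2) = b2.prod ^ ((b1.length : ℤ) - n1 - a - n2) * (prodLL b2 F (fun b f => b - f) / prodLL b2 b1 (fun b' b => b' - b)) := by
  have e : ∀ a : ℤ, b2.prod ^ ((b1.length : ℤ) - n1 - a - n2) = b2.prod ^ ((b2.length : ℤ) - a) * b2.prod ^ ((b1.length : ℤ) - n1 - b2.length - n2) := by
    intro a; rw [← zpow_add₀ G.p2]; congr 1; ring
  rw [e, mul_assoc]
  refine geom (fun a => χ a (-n2)) _ _ ?_ ?_ b2.length ((b1.length : ℤ) - n1 - n2) ?_ ?_ a ha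
  · exact mul_ne_zero (zpow_ne_zero _ G.p2) (div_ne_zero (prodLL_ne _ _ (fun b hb => G.hbF b (by simp [hb]))) G.V21)
  · exact G.p2
  · intro a h1 h2; rw [← mul_assoc, ← e]; exact chi_n2 G hn H a h2 h1
  · intro a h1
    have := Q_all G hn H (chi0 G hn H) a (-n2)
    rw [H.zero a (-n2 - 1) (by omega)] at this
    simpa using this

end
end Stmt0


namespace Stmt0

/-- **Wronskian solution of the Q-system on the generalized T-hook.**
The Wronskian supercharacters satisfy the Q-system together with the stated
boundary conditions. -/
theorem Qsystem_of_isChi {ι : Type*} (z : ι → ℂ) (B1 B2 F1 F2 : List ι)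
    (m1 m2 n1 n2 : ℕ)
    (hm1 : B1.length = m1) (hm2 : B2.length = m2)
    (hn1 : F1.length = n1) (hn2 : F2.length = n2)
    (hnd : (B1 ++ B2 ++ F1 ++ F2).Nodup)
    (hz0 : ∀ i ∈ B1 ++ B2 ++ F1 ++ F2, z i ≠ 0)
    (hzd : ∀ i ∈ B1 ++ B2 ++ F1 ++ F2, ∀ j ∈ B1 ++ B2 ++ F1 ++ F2, i ≠ j → z i ≠ z j)
    (χ : ℤ → ℤ → ℂ) (hχ : IsChi z B1 B2 F1 F2 χ) :
    (∀ a s : ℤ, χ a s ^ 2 = χ a (s - 1) * χ a (s + 1) + χ (a - 1) s * χ (a + 1) s) ∧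
    (∀ a : ℤ, 0 ≤ a →
      χ m1 ((n1 : ℤ) + a) =
        (prodL (B1 ++ B2) z / prodL (F1 ++ F2) (fun f => -z f)) ^ a * χ ((m1 : ℤ) + a) n1) ∧
    (∀ a : ℤ, 0 ≤ a → χ m2 (-(n2 : ℤ) - a) = χ ((m2 : ℤ) + a) (-(n2 : ℤ))) ∧
    (∀ a : ℤ, (m1 : ℤ) ≤ a →
      χ a n1 =
        (prodL B2 z / prodL (F1 ++ F2) (fun f => -z f)) ^ ((m1 : ℤ) - a) *
          (prodLL B1 (F1 ++ F2) (fun b f => z b - z f) /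
            prodLL B2 B1 (fun b' b => z b' - z b))) ∧
    (∀ a : ℤ, (m2 : ℤ) ≤ a →
      χ a (-(n2 : ℤ)) =
        prodL B2 (fun b => z b ^ (((m1 : ℤ) - (n1 : ℤ)) - a - (n2 : ℤ))) *
          (prodLL B2 (F1 ++ F2) (fun b f => z b - z f) /
            prodLL B2 B1 (fun b' b => z b' - z b))) ∧
    (∀ s : ℤ, (n1 : ℤ) ≤ s →
      χ m1 s =
        prodL B1 (fun b => z b ^ (s - (n1 : ℤ))) *
          (prodLL B1 (F1 ++ F2) (fun b f => z b - z f) /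
            prodLL B2 B1 (fun b' b => z b' - z b))) ∧
    (∀ s : ℤ, s ≤ -(n2 : ℤ) →
      χ m2 s =
        prodL B2 (fun b => z b ^ (s - (m2 : ℤ) + ((m1 : ℤ) - (n1 : ℤ)))) *
          (prodLL B2 (F1 ++ F2) (fun b f => z b - z f) /
            prodLL B2 B1 (fun b' b => z b' - z b))) ∧
    (∀ s : ℤ, χ 0 s = 1) := by
  subst hm1 hm2 hn1 hn2
  have hinj : Set.InjOn z {i | i ∈ B1 ++ B2 ++ F1 ++ F2} := by
    intro i hi j hj h
    by_contra hne
    exact hzd i hi j hj hne h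
  have hnd' : ((B1 ++ B2 ++ F1 ++ F2).map z).Nodup := List.Nodup.map_on (fun i hi j hj h => hinj hi hj h) hnd
  simp only [List.map_append] at hnd'
  rw [List.append_assoc] at hnd'
  have hnn := List.nodup_append.1 hnd'
  have G : Good (B1.map z) (B2.map z) (F1.map z ++ F2.map z) := by
    refine ⟨hnn.1, hnn.2.1, ?_, ?_, ?_⟩
    · intro b hb hf; exact hnn.2.2 b hb b hf rfl
    · intro b hb
      rw [← List.map_append, List.mem_map] at hb
      obtain ⟨i, hi, rfl⟩ := hb
      exact hz0 i (by rw [List.append_assoc, List.mem_append]; exact Or.inl hi)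
    · intro b hb
      rw [← List.map_append, List.mem_map] at hb
      obtain ⟨i, hi, rfl⟩ := hb
      exact hz0 i (by rw [List.append_assoc, List.mem_append]; exact Or.inr hi)
  have H := forms_of_isChi _ _ _ _ χ G (isChi_map z B1 B2 F1 F2 χ hχ)
  have hn : (F1.map z ++ F2.map z).length = (F1.map z).length + (F2.map z).length := List.length_append
  have c0 := chi0 G hn H
  have cQ := Q_all G hn H c0
  have c1 := chi_n1' G hn H
  have c2 := chi_n2' G hn H
  have c3 := chi_m1 G hn H
  have c4 := chi_m2 G hn H
  have hneg : prodL (F1 ++ F2) (fun f => -z f) = (-1) ^ (F1.map z ++ F2.map z).length * (F1.map z ++ F2.map z).prod := by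
    unfold prodL; rw [prod_neg_list, List.map_append, hn]; simp
  have hz : ∀ L : List ι, prodL L z = (L.map z).prod := fun _ => rfl
  have hzp : ∀ (L : List ι) (e : ℤ), prodL L (fun b => z b ^ e) = (L.map z).prod ^ e := by
    intro L e
    rw [prodL_map z L (fun b => b ^ e), prodL, prod_zpow]
  have hV : ∀ L M : List ι, prodLL L M (fun a b => z a - z b) = prodLL (L.map z) (M.map z) (fun a b => a - b) :=
    fun L M => prodLL_map z L M (fun a b => a - b)
  rw [hneg, hz, hz]
  simp only [hzp, hV, List.map_append]
  have hp1 := G.p1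
  have hp2 := G.p2
  have hph := G.ph
  have hε : (-1 : ℂ) ^ (F1.map z ++ F2.map z).length ≠ 0 := pow_ne_zero _ (by norm_num)
  generalize (-1 : ℂ) ^ (F1.map z ++ F2.map z).length = ε at *
  simp only [List.length_map] at c1 c2 c3 c4
  refine ⟨cQ, ?_, ?_, c1, ?_, c3, c4, c0⟩
  · intro a ha
    rw [c3 _ (by omega), c1 _ (by omega), ← mul_assoc]
    congr 1
    rw [show (F1.length : ℤ) + a - F1.length = a by ring, show (B1.length : ℤ) - (B1.length + a) = -a by ring,
      zpow_neg, ← div_eq_mul_inv, ← div_zpow, List.prod_append]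
    congr 1
    field_simp
  · intro a ha
    rw [c4 _ (by omega), c2 _ (by omega)]
    congr 2
    ring
  · intro a ha
    rw [c2 a ha]


end Stmt0
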